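/- A drawing of a simple graph maps vertices to distinct points of the plane and edges to Jordan arcs, two arcs sharing at most one point, which is a common end-vertex or a proper crossing. It is IC-planar if each edge is crossed at most once and no two crossed edges share an end-vertex; an IC-plane graph is a graph with a fixed IC-planar embedding, i.e. a class of IC-planar drawings with the same faces, described by the cyclic order of the edges around each vertex, the crossing pairs of edges with the cyclic order around each crossing point, and the outer face. A graph is biconnected if it is connected and remains connected after removing any one vertex (the one-vertex graph counts as biconnected). A kite is a $K_4$ embedded so that all four vertices are on the boundary of its outer face, so that exactly one pair of its edges cross while the other four edges are uncrossed and belong to the boundary of the outer face; a kite induced in an IC-plane graph by the end-vertices of a pair of crossing edges is empty if no other vertex of the graph lies inside its internal faces. Let $G=(V,E)$ be an $n$-vertex IC-plane graph, $n\ge 1$. Then $G$ can be augmented to a biconnected IC-plane graph $G^+=(V,E^+)$ on the same vertex set, with $E\subseteq E^+$ and with a possibly different IC-planar embedding, such that in $G^+$ the four end-vertices of every pair of crossing edges induce an empty kite. Moreover, $G^+$ with its embedding can be computed from $G$ with its embedding in $O(n)$ time (on a random access machine with words of $O(\log n)$ bits). -/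

import Mathlib

/-! ## IC-planar embeddings

An embedding (a class of drawings with the same faces) is given by the data that determine it: the
counterclockwise order of the edges around every vertex, the pairs of edges that cross together
with the order of the four half-edges around each crossing point, and the outer face.  Such data
come from a drawing in the plane if and only if the plane map obtained by replacing the crossing
points by vertices satisfies Euler's formula on each connected component.

A dart `d` of a graph is an edge with a direction, from `d.fst` to `d.snd`; `d.symm` is the reverse.
-/

/-- An IC-planar embedding (up to the choice of the outer face) of the simple graph `G`, before
planarity is imposed: rotations and crossings.
* `rot d` is the dart that follows `d` counterclockwise among the darts that leave `d.fst`.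
* `cross d = none` if the edge of `d` is not crossed.  If it is crossed, then it is crossed once,
  and `cross d = some e` where the dart `e` traverses the other edge so that it passes from the
  right of `d` to the left of `d`.  Thus, seen from the crossing point, the half-edges towards
  `d.snd`, `e.snd`, `d.fst`, `e.fst` are in counterclockwise order.
* no two crossed edges share an end-vertex. -/
structure ICRotation {V : Type*} (G : SimpleGraph V) where
  rot : Equiv.Perm G.Dart
  rot_fst : ∀ d, (rot d).fst = d.fst
  rot_cyclic : ∀ d e : G.Dart, d.fst = e.fst → rot.SameCycle d e
  cross : G.Dart → Option G.Dart
  cross_turn : ∀ d e, cross d = some e → cross e = some d.symm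
  indep : ∀ d e : G.Dart, (cross d).isSome → (cross e).isSome → d.fst = e.fst → d = e

namespace ICRotation

variable {V : Type*} {G : SimpleGraph V} (R : ICRotation G)

theorem cross_get_isSome (d : G.Dart) (h : (R.cross d).isSome) :
    (R.cross ((R.cross d).get h)).isSome := by
  obtain ⟨e, he⟩ := Option.isSome_iff_exists.1 h
  simp [he, R.cross_turn d e he]

theorem cross_symm_isSome (d : G.Dart) (h : (R.cross d).isSome) :
    (R.cross d.symm).isSome := by
  obtain ⟨e, he⟩ := Option.isSome_iff_exists.1 h
  simp [R.cross_turn e d.symm (R.cross_turn d e he)]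

/-- The darts of the planarization, in which every crossing point is a vertex of degree four.
`Sum.inl d` is the part of `d` that starts at the vertex `d.fst` (all of `d` if `d` is not crossed,
its first half otherwise); `Sum.inr d` is the second half of the crossed dart `d`, which starts at
the crossing point. -/
abbrev Half : Type _ := G.Dart ⊕ {d : G.Dart // (R.cross d).isSome}

/-- The dart of `G` of which the given dart of the planarization is a part. -/
def under : R.Half → G.Dart
  | .inl d => d
  | .inr d => d.1

/-- The next dart of the planarization counterclockwise around the same starting point. -/
def turn : R.Half → R.Half
  | .inl d => .inl (R.rot d)
  | .inr d => .inr ⟨(R.cross d.1).get d.2, R.cross_get_isSome d.1 d.2⟩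

/-- The reverse of a dart of the planarization. -/
def flip : R.Half → R.Half
  | .inl d => if h : (R.cross d).isSome then .inr ⟨d.symm, R.cross_symm_isSome d h⟩
      else .inl d.symm
  | .inr d => .inl d.1.symm

/-- `R.FaceNext h k`: walking along the boundary of the face to the left of `h`, the dart `h` is
followed by `k`, i.e. `k` comes directly before the reverse of `h` in counterclockwise order. -/
def FaceNext (h k : R.Half) : Prop := R.turn k = R.flip h

/-- Every component of the planarization has genus zero, by Euler's formula
`#vertices + #faces = #edges + 2 #components`.  (Isolated vertices are left out on both sides; face
boundaries are counted separately for each component.) -/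
def Planar : Prop :=
  Nat.card (Quot fun h k => R.turn h = k) + Nat.card (Quot R.FaceNext) =
    Nat.card (Quot fun h k => R.flip h = k) +
      2 * Nat.card (Quot fun h k => R.turn h = k ∨ R.flip h = k)

/-- The edge of `G` containing the given dart of the planarization belongs to the subgraph of `G`
induced by `S`. -/
def InInduced (S : Set V) (h : R.Half) : Prop := (R.under h).fst ∈ S ∧ (R.under h).snd ∈ S

/-- The regions to the left of `h` and of `k` are in the same face of the drawing of the subgraph
induced by `S`: one gets from one to the other within faces of the whole drawing and across edges
that do not belong to this subgraph.  (This presumes that the planarization is connected.) -/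
def SameFaceOf (S : Set V) : R.Half → R.Half → Prop :=
  Relation.EqvGen fun h k => R.FaceNext h k ∨ (R.flip h = k ∧ ¬ R.InInduced S h)

end ICRotation

/-- An IC-plane graph with vertex set `{0, …, n - 1}`.  The outer face is the face to the left of
(the first part of) the dart `outer`; it is `none` only if there are no edges. -/
structure ICPlaneGraph (n : ℕ) where
  graph : SimpleGraph (Fin n)
  emb : ICRotation graph
  planar : emb.Planar
  outer : Option graph.Dart
  outer_isSome : Nonempty graph.Dart → outer.isSome

namespace ICPlaneGraph

variable {n : ℕ} (G : ICPlaneGraph n)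

/-- The region to the left of `h` is in the outer face of the drawing of the subgraph induced
by `S`. -/
def InOuterFaceOf (S : Set (Fin n)) (h : G.emb.Half) : Prop :=
  ∃ o, G.outer = some o ∧ G.emb.SameFaceOf S (.inl o) h

/-- The set of the end-vertices of two edges. -/
def ends (d e : G.graph.Dart) : Set (Fin n) := {d.fst, d.snd, e.fst, e.snd}

/-- The end-vertices of the crossing edges of `d` and `e` induce a kite: any two of them are
adjacent, all of them are on the boundary of the outer face of the induced subgraph, and the other
four edges are not crossed and belong to the boundary of this outer face. -/
def InducesKite (d e : G.graph.Dart) : Prop :=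
  (∀ u ∈ G.ends d e, ∀ v ∈ G.ends d e, u ≠ v → G.graph.Adj u v) ∧
  (∀ v ∈ G.ends d e, ∃ f : G.graph.Dart, f.fst = v ∧ f.snd ∈ G.ends d e ∧
    G.InOuterFaceOf (G.ends d e) (.inl f)) ∧
  (∀ f : G.graph.Dart, f.fst ∈ G.ends d e → f.snd ∈ G.ends d e → f.edge ≠ d.edge →
    f.edge ≠ e.edge → G.emb.cross f = none ∧
      (G.InOuterFaceOf (G.ends d e) (.inl f) ∨ G.InOuterFaceOf (G.ends d e) (.inl f.symm)))

/-- The end-vertices of the crossing edges of `d` and `e` induce an empty kite: they induce a kite,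
and every other vertex is in the outer face of the kite.  (Used for connected graphs, where every
other vertex has an incident edge.) -/
def InducesEmptyKite (d e : G.graph.Dart) : Prop :=
  G.InducesKite d e ∧
  ∀ f : G.graph.Dart, f.fst ∉ G.ends d e → G.InOuterFaceOf (G.ends d e) (.inl f)

end ICPlaneGraph

/-- A graph is biconnected if it is connected and remains connected after removing any one vertex
(if nothing is left after the removal, there is nothing to check). -/
def Biconnected {V : Type*} (H : SimpleGraph V) : Prop :=
  H.Connected ∧ ∀ v : V, (H.induce {u : V | u ≠ v}).Preconnected

/-! ## A random access machine -/

namespace RAM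

/-- The memory: registers and arrays of natural numbers.  A program names finitely many of them. -/
structure Mem where
  reg : ℕ → ℕ
  arr : ℕ → ℕ → ℕ

/-- `r := x`. -/
def Mem.setReg (s : Mem) (r x : ℕ) : Mem := { s with reg := Function.update s.reg r x }

/-- `a[i] := x`. -/
def Mem.setArr (s : Mem) (a i x : ℕ) : Mem :=
  { s with arr := Function.update s.arr a (Function.update (s.arr a) i x) }

/-- Programs of a random access machine, with structured control.  The operands are names of
registers (`r`, `p`, `q`) and of arrays (`a`), and constants (`k`). -/
inductive Prog where
  /-- do nothing -/
  | skip
  /-- `r := k` -/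
  | const (r k : ℕ)
  /-- `r := p` -/
  | move (r p : ℕ)
  /-- `r := p + q` -/
  | add (r p q : ℕ)
  /-- `r := p - q` (zero if `p < q`) -/
  | sub (r p q : ℕ)
  /-- `r := a[p]` -/
  | load (r a p : ℕ)
  /-- `a[p] := q` -/
  | store (a p q : ℕ)
  | seq (c₁ c₂ : Prog)
  /-- `if p < q then c₁ else c₂` -/
  | ifLt (p q : ℕ) (c₁ c₂ : Prog)
  /-- `while p < q do c` -/
  | whileLt (p q : ℕ) (c : Prog)

/-- `Exec W c s t s'`: started in memory `s`, the program `c` halts after `t` steps in memory `s'`,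
on a machine whose words hold the numbers `0, …, W` (a run that would compute a larger number is
not an execution).  Every elementary instruction and every evaluation of a test is one step. -/
inductive Exec (W : ℕ) : Prog → Mem → ℕ → Mem → Prop
  | skip (s) : Exec W .skip s 1 s
  | const (s r k) : k ≤ W → Exec W (.const r k) s 1 (s.setReg r k)
  | move (s r p) : s.reg p ≤ W → Exec W (.move r p) s 1 (s.setReg r (s.reg p))
  | add (s r p q) : s.reg p + s.reg q ≤ W →
      Exec W (.add r p q) s 1 (s.setReg r (s.reg p + s.reg q))
  | sub (s r p q) : s.reg p - s.reg q ≤ W →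
      Exec W (.sub r p q) s 1 (s.setReg r (s.reg p - s.reg q))
  | load (s r a p) : s.arr a (s.reg p) ≤ W →
      Exec W (.load r a p) s 1 (s.setReg r (s.arr a (s.reg p)))
  | store (s a p q) : s.reg q ≤ W →
      Exec W (.store a p q) s 1 (s.setArr a (s.reg p) (s.reg q))
  | seq {s₁ s₂ s₃ c₁ c₂ t₁ t₂} : Exec W c₁ s₁ t₁ s₂ → Exec W c₂ s₂ t₂ s₃ →
      Exec W (.seq c₁ c₂) s₁ (t₁ + t₂) s₃
  | ifTrue {s s' p q c₁ c₂ t} : s.reg p < s.reg q → Exec W c₁ s t s' →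
      Exec W (.ifLt p q c₁ c₂) s (t + 1) s'
  | ifFalse {s s' p q c₁ c₂ t} : ¬ s.reg p < s.reg q → Exec W c₂ s t s' →
      Exec W (.ifLt p q c₁ c₂) s (t + 1) s'
  | whileTrue {s₁ s₂ s₃ p q c t₁ t₂} : s₁.reg p < s₁.reg q → Exec W c s₁ t₁ s₂ →
      Exec W (.whileLt p q c) s₂ t₂ s₃ → Exec W (.whileLt p q c) s₁ (t₁ + t₂ + 1) s₃
  | whileFalse {s p q c} : ¬ s.reg p < s.reg q → Exec W (.whileLt p q c) s 1 s

end RAM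

/-! ## Representation of an IC-plane graph in the memory -/

namespace ICPlaneGraph

variable {n : ℕ}

/-- The number of a dart that may be absent: zero if it is absent, one plus its index otherwise. -/
def optIndex {α : Type*} {m : ℕ} (ι : α ≃ Fin m) : Option α → ℕ
  | none => 0
  | some d => (ι d : ℕ) + 1

/-- The contents of array `a` at the entry of dart `d`, the darts being numbered by `ι`:
`d.fst` in array 0, the reverse of `d` in array 1, the dart after `d` in counterclockwise order
around `d.fst` in array 2, and the dart that crosses `d` from right to left in array 3. -/
def entry (G : ICPlaneGraph n) {m : ℕ} (ι : G.graph.Dart ≃ Fin m) (d : G.graph.Dart) : ℕ → ℕ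
  | 0 => (d.fst : ℕ)
  | 1 => (ι d.symm : ℕ)
  | 2 => (ι (G.emb.rot d) : ℕ)
  | 3 => optIndex ι (G.emb.cross d)
  | _ => 0

/-- The memory that holds `G` and nothing else.  Register 0 contains the number of vertices,
register 1 the number of darts, register 2 the dart of the outer face; the arrays contain the
entries of the darts. -/
def memory (G : ICPlaneGraph n) {m : ℕ} (ι : G.graph.Dart ≃ Fin m) : RAM.Mem where
  reg
    | 0 => n
    | 1 => m
    | 2 => optIndex ι G.outer
    | _ => 0
  arr a i := if h : i < m then G.entry ι (ι.symm ⟨i, h⟩) a else 0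

/-- The memory `s` contains a representation of `G` (for some numbering of its darts), and possibly
other things in the remaining cells. -/
def StoredIn (G : ICPlaneGraph n) (s : RAM.Mem) : Prop :=
  ∃ (m : ℕ) (ι : G.graph.Dart ≃ Fin m),
    (∀ r < 3, s.reg r = (G.memory ι).reg r) ∧
    (∀ a < 4, ∀ i < m, s.arr a i = (G.memory ι).arr a i)

end ICPlaneGraph

set_option linter.unusedSectionVars false

/-! ## Counting classes of relations and orbits of permutations -/

section Counting

open Relation

variable {X Y U : Type*}

theorem card_quot_congr {r : X → X → Prop} {r' : X → X → Prop}
    (h : ∀ x y, r x y → EqvGen r' x y) (h' : ∀ x y, r' x y → EqvGen r x y) :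
    Nat.card (Quot r) = Nat.card (Quot r') :=
  Nat.card_congr
    { toFun := Quot.lift (Quot.mk r') fun x y hxy => Quot.eqvGen_sound (h x y hxy)
      invFun := Quot.lift (Quot.mk r) fun x y hxy => Quot.eqvGen_sound (h' x y hxy)
      left_inv := by rintro ⟨x⟩; rfl
      right_inv := by rintro ⟨x⟩; rfl }

theorem card_quot_equiv (e : X ≃ Y) {r : X → X → Prop} {r' : Y → Y → Prop}
    (h : ∀ x y, r x y ↔ r' (e x) (e y)) : Nat.card (Quot r) = Nat.card (Quot r') :=
  Nat.card_congr (Quot.congr e h)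

theorem card_quot_sum [Finite X] [Finite U] {r : X ⊕ U → X ⊕ U → Prop} {r₁ : X → X → Prop}
    {r₂ : U → U → Prop} (h₁ : ∀ x y, r (.inl x) (.inl y) ↔ r₁ x y)
    (h₂ : ∀ x y, r (.inr x) (.inr y) ↔ r₂ x y) (h₃ : ∀ x y, ¬ r (.inl x) (.inr y))
    (h₄ : ∀ x y, ¬ r (.inr x) (.inl y)) :
    Nat.card (Quot r) = Nat.card (Quot r₁) + Nat.card (Quot r₂) := by
  rw [← Nat.card_sum]
  have hl : ∀ x y, r x y →
      Sum.elim (fun x => Sum.inl (Quot.mk r₁ x)) (fun x => Sum.inr (Quot.mk r₂ x)) x =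
      Sum.elim (fun x => Sum.inl (Quot.mk r₁ x)) (fun x => Sum.inr (Quot.mk r₂ x)) y := by
    rintro (x | x) (y | y) hxy
    · exact congrArg Sum.inl (Quot.sound ((h₁ x y).1 hxy))
    · exact absurd hxy (h₃ x y)
    · exact absurd hxy (h₄ x y)
    · exact congrArg Sum.inr (Quot.sound ((h₂ x y).1 hxy))
  exact Nat.card_congr
    { toFun := Quot.lift _ hl
      invFun := Sum.elim
        (Quot.lift (fun x => Quot.mk _ (.inl x)) fun x y hxy => Quot.sound ((h₁ x y).2 hxy))
        (Quot.lift (fun x => Quot.mk _ (.inr x)) fun x y hxy => Quot.sound ((h₂ x y).2 hxy))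
      left_inv := by rintro ⟨x | x⟩ <;> rfl
      right_inv := by rintro (x | x) <;> induction x using Quot.ind <;> rfl }

/-- The relation `r` together with the pair `(a, b)`. -/
def joinPair (r : X → X → Prop) (a b : X) (x y : X) : Prop := r x y ∨ (x = a ∧ y = b)

theorem card_quot_joinPair_of_rel {r : X → X → Prop} {a b : X} (h : EqvGen r a b) :
    Nat.card (Quot (joinPair r a b)) = Nat.card (Quot r) := by
  refine card_quot_congr ?_ fun x y hxy => .rel _ _ (.inl hxy)
  rintro x y (hxy | ⟨rfl, rfl⟩)
  exacts [.rel _ _ hxy, h]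

theorem card_quot_joinPair_of_not_rel [Finite X] {r : X → X → Prop} {a b : X}
    (h : ¬ EqvGen r a b) : Nat.card (Quot (joinPair r a b)) + 1 = Nat.card (Quot r) := by
  classical
  have hab : Quot.mk r a ≠ Quot.mk r b := fun e => h (Quot.eqvGen_exact e)
  rw [← Finite.card_option]
  refine Nat.card_congr ((Equiv.optionCongr ?_).trans (Equiv.optionSubtypeNe (Quot.mk r b)))
  refine
    { toFun := Quot.lift (fun x => if hx : Quot.mk r x = Quot.mk r b then ⟨Quot.mk r a, hab⟩
        else ⟨Quot.mk r x, hx⟩) ?_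
      invFun := fun q => Quot.lift (Quot.mk (joinPair r a b))
        (fun x y hxy => Quot.sound (.inl hxy)) q.1
      left_inv := ?_
      right_inv := ?_ }
  · rintro x y (hxy | ⟨rfl, rfl⟩)
    · simp [Quot.sound hxy]
    · simp [hab]
  · rintro ⟨x⟩
    by_cases hx : Quot.mk r x = Quot.mk r b
    · simp only [hx, dite_true]
      have h1 : Quot.mk (joinPair r a b) a = Quot.mk _ b := Quot.sound (.inr ⟨rfl, rfl⟩)
      have h2 : Quot.mk (joinPair r a b) x = Quot.mk _ b :=
        Quot.eqvGen_sound ((Quot.eqvGen_exact hx).mono fun _ _ => Or.inl)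
      exact h1.trans h2.symm
    · simp [hx]
  · rintro ⟨⟨x⟩, hx⟩
    exact dif_neg hx

/-- The number of orbits of `f`. -/
noncomputable def orbCount (f : X → X) : ℕ := Nat.card (Quot fun x y => f x = y)

/-- `x` and `y` are in the same component of the map given by `f` and `g`. -/
def Linked (f g : X → X) : X → X → Prop := EqvGen fun x y => f x = y ∨ g x = y

/-- The number of components of the map given by `f` and `g`. -/
noncomputable def compCount (f g : X → X) : ℕ := Nat.card (Quot fun x y => f x = y ∨ g x = y)

theorem eqvGen_perm_iff [Finite X] (σ : Equiv.Perm X) (x y : X) :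
    EqvGen (fun x y => σ x = y) x y ↔ σ.SameCycle x y := by
  constructor
  · intro h
    induction h with
    | rel x y h => exact ⟨1, by simpa using h⟩
    | refl x => exact .refl _ _
    | symm x y _ ih => exact ih.symm
    | trans x y z _ _ ih ih' => exact ih.trans ih'
  · intro h
    obtain ⟨i, rfl⟩ := h.exists_nat_pow_eq
    clear h
    induction i with
    | zero => exact .refl _
    | succ i ih =>
      refine ih.trans _ _ _ (.rel _ _ ?_)
      rw [pow_succ']; rfl

theorem Linked.of_sameCycle [Finite X] {σ : Equiv.Perm X} {g : X → X} {x y : X}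
    (h : σ.SameCycle x y) : Linked σ g x y :=
  ((eqvGen_perm_iff σ x y).2 h).mono fun _ _ => Or.inl

theorem mem_iff_of_linked {f g : X → X} {Z : Set X} (hf : ∀ x, f x ∈ Z ↔ x ∈ Z)
    (hg : ∀ x, g x ∈ Z ↔ x ∈ Z) {x y : X} (h : Linked f g x y) : x ∈ Z ↔ y ∈ Z := by
  induction h with
  | rel x y h => rcases h with rfl | rfl; exacts [(hf x).symm, (hg x).symm]
  | refl x => rfl
  | symm x y _ ih => exact ih.symm
  | trans x y z _ _ ih ih' => exact ih.trans ih'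

theorem mem_of_sameCycle [Finite X] {σ : Equiv.Perm X} {Z : Set X} (h : ∀ x ∈ Z, σ x ∈ Z) {x y : X}
    (hxy : σ.SameCycle x y) (hx : x ∈ Z) : y ∈ Z := by
  obtain ⟨i, rfl⟩ := hxy.exists_nat_pow_eq
  clear hxy
  induction i with
  | zero => exact hx
  | succ i ih => rw [pow_succ']; exact h _ ih

theorem apply_mem_iff [Finite X] {σ : Equiv.Perm X} {Z : Set X} (h : ∀ x ∈ Z, σ x ∈ Z) (x : X) :
    σ x ∈ Z ↔ x ∈ Z :=
  ⟨mem_of_sameCycle h (Equiv.Perm.SameCycle.symm ⟨1, by simp⟩), h x⟩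

section Swap

variable [Finite X] [DecidableEq X] (σ : Equiv.Perm X) {a b : X}

theorem mul_swap_left (a b : X) : (σ * Equiv.swap a b) a = σ b := by simp

theorem mul_swap_right (a b : X) : (σ * Equiv.swap a b) b = σ a := by simp

theorem mul_swap_of_ne {x : X} (ha : x ≠ a) (hb : x ≠ b) : (σ * Equiv.swap a b) x = σ x := by
  simp [Equiv.swap_apply_of_ne_of_ne ha hb]

theorem sameCycle_mul_swap (h : ¬ σ.SameCycle a b) : (σ * Equiv.swap a b).SameCycle a b := by
  by_contra hc
  have key : ∀ i : ℕ, ((σ * Equiv.swap a b) ^ (i + 1)) a = (σ ^ (i + 1)) b := by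
    intro i
    induction i with
    | zero => simp
    | succ i ih =>
      rw [pow_succ', Equiv.Perm.mul_apply, ih, pow_succ' σ (i + 1), Equiv.Perm.mul_apply]
      refine mul_swap_of_ne σ ?_ ?_
      · intro e
        exact h (Equiv.Perm.SameCycle.symm ⟨(i + 1 : ℕ), by rw [zpow_natCast]; exact e⟩)
      · intro e
        exact hc ⟨(i + 1 : ℕ), by rw [zpow_natCast, ih, e]⟩
  have h1 := key (orderOf σ - 1)
  have h2 : orderOf σ - 1 + 1 = orderOf σ := Nat.sub_add_cancel (orderOf_pos σ)
  rw [h2, pow_orderOf_eq_one] at h1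
  exact hc ⟨(orderOf σ : ℕ), by rw [zpow_natCast, h1]; rfl⟩

theorem not_sameCycle_mul_swap (hab : a ≠ b) (h : σ.SameCycle a b) :
    ¬ (σ * Equiv.swap a b).SameCycle a b := by
  classical
  have hex : ∃ j, (σ ^ (j + 1)) b = a := by
    obtain ⟨i, hi⟩ := h.symm.exists_nat_pow_eq
    rcases i with - | i
    · exact absurd hi.symm hab
    · exact ⟨i, hi⟩
  set j := Nat.find hex with hj
  have hja : (σ ^ (j + 1)) b = a := Nat.find_spec hex
  have hmin : ∀ i < j, (σ ^ (i + 1)) b ≠ a := fun i hi => Nat.find_min hex hi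
  have hnb : ∀ i < j, (σ ^ (i + 1)) b ≠ b := by
    intro i hi e
    refine hmin (j - (i + 1)) (by omega) ?_
    have h1 : j + 1 = (j - (i + 1) + 1) + (i + 1) := by omega
    rw [h1, pow_add, Equiv.Perm.mul_apply, e] at hja
    exact hja
  intro hc
  have : b ∈ {x | ∃ i ≤ j, x = (σ ^ (i + 1)) b} := by
    refine mem_of_sameCycle ?_ hc ⟨j, le_rfl, hja.symm⟩
    rintro x ⟨i, hi, rfl⟩
    rcases hi.lt_or_eq with hi | rfl
    · refine ⟨i + 1, hi, ?_⟩
      rw [mul_swap_of_ne σ (hmin i hi) (hnb i hi), pow_succ' σ (i + 1)]; rfl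
    · refine ⟨0, Nat.zero_le _, ?_⟩
      rw [hja, mul_swap_left]; simp
  obtain ⟨i, hi, e⟩ := this
  rcases hi.lt_or_eq with hi | rfl
  · exact hnb i hi e.symm
  · exact hab (hja.symm.trans e.symm)

theorem Equiv.Perm.SameCycle.mul_swap (h : ¬ σ.SameCycle a b) {x y : X} (hxy : σ.SameCycle x y) :
    (σ * Equiv.swap a b).SameCycle x y := by
  refine mem_of_sameCycle (Z := {z | (σ * Equiv.swap a b).SameCycle x z}) ?_ hxy (.refl _ _)
  intro z hz
  have hab := sameCycle_mul_swap σ h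
  have hs : ∀ z, (σ * Equiv.swap a b).SameCycle z ((σ * Equiv.swap a b) z) := fun z => ⟨1, by simp⟩
  change (σ * Equiv.swap a b).SameCycle x (σ z)
  by_cases hza : z = a
  · rw [hza] at hz ⊢
    have := hs b
    rw [mul_swap_right] at this
    exact (hz.trans hab).trans this
  · by_cases hzb : z = b
    · rw [hzb] at hz ⊢
      have := hs a
      rw [mul_swap_left] at this
      exact (hz.trans hab.symm).trans this
    · have := hs z
      rw [mul_swap_of_ne σ hza hzb] at this
      exact hz.trans this

theorem Equiv.Perm.SameCycle.swap_mul (h : ¬ σ.SameCycle a b) {x y : X} (hxy : σ.SameCycle x y) :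
    (Equiv.swap a b * σ).SameCycle x y := by
  have h1 := Equiv.Perm.SameCycle.mul_swap σ⁻¹ (a := a) (b := b)
    (by rwa [Equiv.Perm.sameCycle_inv]) (Equiv.Perm.sameCycle_inv.2 hxy)
  rw [← Equiv.Perm.sameCycle_inv] at h1
  simpa using h1

theorem sameCycle_swap_mul (h : ¬ σ.SameCycle a b) : (Equiv.swap a b * σ).SameCycle a b := by
  have h1 := sameCycle_mul_swap σ⁻¹ (a := a) (b := b) (by rwa [Equiv.Perm.sameCycle_inv])
  rw [← Equiv.Perm.sameCycle_inv] at h1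
  simpa using h1

theorem eqvGen_joinPair_swap {Q : X → X → Prop} {x y : X}
    (h : σ x = y) : EqvGen (joinPair (fun x y => (σ * Equiv.swap a b) x = y ∨ Q x y) a b) x y := by
  have hab : EqvGen (joinPair (fun x y => (σ * Equiv.swap a b) x = y ∨ Q x y) a b) a b :=
    .rel _ _ (.inr ⟨rfl, rfl⟩)
  by_cases hxa : x = a
  · have hxb : EqvGen (joinPair (fun x y => (σ * Equiv.swap a b) x = y ∨ Q x y) a b) x b := by
      rw [hxa]; exact hab
    refine hxb.trans _ _ _ (.rel _ _ (.inl (.inl ?_)))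
    rw [mul_swap_right, ← hxa, h]
  · by_cases hxb : x = b
    · have hxa : EqvGen (joinPair (fun x y => (σ * Equiv.swap a b) x = y ∨ Q x y) a b) x a := by
        rw [hxb]; exact hab.symm
      refine hxa.trans _ _ _ (.rel _ _ (.inl (.inl ?_)))
      rw [mul_swap_left, ← hxb, h]
    · exact .rel _ _ (.inl (.inl (by rw [mul_swap_of_ne σ hxa hxb, h])))

theorem card_quot_joinPair_swap (Q : X → X → Prop) :
    Nat.card (Quot (joinPair (fun x y => (σ * Equiv.swap a b) x = y ∨ Q x y) a b)) =
      Nat.card (Quot (joinPair (fun x y => σ x = y ∨ Q x y) a b)) := by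
  refine card_quot_congr ?_ ?_
  · rintro x y ((h | h) | h)
    · have := eqvGen_joinPair_swap (σ * Equiv.swap a b) (a := a) (b := b) (Q := Q) h
      rwa [mul_assoc, Equiv.swap_mul_self, mul_one] at this
    · exact .rel _ _ (.inl (.inr h))
    · exact .rel _ _ (.inr h)
  · rintro x y ((h | h) | h)
    · exact eqvGen_joinPair_swap σ h
    · exact .rel _ _ (.inl (.inr h))
    · exact .rel _ _ (.inr h)

theorem orbCount_mul_swap_of_not_sameCycle (h : ¬ σ.SameCycle a b) :
    orbCount (σ * Equiv.swap a b) + 1 = orbCount σ := by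
  have key := card_quot_joinPair_swap σ (a := a) (b := b) (fun _ _ => False)
  simp only [or_false] at key
  rw [card_quot_joinPair_of_rel ((eqvGen_perm_iff _ _ _).2 (sameCycle_mul_swap σ h))] at key
  rw [orbCount, orbCount, key]
  exact card_quot_joinPair_of_not_rel fun hc => h ((eqvGen_perm_iff _ _ _).1 hc)

theorem orbCount_mul_swap_of_sameCycle (hab : a ≠ b) (h : σ.SameCycle a b) :
    orbCount (σ * Equiv.swap a b) = orbCount σ + 1 := by
  have := orbCount_mul_swap_of_not_sameCycle _ (not_sameCycle_mul_swap σ hab h)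
  rw [mul_assoc, Equiv.swap_mul_self, mul_one] at this
  exact this.symm

theorem orbCount_inv : orbCount (σ⁻¹ : Equiv.Perm X) = orbCount σ := by
  refine card_quot_congr ?_ ?_
  · rintro x y rfl
    exact .symm _ _ (.rel _ _ (by simp))
  · rintro x y rfl
    exact .symm _ _ (.rel _ _ (by simp))

theorem swap_mul_eq_inv (φ : Equiv.Perm X) :
    Equiv.swap a b * φ = (φ⁻¹ * Equiv.swap a b)⁻¹ := by simp

theorem orbCount_swap_mul_of_not_sameCycle (h : ¬ σ.SameCycle a b) :
    orbCount (Equiv.swap a b * σ) + 1 = orbCount σ := by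
  rw [swap_mul_eq_inv, orbCount_inv, ← orbCount_inv σ]
  exact orbCount_mul_swap_of_not_sameCycle _ (by rwa [Equiv.Perm.sameCycle_inv])

theorem orbCount_swap_mul_of_sameCycle (hab : a ≠ b) (h : σ.SameCycle a b) :
    orbCount (Equiv.swap a b * σ) = orbCount σ + 1 := by
  rw [swap_mul_eq_inv, orbCount_inv, ← orbCount_inv σ]
  exact orbCount_mul_swap_of_sameCycle _ hab (by rwa [Equiv.Perm.sameCycle_inv])

theorem compCount_mul_swap_of_linked (α : X → X) (h : Linked σ α a b)
    (h' : Linked (σ * Equiv.swap a b : Equiv.Perm X) α a b) :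
    compCount (σ * Equiv.swap a b : Equiv.Perm X) α = compCount σ α := by
  have key := card_quot_joinPair_swap σ (a := a) (b := b) (fun x y => α x = y)
  rwa [card_quot_joinPair_of_rel h, card_quot_joinPair_of_rel h'] at key

theorem compCount_mul_swap_of_not_linked (α : X → X) (h : ¬ Linked σ α a b) :
    compCount (σ * Equiv.swap a b : Equiv.Perm X) α + 1 = compCount σ α := by
  have key := card_quot_joinPair_swap σ (a := a) (b := b) (fun x y => α x = y)
  have h' : Linked (σ * Equiv.swap a b : Equiv.Perm X) α a b :=
    .of_sameCycle (sameCycle_mul_swap σ fun hc => h (.of_sameCycle hc))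
  rw [card_quot_joinPair_of_rel h'] at key
  rw [compCount, compCount, key]
  exact card_quot_joinPair_of_not_rel h

end Swap

theorem orbCount_one : orbCount (1 : Equiv.Perm X) = Nat.card X := by
  refine Nat.card_congr ⟨Quot.lift id fun x y h => h, Quot.mk _, ?_, fun x => rfl⟩
  rintro ⟨x⟩; rfl

/-- An involution without fixed points has half as many orbits as points. -/
theorem card_eq_two_mul_orbCount [Finite X] {α : X → X} (h : ∀ x, α (α x) = x)
    (hne : ∀ x, α x ≠ x) : Nat.card X = 2 * orbCount α := by
  classical
  have hrep : ∀ x : X, (Quot.mk (fun x y => α x = y) x).out = x ∨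
      (Quot.mk (fun x y => α x = y) x).out = α x := by
    intro x
    have h1 : EqvGen (fun x y => α x = y) (Quot.mk (fun x y => α x = y) x).out x :=
      Quot.eqvGen_exact (Quot.out_eq _)
    generalize (Quot.mk (fun x y => α x = y) x).out = z at h1
    induction h1 with
    | rel x y e => right; rw [← e, h]
    | refl x => left; rfl
    | symm x y _ ih => rcases ih with e | e <;> simp [e, h]
    | trans x y z _ _ ih ih' => rcases ih with e | e <;> rcases ih' with e' | e' <;> simp [e, e', h]
  have e : X ≃ Bool × Quot (fun x y => α x = y) :=
    { toFun := fun x => (decide ((Quot.mk (fun x y => α x = y) x).out = x), Quot.mk _ x)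
      invFun := fun p => if p.1 then p.2.out else α p.2.out
      left_inv := by
        intro x
        rcases hrep x with e | e
        · simp [e]
        · simp [e, hne, h]
      right_inv := by
        rintro ⟨b, q⟩
        have hq : Quot.mk (fun x y => α x = y) q.out = q := Quot.out_eq q
        have hq' : Quot.mk (fun x y => α x = y) (α q.out) = q := by
          rw [← Quot.sound (r := fun x y => α x = y) (a := q.out) rfl, hq]
        cases b
        · simp [hq', (hne q.out).symm]
        · simp [hq] }
  rw [Nat.card_congr e, Nat.card_prod]
  simp [orbCount]

end Counting

/-! ## Maps of genus zero -/

section Genus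

open Relation

variable {X Y U : Type*}

/-- Euler's formula, with genus zero for every component, for the map with vertex rotation `f` and
edge involution `g`. -/
def Flat (f g : X → X) : Prop :=
  Nat.card (Quot fun h k => f h = k) + Nat.card (Quot fun h k => f k = g h) =
    Nat.card (Quot fun h k => g h = k) + 2 * Nat.card (Quot fun h k => f h = k ∨ g h = k)

theorem face_quot_eq (σ α : Equiv.Perm X) :
    Nat.card (Quot fun h k => σ k = α h) = orbCount (σ⁻¹ * α) := by
  have : (fun h k => σ k = α h) = fun h k => (σ⁻¹ * α) h = k := by
    funext h k
    rw [Equiv.Perm.mul_apply, Equiv.Perm.inv_eq_iff_eq]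
    exact propext eq_comm
  rw [orbCount, this]

theorem flat_iff (σ α : Equiv.Perm X) :
    Flat σ α ↔ orbCount σ + orbCount (σ⁻¹ * α) = orbCount α + 2 * compCount σ α := by
  rw [← face_quot_eq]; rfl

theorem flat_congr (e : X ≃ Y) {f g : X → X} {f' g' : Y → Y} (hf : ∀ x, e (f x) = f' (e x))
    (hg : ∀ x, e (g x) = g' (e x)) : Flat f g ↔ Flat f' g' := by
  unfold Flat
  rw [card_quot_equiv e (r := fun h k => f h = k) (r' := fun h k => f' h = k)
      fun x y => by rw [← hf, e.apply_eq_iff_eq],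
    card_quot_equiv e (r := fun h k => f k = g h) (r' := fun h k => f' k = g' h)
      fun x y => by rw [← hf, ← hg, e.apply_eq_iff_eq],
    card_quot_equiv e (r := fun h k => g h = k) (r' := fun h k => g' h = k)
      fun x y => by rw [← hg, e.apply_eq_iff_eq],
    card_quot_equiv e (r := fun h k => f h = k ∨ g h = k) (r' := fun h k => f' h = k ∨ g' h = k)
      fun x y => by rw [← hf, ← hg, e.apply_eq_iff_eq, e.apply_eq_iff_eq]]

/-- Isolated edges do not matter for Euler's formula. -/
theorem flat_sum_iff [Finite X] [Finite U] {f g : X → X} {ρ : U → U} (h : ∀ x, ρ (ρ x) = x)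
    (hne : ∀ x, ρ x ≠ x) : Flat (Sum.map f id) (Sum.map g ρ) ↔ Flat f g := by
  have h1 := card_eq_two_mul_orbCount h hne
  have h0 : Nat.card (Quot fun x y : U => id x = y) = Nat.card U := orbCount_one
  have h3 : Nat.card (Quot fun x y : U => id y = ρ x) = orbCount ρ :=
    card_quot_congr (fun x y e => .rel _ _ e.symm) (fun x y e => .rel _ _ e.symm)
  have h4 : Nat.card (Quot fun x y : U => id x = y ∨ ρ x = y) = orbCount ρ := by
    refine card_quot_congr ?_ fun x y e => .rel _ _ (.inr e)
    rintro x y (rfl | e)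
    exacts [.refl _, .rel _ _ e]
  unfold Flat
  rw [card_quot_sum (r := fun h k => Sum.map f id h = k) (r₁ := fun h k => f h = k)
      (r₂ := fun h k => id h = k) (by simp) (by simp) (by simp) (by simp),
    card_quot_sum (r := fun h k => Sum.map f id k = Sum.map g ρ h) (r₁ := fun h k => f k = g h)
      (r₂ := fun h k => id k = ρ h) (by simp) (by simp) (by simp) (by simp),
    card_quot_sum (r := fun h k => Sum.map g ρ h = k) (r₁ := fun h k => g h = k)
      (r₂ := fun h k => ρ h = k) (by simp) (by simp) (by simp) (by simp),
    card_quot_sum (r := fun h k => Sum.map f id h = k ∨ Sum.map g ρ h = k)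
      (r₁ := fun h k => f h = k ∨ g h = k)
      (r₂ := fun h k => id h = k ∨ ρ h = k) (by simp) (by simp) (by simp) (by simp), h0, h3, h4]
  change _ + Nat.card U + (_ + orbCount ρ) = _ + orbCount ρ + 2 * (_ + orbCount ρ) ↔ _
  omega

variable [Finite X] [DecidableEq X] {σ α : Equiv.Perm X} {a b : X}

theorem face_mul_swap (σ α : Equiv.Perm X) (a b : X) :
    (σ * Equiv.swap a b)⁻¹ * α = Equiv.swap a b * (σ⁻¹ * α) := by simp [mul_assoc]

theorem Linked.of_face (h : (σ⁻¹ * α).SameCycle a b) : Linked σ α a b := by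
  have h1 := (eqvGen_perm_iff _ _ _).2 h
  clear h
  induction h1 with
  | rel x y h =>
    refine (EqvGen.rel x (α x) (.inr rfl)).trans _ _ _ (.symm _ _ (.rel _ _ (.inl ?_)))
    rw [← h]; simp
  | refl x => exact .refl _
  | symm x y _ ih => exact ih.symm
  | trans x y z _ _ ih ih' => exact ih.trans _ _ _ ih'

theorem euler_le_of_split (hab : a ≠ b) (h : σ.SameCycle a b)
    (hs : orbCount (σ * Equiv.swap a b : Equiv.Perm X) +
      orbCount ((σ * Equiv.swap a b)⁻¹ * α : Equiv.Perm X) ≤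
      orbCount α + 2 * compCount (σ * Equiv.swap a b : Equiv.Perm X) α) :
    orbCount σ + orbCount (σ⁻¹ * α) ≤ orbCount α + 2 * compCount σ α := by
  have hV := orbCount_mul_swap_of_sameCycle σ hab h
  by_cases hl : Linked (σ * Equiv.swap a b : Equiv.Perm X) α a b
  · have hC := compCount_mul_swap_of_linked σ α (.of_sameCycle h) hl
    rw [face_mul_swap] at hs
    by_cases hf : (σ⁻¹ * α).SameCycle a b
    · have := orbCount_swap_mul_of_sameCycle _ hab hf
      omega
    · have := orbCount_swap_mul_of_not_sameCycle _ hf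
      omega
  · have hC := compCount_mul_swap_of_not_linked _ α hl
    rw [mul_assoc, Equiv.swap_mul_self, mul_one] at hC
    have hF := orbCount_swap_mul_of_not_sameCycle _ fun hc => hl (.of_face hc)
    rw [← face_mul_swap, mul_assoc, Equiv.swap_mul_self, mul_one] at hF
    omega

/-- The genus is not negative. -/
theorem euler_le (hα : ∀ x, α (α x) = x) (hne : ∀ x, α x ≠ x) (σ : Equiv.Perm X) :
    orbCount σ + orbCount (σ⁻¹ * α) ≤ orbCount α + 2 * compCount σ α := by
  have hle : ∀ σ : Equiv.Perm X, orbCount σ ≤ Nat.card X := fun σ =>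
    Nat.card_le_card_of_surjective _ Quot.mk_surjective
  induction hk : Nat.card X - orbCount σ generalizing σ with
  | zero =>
    by_cases h1 : σ = 1
    · subst h1
      have h1 := card_eq_two_mul_orbCount hα hne
      have h4 : compCount (1 : Equiv.Perm X) α = orbCount α := by
        refine card_quot_congr ?_ fun x y e => .rel _ _ (.inr e)
        rintro x y (rfl | e)
        exacts [.refl _, .rel _ _ e]
      rw [orbCount_one, h4, inv_one, one_mul]
      omega
    · obtain ⟨x, hx⟩ : ∃ x, σ x ≠ x := by
        by_contra! hc; exact h1 (Equiv.ext hc)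
      have := orbCount_mul_swap_of_sameCycle σ hx.symm ⟨1, by simp⟩
      have := hle (σ * Equiv.swap x (σ x))
      omega
  | succ k ih =>
    obtain ⟨x, hx⟩ : ∃ x, σ x ≠ x := by
      by_contra! hc
      have : σ = 1 := Equiv.ext hc
      rw [this, orbCount_one] at hk
      omega
    have hsc : σ.SameCycle x (σ x) := ⟨1, by simp⟩
    refine euler_le_of_split hx.symm hsc (ih _ ?_)
    rw [orbCount_mul_swap_of_sameCycle σ hx.symm hsc]
    omega

/-- Splitting a vertex preserves planarity. -/
theorem Flat.split (hα : ∀ x, α (α x) = x) (hne : ∀ x, α x ≠ x) (hF : Flat σ α)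
    (h : σ.SameCycle a b) : Flat (σ * Equiv.swap a b) α := by
  rcases eq_or_ne a b with rfl | hab
  · simpa using hF
  rw [flat_iff] at hF
  have h' := (flat_iff (σ * Equiv.swap a b) α).2
  refine h' ?_
  have hle := euler_le hα hne (σ * Equiv.swap a b)
  have hV := orbCount_mul_swap_of_sameCycle σ hab h
  by_cases hl : Linked (σ * Equiv.swap a b : Equiv.Perm X) α a b
  · have hC := compCount_mul_swap_of_linked σ α (.of_sameCycle h) hl
    rw [face_mul_swap] at hle ⊢
    by_cases hf : (σ⁻¹ * α).SameCycle a b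
    · have := orbCount_swap_mul_of_sameCycle _ hab hf
      omega
    · have := orbCount_swap_mul_of_not_sameCycle _ hf
      omega
  · have hC := compCount_mul_swap_of_not_linked _ α hl
    rw [mul_assoc, Equiv.swap_mul_self, mul_one] at hC
    have hF := orbCount_swap_mul_of_not_sameCycle _ fun hc => hl (.of_face hc)
    rw [← face_mul_swap, mul_assoc, Equiv.swap_mul_self, mul_one] at hF
    omega

/-- If a face of a planar map visits a vertex twice, then splitting the vertex at these visits
separates the two parts. -/
theorem Flat.not_linked_of_split (hα : ∀ x, α (α x) = x) (hne : ∀ x, α x ≠ x) (hF : Flat σ α)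
    (hab : a ≠ b) (h : σ.SameCycle a b)
    (hf : (σ⁻¹ * α).SameCycle a b) : ¬ Linked (σ * Equiv.swap a b : Equiv.Perm X) α a b := by
  intro hl
  rw [flat_iff] at hF
  have hle := euler_le hα hne (σ * Equiv.swap a b)
  have hV := orbCount_mul_swap_of_sameCycle σ hab h
  have hC := compCount_mul_swap_of_linked σ α (.of_sameCycle h) hl
  rw [face_mul_swap] at hle
  have := orbCount_swap_mul_of_sameCycle _ hab hf
  omega

/-- Merging vertices of different components preserves planarity. -/
theorem Flat.merge_of_not_linked (hF : Flat σ α) (h : ¬ Linked σ α a b) :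
    Flat (σ * Equiv.swap a b) α := by
  rw [flat_iff] at hF
  refine (flat_iff (σ * Equiv.swap a b) α).2 ?_
  have hV := orbCount_mul_swap_of_not_sameCycle σ fun hc => h (.of_sameCycle hc)
  have hC := compCount_mul_swap_of_not_linked σ α h
  rw [face_mul_swap]
  have := orbCount_swap_mul_of_not_sameCycle _ fun hc => h (.of_face hc)
  omega

/-- Merging vertices within a face preserves planarity. -/
theorem Flat.merge_of_face (hF : Flat σ α) (h : ¬ σ.SameCycle a b)
    (hf : (σ⁻¹ * α).SameCycle a b) : Flat (σ * Equiv.swap a b) α := by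
  rw [flat_iff] at hF
  refine (flat_iff (σ * Equiv.swap a b) α).2 ?_
  have hab : a ≠ b := by rintro rfl; exact h (.refl _ _)
  have hV := orbCount_mul_swap_of_not_sameCycle σ h
  have hC := compCount_mul_swap_of_linked σ α (.of_face hf)
    (.of_sameCycle (sameCycle_mul_swap σ h))
  rw [face_mul_swap]
  have := orbCount_swap_mul_of_sameCycle _ hab hf
  omega

end Genus

/-! ## Rotations on a fixed universe of darts -/

section Rotation

variable {A : Type*} {n : ℕ}

theorem perm_apply_inv (σ : Equiv.Perm A) (a : A) : σ (σ⁻¹ a) = a := by simp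

theorem perm_inv_apply (σ : Equiv.Perm A) (a : A) : σ⁻¹ (σ a) = a := by simp

/-- `σ` permutes the darts of `U` cyclically around each vertex, and fixes all other darts. -/
structure IsRotation (σ : Equiv.Perm A) (U : Set A) (f : A → Fin n) : Prop where
  fixed : ∀ a, a ∉ U → σ a = a
  fst : ∀ a ∈ U, f (σ a) = f a
  cyclic : ∀ a ∈ U, ∀ b ∈ U, f a = f b → σ.SameCycle a b

variable {σ : Equiv.Perm A} {U : Set A} {f g : A → Fin n}

theorem IsRotation.mem (h : IsRotation σ U f) {a : A} (ha : a ∈ U) : σ a ∈ U := by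
  by_contra hc
  have := σ.injective (h.fixed _ hc)
  rw [this] at hc
  exact hc ha

theorem IsRotation.inv_mem (h : IsRotation σ U f) {a : A} (ha : a ∈ U) : σ⁻¹ a ∈ U := by
  by_contra hc
  have := h.fixed _ hc
  rw [perm_apply_inv] at this
  rw [← this] at hc
  exact hc ha

theorem IsRotation.inv_fst (h : IsRotation σ U f) {a : A} (ha : a ∈ U) : f (σ⁻¹ a) = f a := by
  have := h.fst _ (h.inv_mem ha)
  rw [perm_apply_inv] at this
  exact this.symm

theorem IsRotation.congr (h : IsRotation σ U f) (hfg : ∀ a ∈ U, f a = g a) : IsRotation σ U g where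
  fixed := h.fixed
  fst a ha := by rw [← hfg a ha, ← hfg _ (h.mem ha), h.fst a ha]
  cyclic a ha b hb e := h.cyclic a ha b hb (by rw [hfg a ha, hfg b hb, e])

variable [Finite A] [DecidableEq A]

/-- Attach the dart `c` after the dart `k`; `k = c` means that there are no darts at the vertex. -/
theorem IsRotation.attach (h : IsRotation σ U f) {c k : A} (hc : c ∉ U)
    (hk : (k ∈ U ∧ f k = f c) ∨ (k = c ∧ ∀ a ∈ U, f a ≠ f c)) :
    IsRotation (σ * Equiv.swap k c) (insert c U) f := by
  rcases hk with ⟨hk, hfk⟩ | ⟨rfl, hk⟩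
  · have hkc : k ≠ c := fun e => hc (e ▸ hk)
    have hns : ¬ σ.SameCycle k c := fun hs => hc (mem_of_sameCycle (fun x hx => h.mem hx) hs hk)
    refine ⟨?_, ?_, ?_⟩
    · intro a ha
      rw [Set.mem_insert_iff, not_or] at ha
      have hak : a ≠ k := fun e => ha.2 (e ▸ hk)
      rw [mul_swap_of_ne σ hak ha.1, h.fixed a ha.2]
    · intro a ha
      by_cases hac : a = c
      · rw [hac, mul_swap_right, h.fst k hk, hfk]
      by_cases hak : a = k
      · rw [hak, mul_swap_left, h.fixed c hc, hfk]
      rw [mul_swap_of_ne σ hak hac]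
      exact h.fst a (ha.resolve_left hac)
    · have key : ∀ a ∈ U, f a = f k → (σ * Equiv.swap k c).SameCycle c a := fun a ha hak =>
        (sameCycle_mul_swap σ hns).symm.trans ((h.cyclic k hk a ha hak.symm).mul_swap σ hns)
      rintro a (rfl | ha) b (rfl | hb) hab
      · exact .refl _ _
      · exact key b hb (by rw [← hab, hfk])
      · exact (key a ha (by rw [hab, hfk])).symm
      · exact (h.cyclic a ha b hb hab).mul_swap σ hns
  · rw [Equiv.swap_self]
    change IsRotation (σ * 1) _ _
    rw [mul_one]
    refine ⟨fun a ha => h.fixed a fun h' => ha (.inr h'), ?_, ?_⟩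
    · rintro a (rfl | ha)
      · rw [h.fixed a hc]
      · exact h.fst a ha
    · rintro a (rfl | ha) b (rfl | hb) hab
      · exact .refl _ _
      · exact absurd hab.symm (hk b hb)
      · exact absurd hab (hk a ha)
      · exact h.cyclic a ha b hb hab

/-- The rotation without the dart `c`. -/
def detach (σ : Equiv.Perm A) (c : A) : Equiv.Perm A := σ * Equiv.swap (σ⁻¹ c) c

theorem detach_self (σ : Equiv.Perm A) (c : A) : detach σ c c = c := by
  simp [detach]

theorem detach_of_ne {c x : A} (hx : x ≠ c) (h : σ x ≠ c) : detach σ c x = σ x := by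
  refine mul_swap_of_ne σ (fun e => h ?_) hx
  rw [e]; simp

theorem detach_of_eq {c x : A} (h : σ x = c) : detach σ c x = σ c := by
  have : σ⁻¹ c = x := by rw [← h]; simp
  rw [detach, this, mul_swap_left]

theorem sameCycle_detach {c x y : A} (hx : x ≠ c) (hy : y ≠ c) (h : σ.SameCycle x y) :
    (detach σ c).SameCycle x y := by
  have hs : ∀ z, (detach σ c).SameCycle z (detach σ c z) := fun z => ⟨1, by simp⟩
  have := mem_of_sameCycle (Z := {z | (z ≠ c → (detach σ c).SameCycle x z) ∧
    (z = c → (detach σ c).SameCycle x (σ⁻¹ c))}) ?_ h ⟨fun _ => .refl _ _, fun e => absurd e hx⟩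
  · exact this.1 hy
  rintro z ⟨h1, h2⟩
  by_cases hz : z = c
  · refine ⟨fun hne => ?_, fun _ => h2 hz⟩
    have := hs (σ⁻¹ c)
    rw [detach_of_eq (by simp)] at this
    rw [hz]
    exact (h2 hz).trans this
  · refine ⟨fun hne => ?_, fun e => ?_⟩
    · have := hs z
      rw [detach_of_ne hz hne] at this
      exact (h1 hz).trans this
    · have hz' : σ⁻¹ c = z := by rw [← e]; simp
      rw [hz']
      exact h1 hz

theorem IsRotation.detach (h : IsRotation σ U f) (c : A) :
    IsRotation (detach σ c) (U \ {c}) f := by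
  refine ⟨?_, ?_, ?_⟩
  · intro a ha
    by_cases hac : a = c
    · rw [hac, detach_self]
    · have : a ∉ U := fun h' => ha ⟨h', hac⟩
      rw [detach_of_ne hac (by rwa [h.fixed a this]), h.fixed a this]
  · rintro a ⟨ha, hac⟩
    by_cases hc : σ a = c
    · have hcU : c ∈ U := hc ▸ h.mem ha
      rw [detach_of_eq hc, h.fst c hcU, ← hc, h.fst a ha]
    · rw [detach_of_ne hac hc, h.fst a ha]
  · rintro a ⟨ha, hac⟩ b ⟨hb, hbc⟩ hab
    exact sameCycle_detach hac hbc (h.cyclic a ha b hb hab)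

end Rotation

/-- Darts with their reversal and their crossings. -/
structure Frame (A : Type) where
  rev : A → A
  rev_rev : ∀ a, rev (rev a) = a
  rev_ne : ∀ a, rev a ≠ a
  cross : A → Option A
  cross_turn : ∀ d e, cross d = some e → cross e = some (rev d)

namespace Frame

variable {A : Type} (F : Frame A)

theorem rev_inj {a b : A} (h : F.rev a = F.rev b) : a = b := by
  rw [← F.rev_rev a, h, F.rev_rev]

/-- The reversal as a permutation. -/
def revPerm : Equiv.Perm A := ⟨F.rev, F.rev, F.rev_rev, F.rev_rev⟩

theorem cross_rev {d e : A} (h : F.cross d = some e) : F.cross (F.rev d) = some (F.rev e) :=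
  F.cross_turn _ _ (F.cross_turn _ _ h)

theorem cross_rev' {d e : A} (h : F.cross d = some e) : F.cross (F.rev e) = some d := by
  rw [F.cross_turn _ _ (F.cross_rev h), F.rev_rev]

theorem isSome_rev {d : A} : (F.cross (F.rev d)).isSome ↔ (F.cross d).isSome := by
  constructor
  · intro h
    obtain ⟨e, he⟩ := Option.isSome_iff_exists.1 h
    have := F.cross_rev he
    rw [F.rev_rev] at this
    simp [this]
  · intro h
    obtain ⟨e, he⟩ := Option.isSome_iff_exists.1 h
    simp [F.cross_rev he]

theorem cross_rev_eq_none {d : A} : F.cross (F.rev d) = none ↔ F.cross d = none := by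
  have := F.isSome_rev (d := d)
  rw [← Option.not_isSome_iff_eq_none, ← Option.not_isSome_iff_eq_none, this]

theorem isSome_get {d : A} (h : (F.cross d).isSome) :
    (F.cross ((F.cross d).get h)).isSome := by
  obtain ⟨e, he⟩ := Option.isSome_iff_exists.1 h
  simp [he, F.cross_turn d e he]

/-- The darts of the planarization. -/
abbrev Half : Type := A ⊕ {a : A // (F.cross a).isSome}

/-- The rotation at the crossing points. -/
def crossPerm : Equiv.Perm {a : A // (F.cross a).isSome} where
  toFun d := ⟨(F.cross d.1).get d.2, F.isSome_get d.2⟩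
  invFun d := ⟨F.rev ((F.cross d.1).get d.2), F.isSome_rev.2 (F.isSome_get d.2)⟩
  left_inv := by
    rintro ⟨d, hd⟩
    obtain ⟨e, he⟩ := Option.isSome_iff_exists.1 hd
    simp [he, F.cross_turn d e he, F.rev_rev]
  right_inv := by
    rintro ⟨d, hd⟩
    obtain ⟨e, he⟩ := Option.isSome_iff_exists.1 hd
    simp [he, F.cross_rev' he]

/-- The reversal in the planarization. -/
def flip : F.Half → F.Half
  | .inl d => if h : (F.cross d).isSome then .inr ⟨F.rev d, F.isSome_rev.2 h⟩ else .inl (F.rev d)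
  | .inr d => .inl (F.rev d.1)

theorem flip_inl_of_none {d : A} (h : F.cross d = none) : F.flip (.inl d) = .inl (F.rev d) := by
  simp [flip, h]

theorem flip_inl_of_isSome {d : A} (h : (F.cross d).isSome) :
    F.flip (.inl d) = .inr ⟨F.rev d, F.isSome_rev.2 h⟩ := by
  simp [flip, h]

theorem flip_flip (h : F.Half) : F.flip (F.flip h) = h := by
  rcases h with d | ⟨d, hd⟩
  · by_cases h : (F.cross d).isSome
    · rw [flip_inl_of_isSome F h]; simp [flip, F.rev_rev]
    · have h' : F.cross d = none := by simpa using h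
      rw [flip_inl_of_none F h', flip_inl_of_none F (F.cross_rev_eq_none.2 h'), F.rev_rev]
  · change F.flip (.inl (F.rev d)) = _
    rw [flip_inl_of_isSome F (F.isSome_rev.2 hd)]
    simp [F.rev_rev]

theorem flip_ne (h : F.Half) : F.flip h ≠ h := by
  rcases h with d | ⟨d, hd⟩
  · by_cases h : (F.cross d).isSome
    · rw [flip_inl_of_isSome F h]; simp
    · have h' : F.cross d = none := by simpa using h
      rw [flip_inl_of_none F h']
      simpa using F.rev_ne d
  · simp [flip]

/-- The reversal in the planarization, as a permutation. -/
def flipPerm : Equiv.Perm F.Half := ⟨F.flip, F.flip, F.flip_flip, F.flip_flip⟩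

/-- The rotation in the planarization. -/
def turn (σ : Equiv.Perm A) : Equiv.Perm F.Half := Equiv.Perm.sumCongr σ F.crossPerm

theorem turn_mul_swap [DecidableEq A] (σ : Equiv.Perm A) (a b : A) :
    F.turn (σ * Equiv.swap a b) = F.turn σ * Equiv.swap (.inl a) (.inl b) := by
  rw [turn, turn, ← Equiv.Perm.sumCongr_swap_one, Equiv.Perm.sumCongr_mul, mul_one]

/-- The successor on the boundary of the face to the left. -/
def face (σ : Equiv.Perm A) : Equiv.Perm F.Half := (F.turn σ)⁻¹ * F.flipPerm

theorem face_inl_of_none (σ : Equiv.Perm A) {d : A} (h : F.cross d = none) :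
    F.face σ (.inl d) = .inl (σ⁻¹ (F.rev d)) := by
  rw [face, Equiv.Perm.mul_apply]
  change (F.turn σ)⁻¹ (F.flip (.inl d)) = _
  rw [F.flip_inl_of_none h, Equiv.Perm.inv_eq_iff_eq]
  simp [turn]

theorem face_inl_of_some (σ : Equiv.Perm A) {d e : A} (h : F.cross d = some e) :
    F.face σ (.inl d) = .inr ⟨e, by rw [F.cross_turn _ _ h]; rfl⟩ := by
  rw [face, Equiv.Perm.mul_apply]
  change (F.turn σ)⁻¹ (F.flip (.inl d)) = _
  rw [F.flip_inl_of_isSome (by rw [h]; rfl), Equiv.Perm.inv_eq_iff_eq]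
  simp [turn, crossPerm, F.cross_turn _ _ h]

theorem face_inr (σ : Equiv.Perm A) (d : {a : A // (F.cross a).isSome}) :
    F.face σ (.inr d) = .inl (σ⁻¹ (F.rev d.1)) := by
  rw [face, Equiv.Perm.mul_apply]
  change (F.turn σ)⁻¹ (.inl (F.rev d.1)) = _
  rw [Equiv.Perm.inv_eq_iff_eq]
  simp [turn]

/-- The dart of which the given dart of the planarization is a part. -/
def under : F.Half → A := Sum.elim id Subtype.val

/-- A set of darts that is a union of components gives a union of components of the
planarization. -/
theorem mem_iff_of_linked {σ : Equiv.Perm A} {Z : Set A} (hσ : ∀ a, σ a ∈ Z ↔ a ∈ Z)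
    (hr : ∀ a, F.rev a ∈ Z ↔ a ∈ Z) (hc : ∀ d e, F.cross d = some e → (e ∈ Z ↔ d ∈ Z))
    {h k : F.Half} (hk : Linked (F.turn σ) F.flipPerm h k) : F.under h ∈ Z ↔ F.under k ∈ Z := by
  refine _root_.mem_iff_of_linked (Z := {h | F.under h ∈ Z}) ?_ ?_ hk
  · rintro (d | ⟨d, hd⟩)
    · exact hσ d
    · obtain ⟨e, he⟩ := Option.isSome_iff_exists.1 hd
      have := hc d e he
      simpa [turn, crossPerm, under, he] using this
  · rintro (d | ⟨d, hd⟩)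
    · change F.under (F.flip (.inl d)) ∈ Z ↔ d ∈ Z
      by_cases h : (F.cross d).isSome
      · rw [F.flip_inl_of_isSome h]; exact hr d
      · rw [F.flip_inl_of_none (by simpa using h)]; exact hr d
    · exact hr d

end Frame

/-- A planar system of darts on `n` vertices: the used darts of the frame with their starting
vertices and rotation form an embedded simple graph, in which no two crossed edges share an
end-vertex. -/
structure DartSystem {A : Type} (F : Frame A) (n : ℕ) where
  fst : A → Fin n
  rot : Equiv.Perm A
  used : Set A
  isRot : IsRotation rot used fst
  rev_mem : ∀ a ∈ used, F.rev a ∈ used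
  cross_mem : ∀ a, (F.cross a).isSome → a ∈ used
  indep : ∀ a b, (F.cross a).isSome → (F.cross b).isSome → fst a = fst b → a = b
  loopless : ∀ a ∈ used, fst a ≠ fst (F.rev a)
  simple : ∀ a ∈ used, ∀ b ∈ used, fst a = fst b → fst (F.rev a) = fst (F.rev b) → a = b
  flat : Flat (F.turn rot) F.flipPerm

namespace DartSystem

variable {A : Type} {F : Frame A} {n : ℕ} (S : DartSystem F n)

theorem rev_mem_iff {a : A} : F.rev a ∈ S.used ↔ a ∈ S.used :=
  ⟨fun h => by simpa [F.rev_rev] using S.rev_mem _ h, S.rev_mem a⟩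

theorem cross_eq_none_of_not_mem {a : A} (h : a ∉ S.used) : F.cross a = none := by
  by_contra hc
  exact h (S.cross_mem a (Option.isSome_iff_ne_none.2 hc))

theorem cross_ne_self {d e : A} (h : F.cross d = some e) : S.fst d ≠ S.fst e := by
  intro hf
  have h1 := F.cross_turn d e h
  have hde : d = e := S.indep d e (by rw [h]; rfl) (by rw [h1]; rfl) hf
  rw [← hde, h, ← hde] at h1
  exact F.rev_ne d (Option.some.inj h1).symm

variable [Finite A] [DecidableEq A]

theorem flat_detach {σ : Equiv.Perm A} (h : Flat (F.turn σ) F.flipPerm) (c : A) :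
    Flat (F.turn (detach σ c)) F.flipPerm := by
  rw [detach, F.turn_mul_swap]
  refine Flat.split F.flip_flip F.flip_ne h ⟨1, ?_⟩
  simp [Frame.turn]

/-- Remove the uncrossed edge of the dart `c`. -/
def remove (c : A) (hc : F.cross c = none) : DartSystem F n where
  fst := S.fst
  rot := detach (detach S.rot c) (F.rev c)
  used := (S.used \ {c}) \ {F.rev c}
  isRot := (S.isRot.detach c).detach _
  rev_mem := by
    rintro a ⟨⟨ha, hac⟩, hac'⟩
    refine ⟨⟨S.rev_mem a ha, fun e => hac' ?_⟩, fun e => hac (F.rev_inj e)⟩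
    rw [Set.mem_singleton_iff] at e ⊢
    rw [← e, F.rev_rev]
  cross_mem := by
    intro a ha
    refine ⟨⟨S.cross_mem a ha, ?_⟩, ?_⟩
    · rintro rfl; simp [hc] at ha
    · rintro rfl
      rw [F.isSome_rev] at ha
      simp [hc] at ha
  indep := S.indep
  loopless a ha := S.loopless a ha.1.1
  simple a ha b hb := S.simple a ha.1.1 b hb.1.1
  flat := flat_detach (flat_detach S.flat c) _

theorem not_linked_of_not_mem {c k : A} (hc : c ∉ S.used) (hk : k ∈ S.used) :
    ¬ Linked (F.turn S.rot) F.flipPerm (.inl k) (.inl c) := by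
  intro hl
  have := F.mem_iff_of_linked (Z := S.used) (fun a => apply_mem_iff (fun x => S.isRot.mem) a)
    (fun a => S.rev_mem_iff) (fun d e h => ?_) hl
  · exact hc (this.1 hk)
  · have h1 := S.cross_mem d (by rw [h]; rfl)
    have h2 := S.cross_mem e (by rw [F.cross_turn d e h]; rfl)
    simp [h1, h2]

theorem flat_attach {c k : A} (hc : c ∉ S.used) (hk : k ∈ S.used ∨ k = c) :
    Flat (F.turn (S.rot * Equiv.swap k c)) F.flipPerm := by
  rcases hk with hk | rfl
  · rw [F.turn_mul_swap]
    exact S.flat.merge_of_not_linked (S.not_linked_of_not_mem hc hk)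
  · rw [Equiv.swap_self]
    exact S.flat

/-- A new edge between two corners of the same face preserves planarity. -/
theorem flat_insert_of_face {c k k' : A} (hc : c ∉ S.used) (hk : k ∈ S.used) (hk' : k' ∈ S.used)
    (hf : (F.face S.rot).SameCycle (.inl k) (.inl k')) :
    Flat (F.turn (S.rot * Equiv.swap k c * Equiv.swap k' (F.rev c))) F.flipPerm := by
  have hc' : F.rev c ∉ S.used := fun h => hc (S.rev_mem_iff.1 h)
  have h1 := S.flat_attach hc (.inl hk)
  rw [F.turn_mul_swap]
  have hns : ¬ (F.face S.rot).SameCycle (.inl k) (.inl c) := fun h =>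
    S.not_linked_of_not_mem hc hk (.of_face h)
  refine h1.merge_of_face ?_ ?_
  · intro hs
    have hfix : (F.turn (S.rot * Equiv.swap k c)) (.inl (F.rev c)) = .inl (F.rev c) := by
      have h2 : (S.rot * Equiv.swap k c) (F.rev c) = F.rev c := by
        have hck : F.rev c ≠ k := fun e => hc' (e ▸ hk)
        rw [mul_swap_of_ne _ hck (F.rev_ne c), S.isRot.fixed _ hc']
      exact congrArg Sum.inl h2
    have := mem_of_sameCycle (Z := {.inl (F.rev c)}) (by rintro x rfl; exact hfix) hs.symm rfl
    exact hc' ((Sum.inl.inj this) ▸ hk')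
  · have e : (F.turn (S.rot * Equiv.swap k c))⁻¹ * F.flipPerm =
        Equiv.swap (.inl k) (.inl c) * F.face S.rot := by
      rw [F.turn_mul_swap, face_mul_swap]; rfl
    rw [e]
    have h2 := sameCycle_swap_mul _ hns
    have h3 := hf.swap_mul _ hns
    have h4 : (F.face S.rot).SameCycle (.inl c) (.inl (F.rev c)) := by
      refine ⟨1, ?_⟩
      rw [zpow_one, F.face_inl_of_none _ (S.cross_eq_none_of_not_mem hc)]
      congr 1
      rw [Equiv.Perm.inv_eq_iff_eq, S.isRot.fixed _ hc']
    exact h3.symm.trans (h2.trans (h4.swap_mul _ hns))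

/-- A new edge between different components preserves planarity. -/
theorem flat_insert_of_comp {c k k' : A} (hc : c ∉ S.used) (Z : Set A)
    (hσ : ∀ a ∈ Z, S.rot a ∈ Z) (hr : ∀ a ∈ Z, F.rev a ∈ Z)
    (hx : ∀ d e, F.cross d = some e → d ∈ Z → e ∈ Z)
    (hk : (k ∈ S.used ∧ k ∈ Z) ∨ k = c) (hk' : (k' ∈ S.used ∧ k' ∉ Z) ∨ k' = F.rev c) :
    Flat (F.turn (S.rot * Equiv.swap k c * Equiv.swap k' (F.rev c))) F.flipPerm := by
  have hc' : F.rev c ∉ S.used := fun h => hc (S.rev_mem_iff.1 h)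
  have h1 := S.flat_attach hc (hk.imp_left And.left)
  rcases hk' with ⟨hk', hkZ⟩ | rfl
  swap
  · rw [Equiv.swap_self]; exact h1
  rw [F.turn_mul_swap]
  refine h1.merge_of_not_linked fun hl => ?_
  have key := F.mem_iff_of_linked (Z := {a | (a ∈ Z ∧ a ∈ S.used) ∨ a = c ∨ a = F.rev c})
    (apply_mem_iff ?_) ?_ ?_ hl
  · rcases key.2 (.inr (.inr rfl)) with h | h | h
    · exact hkZ h.1
    · exact hc (h ▸ hk')
    · exact hc' (h ▸ hk')
  · intro a ha
    have hck : S.rot k ∈ {a | (a ∈ Z ∧ a ∈ S.used) ∨ a = c ∨ a = F.rev c} := by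
      rcases hk with hk | rfl
      · exact .inl ⟨hσ k hk.2, S.isRot.mem hk.1⟩
      · exact .inr (.inl (S.isRot.fixed _ hc))
    by_cases hak : a = k
    · rw [hak, mul_swap_left, S.isRot.fixed _ hc]; exact .inr (.inl rfl)
    by_cases hac : a = c
    · rw [hac, mul_swap_right]; exact hck
    rw [mul_swap_of_ne _ hak hac]
    rcases ha with ha | ha | ha
    · exact .inl ⟨hσ a ha.1, S.isRot.mem ha.2⟩
    · exact absurd ha hac
    · rw [ha, S.isRot.fixed _ hc']; exact .inr (.inr rfl)
  · refine apply_mem_iff (σ := F.revPerm) ?_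
    rintro a (ha | rfl | rfl)
    · exact .inl ⟨hr a ha.1, S.rev_mem a ha.2⟩
    · exact .inr (.inr rfl)
    · exact .inr (.inl (F.rev_rev c))
  · intro d e hde
    have hd := S.cross_mem d (by rw [hde]; rfl)
    have he := S.cross_mem e (by rw [F.cross_turn d e hde]; rfl)
    have hdc : d ≠ c ∧ d ≠ F.rev c := ⟨fun h => hc (h ▸ hd), fun h => hc' (h ▸ hd)⟩
    have hec : e ≠ c ∧ e ≠ F.rev c := ⟨fun h => hc (h ▸ he), fun h => hc' (h ▸ he)⟩
    have hZ : e ∈ Z ↔ d ∈ Z := by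
      refine ⟨fun h => ?_, hx d e hde⟩
      have := hr _ (hx _ _ (F.cross_turn d e hde) h)
      rwa [F.rev_rev] at this
    simp [hd, he, hdc, hec, hZ]

/-- An edge from `u` to `v` can be added, with the new darts `c` and `F.rev c` placed after the
darts `k` at `u` and `k'` at `v`; `k = c` means that there are no darts at `u`, and likewise for
`k'`. -/
structure CanInsert (c k k' : A) (u v : Fin n) : Prop where
  new : c ∉ S.used
  left : (k ∈ S.used ∧ S.fst k = u) ∨ (k = c ∧ ∀ a ∈ S.used, S.fst a ≠ u)
  right : (k' ∈ S.used ∧ S.fst k' = v) ∨ (k' = F.rev c ∧ ∀ a ∈ S.used, S.fst a ≠ v)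
  ne : u ≠ v
  simple : ∀ a ∈ S.used, S.fst a = u → S.fst (F.rev a) ≠ v
  flat : Flat (F.turn (S.rot * Equiv.swap k c * Equiv.swap k' (F.rev c))) F.flipPerm

namespace CanInsert

variable {S} {c k k' : A} {u v : Fin n}

theorem new' (h : S.CanInsert c k k' u v) : F.rev c ∉ S.used := fun h' => h.new (S.rev_mem_iff.1 h')

theorem ne' (h : S.CanInsert c k k' u v) : k ≠ k' := by
  rintro rfl
  rcases h.left with h1 | h1 <;> rcases h.right with h2 | h2
  · exact h.ne (h1.2.symm.trans h2.2)
  · exact h.new' (h2.1 ▸ h1.1)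
  · exact h.new (h1.1 ▸ h2.1)
  · exact F.rev_ne c (h2.1.symm.trans h1.1)

theorem left_ne (h : S.CanInsert c k k' u v) : k ≠ F.rev c := by
  rintro rfl
  rcases h.left with h1 | h1
  · exact h.new' h1.1
  · exact F.rev_ne c h1.1

theorem right_ne (h : S.CanInsert c k k' u v) : k' ≠ c := by
  rintro rfl
  rcases h.right with h1 | h1
  · exact h.new h1.1
  · exact F.rev_ne _ h1.1.symm

theorem rot_left (h : S.CanInsert c k k' u v) :
    (S.rot * Equiv.swap k c * Equiv.swap k' (F.rev c)) k = c := by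
  rw [mul_swap_of_ne _ h.ne' h.left_ne, mul_swap_left, S.isRot.fixed c h.new]

theorem rot_new (h : S.CanInsert c k k' u v) :
    (S.rot * Equiv.swap k c * Equiv.swap k' (F.rev c)) c = S.rot k := by
  rw [mul_swap_of_ne _ h.right_ne.symm (F.rev_ne c).symm, mul_swap_right]

theorem rot_right (h : S.CanInsert c k k' u v) :
    (S.rot * Equiv.swap k c * Equiv.swap k' (F.rev c)) k' = F.rev c := by
  rw [mul_swap_left, mul_swap_of_ne _ h.left_ne.symm (F.rev_ne c), S.isRot.fixed _ h.new']

theorem rot_new' (h : S.CanInsert c k k' u v) :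
    (S.rot * Equiv.swap k c * Equiv.swap k' (F.rev c)) (F.rev c) = S.rot k' := by
  rw [mul_swap_right, mul_swap_of_ne _ h.ne'.symm h.right_ne]

theorem rot_of_ne (h : S.CanInsert c k k' u v) {a : A} (ha : a ∈ S.used) (hk : a ≠ k)
    (hk' : a ≠ k') : (S.rot * Equiv.swap k c * Equiv.swap k' (F.rev c)) a = S.rot a := by
  have h1 : a ≠ c := fun e => h.new (e ▸ ha)
  have h2 : a ≠ F.rev c := fun e => h.new' (e ▸ ha)
  rw [mul_swap_of_ne _ hk' h2, mul_swap_of_ne _ hk h1]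

end CanInsert

/-- Add an edge. -/
def insert {c k k' : A} {u v : Fin n} (hI : S.CanInsert c k k' u v) : DartSystem F n := by
  have hc := hI.new
  have hk := hI.left
  have hk' := hI.right
  have huv := hI.ne
  have hs := hI.simple
  have hc' : F.rev c ∉ S.used := fun h => hc (S.rev_mem_iff.1 h)
  have hcc := F.rev_ne c
  let f : A → Fin n := Function.update (Function.update S.fst c u) (F.rev c) v
  have hfc : f c = u := by simp [f, hcc.symm]
  have hfc' : f (F.rev c) = v := by simp [f]
  have hfa : ∀ a ∈ S.used, f a = S.fst a := by
    intro a ha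
    have h1 : a ≠ c := fun e => hc (e ▸ ha)
    have h2 : a ≠ F.rev c := fun e => hc' (e ▸ ha)
    simp [f, h1, h2]
  have hR : IsRotation S.rot S.used f := S.isRot.congr fun a ha => (hfa a ha).symm
  exact
  { fst := f
    rot := S.rot * Equiv.swap k c * Equiv.swap k' (F.rev c)
    used := Insert.insert (F.rev c) (Insert.insert c S.used)
    isRot := by
      refine (hR.attach hc ?_).attach ?_ ?_
      · rcases hk with ⟨h1, h2⟩ | ⟨h1, h2⟩
        · exact .inl ⟨h1, by rw [hfa k h1, h2, hfc]⟩
        · exact .inr ⟨h1, fun a ha => by rw [hfa a ha, hfc]; exact h2 a ha⟩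
      · rintro (h | h)
        exacts [hcc h, hc' h]
      · rcases hk' with ⟨h1, h2⟩ | ⟨h1, h2⟩
        · exact .inl ⟨.inr h1, by rw [hfa k' h1, h2, hfc']⟩
        · refine .inr ⟨h1, ?_⟩
          rintro a (rfl | ha)
          · rw [hfc, hfc']; exact huv
          · rw [hfa a ha, hfc']; exact h2 a ha
    rev_mem := by
      rintro a (rfl | rfl | ha)
      · rw [F.rev_rev]; exact .inr (.inl rfl)
      · exact .inl rfl
      · exact .inr (.inr (S.rev_mem a ha))
    cross_mem := fun a ha => .inr (.inr (S.cross_mem a ha))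
    indep := by
      intro a b ha hb hab
      rw [hfa a (S.cross_mem a ha), hfa b (S.cross_mem b hb)] at hab
      exact S.indep a b ha hb hab
    loopless := by
      rintro a (rfl | rfl | ha)
      · rw [F.rev_rev, hfc, hfc']; exact huv.symm
      · rw [hfc, hfc']; exact huv
      · rw [hfa a ha, hfa _ (S.rev_mem a ha)]; exact S.loopless a ha
    simple := by
      have key : ∀ a ∈ S.used, f a = u → f (F.rev a) = v → False := by
        intro a ha h1 h2
        rw [hfa a ha] at h1
        rw [hfa _ (S.rev_mem a ha)] at h2
        exact hs a ha h1 h2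
      rintro a (rfl | rfl | ha) b (rfl | rfl | hb) h1 h2
      · rfl
      · rw [hfc, hfc'] at h1; exact absurd h1.symm huv
      · rw [hfc'] at h1
        rw [F.rev_rev, hfc] at h2
        exact (key _ (S.rev_mem b hb) h2.symm (by rw [F.rev_rev]; exact h1.symm)).elim
      · rw [hfc, hfc'] at h1; exact absurd h1 huv
      · rfl
      · rw [hfc] at h1
        rw [hfc'] at h2
        exact (key b hb h1.symm h2.symm).elim
      · rw [hfc'] at h1
        rw [F.rev_rev, hfc] at h2
        exact (key _ (S.rev_mem a ha) h2 (by rw [F.rev_rev]; exact h1)).elim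
      · rw [hfc] at h1
        rw [hfc'] at h2
        exact (key a ha h1 h2).elim
      · rw [hfa a ha, hfa b hb] at h1
        rw [hfa _ (S.rev_mem a ha), hfa _ (S.rev_mem b hb)] at h2
        exact S.simple a ha b hb h1 h2
    flat := hI.flat }

section

variable {S} {c k k' : A} {u v : Fin n} (h : S.CanInsert c k k' u v)

theorem insert_rot : (S.insert h).rot = S.rot * Equiv.swap k c * Equiv.swap k' (F.rev c) := rfl

theorem insert_used : (S.insert h).used = Insert.insert (F.rev c) (Insert.insert c S.used) := rfl

theorem insert_fst : (S.insert h).fst =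
    Function.update (Function.update S.fst c u) (F.rev c) v := rfl

theorem insert_fst_new : (S.insert h).fst c = u := by
  simp [insert_fst, (F.rev_ne c).symm]

theorem insert_fst_new' : (S.insert h).fst (F.rev c) = v := by
  simp [insert_fst]

theorem insert_fst_of_mem {a : A} (ha : a ∈ S.used) : (S.insert h).fst a = S.fst a := by
  have h1 : a ≠ c := fun e => h.new (e ▸ ha)
  have h2 : a ≠ F.rev c := fun e => h.new' (e ▸ ha)
  simp [insert_fst, h1, h2]

theorem mem_insert_of_mem {a : A} (ha : a ∈ S.used) : a ∈ (S.insert h).used := .inr (.inr ha)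

end

end DartSystem

namespace DartSystem

variable {A : Type} {F : Frame A} {n : ℕ} (S : DartSystem F n)

/-! ### Kites and corners outside of kites -/

/-- The corner to the left of the first half of the crossed dart `x` is closed by an edge. -/
def KiteAt (x : A) : Prop := ∀ e, F.cross x = some e → S.rot (F.rev (S.rot x)) = F.rev e

/-- All corners at crossings are closed by edges. -/
def HasKites : Prop := ∀ x, S.KiteAt x

/-- The dart `d` is used, and the face to its left has no crossing on its boundary. -/
structure Good (d : A) : Prop where
  mem : d ∈ S.used
  uncrossed : F.cross d = none
  rot_uncrossed : F.cross (S.rot d) = none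

/-- The successor of a dart on the boundary of a face without crossings. -/
def next : Equiv.Perm A := S.rot⁻¹ * F.revPerm

theorem next_apply (d : A) : S.next d = S.rot⁻¹ (F.rev d) := rfl

theorem rot_next (d : A) : S.rot (S.next d) = F.rev d := by simp [next_apply]

theorem next_mem {d : A} (h : d ∈ S.used) : S.next d ∈ S.used := S.isRot.inv_mem (S.rev_mem d h)

theorem fst_next {d : A} (h : d ∈ S.used) : S.fst (S.next d) = S.fst (F.rev d) :=
  S.isRot.inv_fst (S.rev_mem d h)

theorem rot_ne_of_cross {x e : A} (h : F.cross x = some e) (hk : S.KiteAt x) : S.rot x ≠ x := by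
  intro hx
  have h1 := hk e h
  rw [hx] at h1
  have hxs : (F.cross x).isSome := by rw [h]; rfl
  have hes : (F.cross e).isSome := by rw [F.cross_turn _ _ h]; rfl
  have h2 := S.isRot.fst _ (S.rev_mem x (S.cross_mem x hxs))
  rw [h1] at h2
  exact S.cross_ne_self (F.cross_rev h) h2.symm

theorem cross_rot_eq_none {x e : A} (h : F.cross x = some e) (hk : S.KiteAt x) :
    F.cross (S.rot x) = none := by
  by_contra hc
  have hxs : (F.cross x).isSome := by rw [h]; rfl
  exact S.rot_ne_of_cross h hk (S.indep _ _ (Option.isSome_iff_ne_none.2 hc) hxs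
    (S.isRot.fst x (S.cross_mem x hxs)))

variable {S}

theorem Good.next (hK : S.HasKites) {d : A} (h : S.Good d) : S.Good (S.next d) := by
  refine ⟨S.next_mem h.mem, ?_, ?_⟩
  · by_contra hc
    obtain ⟨e, he⟩ := Option.ne_none_iff_exists'.1 hc
    have h1 := hK _ e he
    rw [rot_next, F.rev_rev] at h1
    have h2 := h.rot_uncrossed
    rw [h1, F.cross_rev_eq_none, F.cross_turn _ _ he] at h2
    cases h2
  · rw [rot_next, F.cross_rev_eq_none]
    exact h.uncrossed

variable [Finite A] [DecidableEq A]

theorem Good.of_sameCycle (hK : S.HasKites) {d g : A} (h : S.Good d) (hs : S.next.SameCycle d g) :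
    S.Good g :=
  mem_of_sameCycle (Z := {x | S.Good x}) (fun _ hx => Good.next hK hx) hs h

theorem Good.face_sameCycle (hK : S.HasKites) {d g : A} (h : S.Good d)
    (hs : S.next.SameCycle d g) : (F.face S.rot).SameCycle (.inl d) (.inl g) := by
  refine (mem_of_sameCycle (Z := {x | S.Good x ∧ (F.face S.rot).SameCycle (.inl d) (.inl x)}) ?_ hs
    ⟨h, .refl _ _⟩).2
  rintro x ⟨hx, hsx⟩
  refine ⟨hx.next hK, hsx.trans ⟨1, ?_⟩⟩
  rw [zpow_one, F.face_inl_of_none _ hx.uncrossed]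
  rfl

theorem exists_good (hK : S.HasKites) {a : A} (ha : a ∈ S.used) :
    ∃ d, S.Good d ∧ S.fst d = S.fst a := by
  by_cases h : ∃ x, (F.cross x).isSome ∧ S.fst x = S.fst a
  · obtain ⟨x, hx, hxa⟩ := h
    obtain ⟨e, he⟩ := Option.isSome_iff_exists.1 hx
    have hxm := S.cross_mem x hx
    have hn := S.cross_rot_eq_none he (hK x)
    refine ⟨S.rot x, ⟨S.isRot.mem hxm, hn, ?_⟩, by rw [S.isRot.fst x hxm, hxa]⟩
    by_contra hc
    have hfe : S.fst (S.rot (S.rot x)) = S.fst x := by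
      rw [S.isRot.fst _ (S.isRot.mem hxm), S.isRot.fst x hxm]
    have hrr : S.rot (S.rot x) = x :=
      S.indep _ _ (Option.isSome_iff_ne_none.2 hc) hx hfe
    have h1 := hK e (F.rev x) (F.cross_turn _ _ he)
    rw [F.rev_rev, ← hrr] at h1
    have h2 := F.rev_inj ((S.rot.injective h1).trans (F.rev_rev _).symm)
    have h4 := hK x e he
    rw [← F.rev_rev (S.rot x), ← h2] at h4
    have hem : e ∈ S.used := S.cross_mem e (by rw [F.cross_turn _ _ he]; rfl)
    rw [F.rev_rev] at h4
    have h5 := S.isRot.fst _ (S.isRot.mem hem)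
    rw [h4, S.isRot.fst _ hem] at h5
    exact S.loopless e hem h5.symm
  · push Not at h
    refine ⟨a, ⟨ha, ?_, ?_⟩, rfl⟩
    · by_contra hc
      exact h a (Option.isSome_iff_ne_none.2 hc) rfl
    · by_contra hc
      exact h _ (Option.isSome_iff_ne_none.2 hc) (S.isRot.fst a ha)

/-! ### Chords of faces -/

theorem turn_sameCycle {σ : Equiv.Perm A} {a b : A} (h : σ.SameCycle a b) :
    (F.turn σ).SameCycle (.inl a) (.inl b) := by
  refine mem_of_sameCycle (Z := {x | (F.turn σ).SameCycle (.inl a) (.inl x)}) ?_ h (.refl _ _)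
  intro x hx
  exact hx.trans ⟨1, by simp [Frame.turn]⟩

theorem linked_rev (σ : Equiv.Perm A) (a : A) :
    Linked (F.turn σ) F.flipPerm (.inl a) (.inl (F.rev a)) := by
  by_cases h : (F.cross a).isSome
  · obtain ⟨e, he⟩ := Option.isSome_iff_exists.1 h
    have hr := F.isSome_rev.2 h
    have h1 : Linked (F.turn σ) F.flipPerm (.inl a) (.inr ⟨F.rev a, hr⟩) :=
      .rel _ _ (.inr (F.flip_inl_of_isSome h))
    have hre : (F.cross (F.rev e)).isSome := by rw [F.cross_rev' he]; rfl
    have h2 : Linked (F.turn σ) F.flipPerm (.inr ⟨F.rev a, hr⟩) (.inr ⟨F.rev e, hre⟩) :=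
      .rel _ _ (.inl (by simp [Frame.turn, Frame.crossPerm, F.cross_rev he]))
    have h3 : Linked (F.turn σ) F.flipPerm (.inr ⟨F.rev e, hre⟩) (.inr ⟨a, h⟩) :=
      .rel _ _ (.inl (by simp [Frame.turn, Frame.crossPerm, F.cross_rev' he]))
    have h4 : Linked (F.turn σ) F.flipPerm (.inr ⟨a, h⟩) (.inl (F.rev a)) :=
      .rel _ _ (.inr rfl)
    exact h1.trans _ _ _ (h2.trans _ _ _ (h3.trans _ _ _ h4))
  · exact .rel _ _ (.inr (F.flip_inl_of_none (by simpa using h)))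

/-- If a face visits the vertex after `d` also elsewhere, then the neighbours of this vertex on the
face are different and not adjacent. -/
theorem chord_new (hK : S.HasKites) {d g : A} (hd : S.Good d) (hg : S.next.SameCycle d g)
    (hne : g ≠ S.next d) (hfst : S.fst g = S.fst (S.next d)) :
    S.fst d ≠ S.fst (F.rev (S.next d)) ∧
    ∀ a ∈ S.used, S.fst a = S.fst d → S.fst (F.rev a) ≠ S.fst (F.rev (S.next d)) := by
  set e := S.next d with he
  have hde : S.next.SameCycle d e := ⟨1, by simp [he]⟩
  have hge := hd.of_sameCycle hK hde
  have hgg := hd.of_sameCycle hK hg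
  have hs : S.rot.SameCycle e g := S.isRot.cyclic e hge.mem g hgg.mem hfst.symm
  have hnl := Flat.not_linked_of_split (σ := F.turn S.rot) (α := F.flipPerm) (a := .inl e)
    (b := .inl g) F.flip_flip F.flip_ne S.flat (by simpa using hne.symm) (turn_sameCycle hs)
    (hge.face_sameCycle hK (hde.symm.trans hg))
  rw [← F.turn_mul_swap] at hnl
  set σ := S.rot * Equiv.swap e g with hσ
  have hw : S.fst e = S.fst (F.rev d) := S.fst_next hd.mem
  have hL : ∀ a ∈ S.used, ∀ b ∈ S.used, S.fst a ≠ S.fst e → S.fst a = S.fst b →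
      Linked (F.turn σ) F.flipPerm (.inl a) (.inl b) := by
    intro a ha b hb hae hab
    refine (mem_of_sameCycle (Z := {z | z ∈ S.used ∧ S.fst z = S.fst a ∧
      Linked (F.turn σ) F.flipPerm (.inl a) (.inl z)}) ?_ (S.isRot.cyclic a ha b hb hab)
      ⟨ha, rfl, .refl _⟩).2.2
    rintro z ⟨hz, hza, hzl⟩
    refine ⟨S.isRot.mem hz, by rw [S.isRot.fst z hz, hza], hzl.trans _ _ _ (.rel _ _ (.inl ?_))⟩
    have h1 : z ≠ e := by rintro rfl; exact hae hza.symm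
    have h2 : z ≠ g := by rintro rfl; exact hae (hza.symm.trans hfst)
    exact congrArg Sum.inl (mul_swap_of_ne S.rot h1 h2)
  have hdne : S.fst d ≠ S.fst e := by rw [hw]; exact S.loopless d hd.mem
  have hene : S.fst (F.rev e) ≠ S.fst e := (S.loopless e hge.mem).symm
  have hlast : Linked (F.turn σ) F.flipPerm (.inl (F.rev d)) (.inl g) := by
    refine .symm _ _ (.rel _ _ (.inl ?_))
    have : σ g = F.rev d := by rw [hσ, mul_swap_right, he, rot_next]
    exact congrArg Sum.inl this
  have hend : Linked (F.turn σ) F.flipPerm (.inl d) (.inl g) :=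
    (linked_rev σ d).trans _ _ _ hlast
  refine ⟨fun hc => hnl ?_, fun a ha h1 h2 => hnl ?_⟩
  · exact (linked_rev σ e).trans _ _ _
      ((hL _ (S.rev_mem e hge.mem) d hd.mem hene hc.symm).trans _ _ _ hend)
  · refine (linked_rev σ e).trans _ _ _
      ((hL _ (S.rev_mem e hge.mem) _ (S.rev_mem a ha) hene h2.symm).trans _ _ _ ?_)
    refine ((linked_rev σ a).symm).trans _ _ _ ?_
    exact (hL a ha d hd.mem (by rw [h1]; exact hdne) h1).trans _ _ _ hend

theorem canInsert_chord (hK : S.HasKites) {c d g : A} (hc : c ∉ S.used) (hd : S.Good d)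
    (hg : S.next.SameCycle d g) (hne : g ≠ S.next d) (hfst : S.fst g = S.fst (S.next d)) :
    S.CanInsert c d (S.next (S.next d)) (S.fst d) (S.fst (F.rev (S.next d))) := by
  obtain ⟨h1, h2⟩ := chord_new hK hd hg hne hfst
  have he := S.next_mem hd.mem
  refine ⟨hc, .inl ⟨hd.mem, rfl⟩, .inl ⟨S.next_mem he, S.fst_next he⟩, h1, h2,
    S.flat_insert_of_face hc hd.mem (S.next_mem he) (hd.face_sameCycle hK ⟨2, ?_⟩)⟩
  rw [show (2 : ℤ) = 1 + 1 from rfl, zpow_add, zpow_one]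
  rfl

/-! ### Insertion of edges outside of the kites -/

section

variable {c k k' : A} {u v : Fin n} (h : S.CanInsert c k k' u v)

theorem insert_hasKites (hK : S.HasKites) (hk : S.Good k ∨ k = c) (hk' : S.Good k' ∨ k' = F.rev c) :
    (S.insert h).HasKites := by
  intro x e he
  have hxs : (F.cross x).isSome := by rw [he]; rfl
  have hxm := S.cross_mem x hxs
  have hk1 : ∀ y ∈ S.used, ((F.cross y).isSome ∨ (F.cross (S.rot y)).isSome) → y ≠ k := by
    rintro y hy h1 rfl
    rcases hk with hk | rfl
    · simp [hk.uncrossed, hk.rot_uncrossed] at h1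
    · exact h.new hy
  have hk2 : ∀ y ∈ S.used, ((F.cross y).isSome ∨ (F.cross (S.rot y)).isSome) → y ≠ k' := by
    rintro y hy h1 rfl
    rcases hk' with hk' | rfl
    · simp [hk'.uncrossed, hk'.rot_uncrossed] at h1
    · exact h.new' hy
  have hm := S.rev_mem _ (S.isRot.mem hxm)
  have h1 : (F.cross (S.rot (F.rev (S.rot x)))).isSome := by
    rw [hK x e he, F.isSome_rev, F.cross_turn _ _ he]; rfl
  rw [insert_rot, h.rot_of_ne hxm (hk1 x hxm (.inl hxs)) (hk2 x hxm (.inl hxs)),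
    h.rot_of_ne hm (hk1 _ hm (.inr h1)) (hk2 _ hm (.inr h1)), hK x e he]

theorem cross_new (h : S.CanInsert c k k' u v) : F.cross c = none :=
  S.cross_eq_none_of_not_mem h.new

theorem cross_new' (h : S.CanInsert c k k' u v) : F.cross (F.rev c) = none :=
  S.cross_eq_none_of_not_mem h.new'

theorem Good.insert {d : A} (hd : S.Good d) : (S.insert h).Good d := by
  refine ⟨mem_insert_of_mem h hd.mem, hd.uncrossed, ?_⟩
  rw [insert_rot]
  by_cases h1 : d = k
  · rw [h1, h.rot_left, cross_new h]
  by_cases h2 : d = k'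
  · rw [h2, h.rot_right, cross_new' h]
  rw [h.rot_of_ne hd.mem h1 h2, hd.rot_uncrossed]

theorem good_insert_new (hk : S.Good k ∨ k = c) : (S.insert h).Good c := by
  refine ⟨.inr (.inl rfl), cross_new h, ?_⟩
  rw [insert_rot, h.rot_new]
  rcases hk with hk | rfl
  · exact hk.rot_uncrossed
  · rw [S.isRot.fixed _ h.new, cross_new h]

theorem good_insert_new' (hk' : S.Good k' ∨ k' = F.rev c) : (S.insert h).Good (F.rev c) := by
  refine ⟨.inl rfl, cross_new' h, ?_⟩
  rw [insert_rot, h.rot_new']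
  rcases hk' with hk' | rfl
  · exact hk'.rot_uncrossed
  · rw [S.isRot.fixed _ h.new', cross_new' h]

theorem insert_next (a : A) :
    (S.insert h).next a = Equiv.swap k' (F.rev c) (Equiv.swap k c (S.next a)) := by
  rw [next, insert_rot]
  simp [next, mul_inv_rev]

end

/-! ### Closing a corner at a crossing -/

theorem remove_rot_of_ne {c a : A} (hc : F.cross c = none) (h1 : a ≠ c) (h2 : a ≠ F.rev c)
    (h3 : S.rot a ≠ c) (h4 : S.rot a ≠ F.rev c) : (S.remove c hc).rot a = S.rot a := by
  change detach (detach S.rot c) (F.rev c) a = _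
  rw [detach_of_ne h2, detach_of_ne h1 h3]
  rwa [detach_of_ne h1 h3]

/-- The edge `c` is the only edge, if any, that can close the corner to the left of `x`. -/
structure ClosesCorner (S : DartSystem F n) (x e c : A) : Prop where
  cross_eq : F.cross x = some e
  side : (c ∈ S.used ∧ S.fst c = S.fst x ∧ S.fst (F.rev c) = S.fst (F.rev e)) ∨
    (c ∉ S.used ∧ ∀ a ∈ S.used, S.fst a = S.fst x → S.fst (F.rev a) ≠ S.fst (F.rev e))

namespace ClosesCorner

variable {x e c : A}

theorem ends_ne (h : S.ClosesCorner x e c) : S.fst x ≠ S.fst (F.rev e) :=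
  (S.cross_ne_self (F.cross_rev' h.cross_eq)).symm

theorem cross_none (h : S.ClosesCorner x e c) : F.cross c = none := by
  rcases h.side with ⟨h1, h2, h3⟩ | ⟨h1, -⟩
  · by_contra hc
    have hxs : (F.cross x).isSome := by rw [h.cross_eq]; rfl
    have hcx := S.indep c x (Option.isSome_iff_ne_none.2 hc) hxs h2
    rw [hcx] at h3
    exact S.cross_ne_self (F.cross_rev h.cross_eq) h3
  · exact S.cross_eq_none_of_not_mem h1

theorem x_mem (h : S.ClosesCorner x e c) : x ∈ (S.remove c h.cross_none).used := by
  refine DartSystem.cross_mem _ _ ?_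
  rw [h.cross_eq]; rfl

theorem y_mem (h : S.ClosesCorner x e c) : F.rev e ∈ (S.remove c h.cross_none).used := by
  refine DartSystem.cross_mem _ _ ?_
  rw [F.cross_rev' h.cross_eq]; rfl

theorem canInsert (h : S.ClosesCorner x e c) :
    (S.remove c h.cross_none).CanInsert c x ((S.remove c h.cross_none).rot⁻¹ (F.rev e))
      (S.fst x) (S.fst (F.rev e)) := by
  set S₁ := S.remove c h.cross_none with hS₁
  have hnew : c ∉ S₁.used := fun hc => hc.1.2 rfl
  have hf : S₁.fst = S.fst := rfl
  refine ⟨hnew, .inl ⟨h.x_mem, rfl⟩,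
    .inl ⟨S₁.isRot.inv_mem h.y_mem, S₁.isRot.inv_fst h.y_mem⟩, h.ends_ne, ?_, ?_⟩
  · intro a ha h1 h2
    rw [hf] at h1 h2
    rcases h.side with ⟨h3, h4, h5⟩ | ⟨-, h3⟩
    · exact ha.1.2 (S.simple a ha.1.1 c h3 (h1.trans h4.symm) (h2.trans h5.symm))
    · exact h3 a ha.1.1 h1 h2
  · refine S₁.flat_insert_of_face hnew h.x_mem (S₁.isRot.inv_mem h.y_mem) ⟨2, ?_⟩
    rw [show (2 : ℤ) = 1 + 1 from rfl, zpow_add, zpow_one, Equiv.Perm.mul_apply,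
      F.face_inl_of_some _ h.cross_eq, F.face_inr]

/-- The system with the corner to the left of `x` closed. -/
def close (h : S.ClosesCorner x e c) : DartSystem F n := (S.remove c h.cross_none).insert h.canInsert

theorem mem_close (h : S.ClosesCorner x e c) {a : A} :
    a ∈ h.close.used ↔ a ∈ S.used ∨ a = c ∨ a = F.rev c := by
  change a ∈ Insert.insert (F.rev c) (Insert.insert c ((S.used \ {c}) \ {F.rev c})) ↔ _
  simp only [Set.mem_insert_iff, Set.mem_sdiff, Set.mem_singleton_iff]
  tauto

theorem close_fst (h : S.ClosesCorner x e c) {a : A} (ha : a ∈ S.used) :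
    h.close.fst a = S.fst a := by
  change Function.update (Function.update S.fst c (S.fst x)) (F.rev c) (S.fst (F.rev e)) a = _
  have hcc := F.rev_ne c
  rcases h.side with ⟨h3, h4, h5⟩ | ⟨h3, -⟩
  · by_cases h1 : a = F.rev c
    · simp [h1, h5]
    by_cases h2 : a = c
    · simp [h2, hcc.symm, h4]
    simp [h1, h2]
  · have h1 : a ≠ F.rev c := fun e => h3 (S.rev_mem_iff.1 (e ▸ ha))
    have h2 : a ≠ c := fun e => h3 (e ▸ ha)
    simp [h1, h2]

theorem close_fst_new (h : S.ClosesCorner x e c) : h.close.fst c = S.fst x := insert_fst_new _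

theorem close_fst_new' (h : S.ClosesCorner x e c) : h.close.fst (F.rev c) = S.fst (F.rev e) :=
  insert_fst_new' _

theorem kiteAt_self (h : S.ClosesCorner x e c) : h.close.KiteAt x := by
  intro e' he'
  have : e' = e := Option.some.inj (he'.symm.trans h.cross_eq)
  subst this
  have h1 : h.close.rot x = c := h.canInsert.rot_left
  have h2 := h.canInsert.rot_new'
  rw [h1]
  rw [perm_apply_inv] at h2
  exact h2

/-- The edge that closes the corner at `x` does not close any other corner. -/
theorem side_ne (h : S.ClosesCorner x e c) {x' e' s : A} (hx' : F.cross x' = some e')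
    (hne : x' ≠ x) (hs : h.close.fst s = S.fst x')
    (hs' : h.close.fst (F.rev s) = S.fst (F.rev e')) : s ≠ c ∧ s ≠ F.rev c := by
  have hxs : (F.cross x).isSome := by rw [h.cross_eq]; rfl
  have hxs' : (F.cross x').isSome := by rw [hx']; rfl
  constructor
  · rintro rfl
    rw [h.close_fst_new] at hs
    exact hne (S.indep _ _ hxs' hxs hs.symm)
  · rintro rfl
    rw [h.close_fst_new'] at hs
    rw [F.rev_rev, h.close_fst_new] at hs'
    have h1 : F.cross (F.rev e) = some x := F.cross_rev' h.cross_eq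
    have h2 := S.indep _ _ hxs' (by rw [h1]; rfl) hs.symm
    rw [← h2, hx'] at h1
    have h3 : e' = x := Option.some.inj h1
    rw [h3] at hs'
    exact S.loopless x (S.cross_mem x hxs) hs'

theorem kiteAt_of_ne (h : S.ClosesCorner x e c) {x' : A} (hne : x' ≠ x) (hK : S.KiteAt x') :
    h.close.KiteAt x' := by
  intro e' he'
  have hxs' : (F.cross x').isSome := by rw [he']; rfl
  have hxm := S.cross_mem x' hxs'
  have hsm := S.isRot.mem hxm
  have hrs := hK e' he'
  have hrm := S.rev_mem _ hsm
  obtain ⟨h1, h2⟩ := h.side_ne he' hne (s := S.rot x')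
    (by rw [h.close_fst hsm, S.isRot.fst x' hxm])
    (by rw [h.close_fst hrm, ← hrs, S.isRot.fst _ hrm])
  have hc0 := h.cross_none
  have hc1 : F.cross (F.rev c) = none := F.cross_rev_eq_none.2 hc0
  have hcr : (F.cross (F.rev e')).isSome := by rw [F.cross_rev' he']; rfl
  have hnc : ∀ y, (F.cross y).isSome → y ≠ c ∧ y ≠ F.rev c := by
    intro y hy
    constructor <;> (rintro rfl; simp [hc0, hc1] at hy)
  have h3 : F.rev (S.rot x') ≠ c := by rintro rfl; exact h2 (F.rev_rev _).symm
  have h4 : F.rev (S.rot x') ≠ F.rev c := fun e => h1 (F.rev_inj e)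
  have r1 : (S.remove c hc0).rot x' = S.rot x' :=
    remove_rot_of_ne hc0 (hnc x' hxs').1 (hnc x' hxs').2 h1 h2
  have r2 : (S.remove c hc0).rot (F.rev (S.rot x')) = F.rev e' := by
    rw [remove_rot_of_ne hc0 h3 h4, hrs]
    · rw [hrs]; exact (hnc _ hcr).1
    · rw [hrs]; exact (hnc _ hcr).2
  have hsn := S.cross_rot_eq_none he' hK
  have hyc : (F.cross (F.rev e)).isSome := by rw [F.cross_rev' h.cross_eq]; rfl
  have q1 : h.close.rot x' = S.rot x' := by
    rw [← r1]
    refine h.canInsert.rot_of_ne (cross_mem _ _ hxs') hne ?_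
    rintro rfl
    rw [perm_apply_inv] at r1
    rw [← r1] at hsn
    simp [hsn] at hyc
  rw [q1, ← r2]
  refine h.canInsert.rot_of_ne ⟨⟨hrm, h3⟩, h4⟩ ?_ ?_
  · rintro rfl
    have := h.cross_eq
    rw [F.cross_rev_eq_none.2 hsn] at this
    cases this
  · intro e1
    rw [e1, perm_apply_inv] at r2
    have hee := F.rev_inj r2
    have t1 := F.cross_turn _ _ he'
    rw [← hee, F.cross_turn _ _ h.cross_eq] at t1
    exact hne (F.rev_inj (Option.some.inj t1)).symm

end ClosesCorner

end DartSystem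

/-! ## Empty kites in connected graphs -/

namespace ICRotation

variable {V : Type*} {G : SimpleGraph V} (R : ICRotation G)

/-- All corners at crossings are closed by edges. -/
def HasKites : Prop := ∀ x e, R.cross x = some e → R.rot (R.rot x).symm = e.symm

variable {R} {x e : G.Dart}

theorem cross_symm (h : R.cross x = some e) : R.cross x.symm = some e.symm :=
  R.cross_turn _ _ (R.cross_turn _ _ h)

theorem cross_symm' (h : R.cross x = some e) : R.cross e.symm = some x := by
  simpa using R.cross_turn _ _ (cross_symm h)

theorem cross_fst_ne (h : R.cross x = some e) : x.fst ≠ e.fst := by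
  intro hf
  have h1 := R.cross_turn x e h
  have hxe : x = e := R.indep x e (by rw [h]; rfl) (by rw [h1]; rfl) hf
  rw [← hxe, h, ← hxe] at h1
  exact x.symm_ne (Option.some.inj h1).symm

theorem cross_symm_eq_none {d : G.Dart} (h : R.cross d = none) : R.cross d.symm = none := by
  by_contra hc
  obtain ⟨e, he⟩ := Option.ne_none_iff_exists'.1 hc
  have := cross_symm he
  rw [SimpleGraph.Dart.symm_symm, h] at this
  cases this

theorem flip_flip (h : R.Half) : R.flip (R.flip h) = h := by
  rcases h with d | ⟨d, hd⟩
  · by_cases h : (R.cross d).isSome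
    · simp [flip, h]
    · have h' : R.cross d = none := by simpa using h
      simp [flip, h', cross_symm_eq_none h']
  · have := R.cross_symm_isSome d hd
    simp [flip, this]

/-- The end-vertices of two edges. -/
def endSet (d e : G.Dart) : Set V := {d.fst, d.snd, e.fst, e.snd}

/-- The four directed versions of two edges. -/
def quad (x e : G.Dart) : Set G.Dart := {x, e, x.symm, e.symm}

theorem exists_cross_of_mem_quad (h : R.cross x = some e) {y : G.Dart} (hy : y ∈ quad x e) :
    ∃ z ∈ quad x e, R.cross y = some z ∧ endSet y z = endSet x e := by
  have hset : ∀ a b c d : V, ({a, b, c, d} : Set V) = {c, d, b, a} := by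
    intro a b c d; ext t; simp only [Set.mem_insert_iff, Set.mem_singleton_iff]; tauto
  have hset' : ∀ a b c d : V, ({a, b, c, d} : Set V) = {b, a, d, c} := by
    intro a b c d; ext t; simp only [Set.mem_insert_iff, Set.mem_singleton_iff]; tauto
  rcases hy with rfl | rfl | rfl | rfl
  · exact ⟨e, by simp [quad], h, rfl⟩
  · exact ⟨x.symm, by simp [quad], R.cross_turn _ _ h, (hset _ _ _ _).symm⟩
  · exact ⟨e.symm, by simp [quad], cross_symm h, hset' _ _ _ _⟩
  · refine ⟨x, by simp [quad], cross_symm' h, ?_⟩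
    change ({e.snd, e.fst, x.fst, x.snd} : Set V) = {x.fst, x.snd, e.fst, e.snd}
    rw [hset, hset', hset]

theorem mem_endSet_iff {v : V} : v ∈ endSet x e ↔ ∃ y ∈ quad x e, y.fst = v := by
  simp only [endSet, quad, Set.mem_insert_iff, Set.mem_singleton_iff]
  constructor
  · rintro (rfl | rfl | rfl | rfl)
    exacts [⟨x, by simp⟩, ⟨x.symm, by simp⟩, ⟨e, by simp⟩, ⟨e.symm, by simp⟩]
  · rintro ⟨y, rfl | rfl | rfl | rfl, rfl⟩ <;> simp

section Local

theorem rot_snd (hK : R.HasKites) (h : R.cross x = some e) : (R.rot x).snd = e.snd := by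
  have := congrArg (fun d => d.fst) (hK x e h)
  simp only [R.rot_fst] at this
  exact this

theorem rot_right (hK : R.HasKites) (h : R.cross x = some e) : R.rot (R.rot e).symm = x := by
  have := hK e x.symm (R.cross_turn _ _ h)
  simpa using this

theorem rot_right_snd : (R.rot e).symm.snd = e.fst := R.rot_fst e

theorem rot_right_fst (hK : R.HasKites) (h : R.cross x = some e) :
    (R.rot e).symm.fst = x.fst := rot_snd hK (R.cross_turn _ _ h)

theorem cross_rot_eq_none (hK : R.HasKites) (h : R.cross x = some e) :
    R.cross (R.rot x) = none := by
  by_contra hc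
  have hx : R.rot x = x :=
    R.indep _ _ (Option.isSome_iff_ne_none.2 hc) (by rw [h]; rfl) (R.rot_fst x)
  have h1 := rot_snd hK h
  rw [hx] at h1
  exact cross_fst_ne (cross_symm h) h1

theorem eq_of_mem_endSet (hK : R.HasKites) (h : R.cross x = some e) {f : G.Dart}
    (hf : f.fst = x.fst) (hs : f.snd ∈ endSet x e) : f = x ∨ f = R.rot x ∨ f = (R.rot e).symm := by
  have ext' : ∀ g : G.Dart, g.fst = x.fst → f.snd = g.snd → f = g := by
    intro g h1 h2
    exact SimpleGraph.Dart.ext _ _ (Prod.ext (hf.trans h1.symm) h2)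
  rcases hs with hs | hs | hs | hs
  · exact absurd (hf.trans hs.symm) f.fst_ne_snd
  · exact .inl (ext' x rfl hs)
  · exact .inr (.inr (ext' _ (rot_right_fst hK h) (hs.trans (R.rot_fst e).symm)))
  · exact .inr (.inl (ext' _ (R.rot_fst x) (hs.trans (rot_snd hK h).symm)))

theorem sameFaceOf_turn {S : Set V} {k : R.Half} (hk : ¬ R.InInduced S (R.turn k)) :
    R.SameFaceOf S k (R.turn k) := by
  have h1 : R.SameFaceOf S (R.flip (R.turn k)) k := .rel _ _ (.inl (flip_flip _).symm)
  have h2 : R.SameFaceOf S (R.turn k) (R.flip (R.turn k)) := .rel _ _ (.inr ⟨rfl, hk⟩)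
  exact (h2.trans _ _ _ h1).symm

variable [Finite G.Dart]

theorem sameFaceOf_corner (hK : R.HasKites) (h : R.cross x = some e) {f : G.Dart}
    (hf : f.fst = x.fst) (hfx : f ≠ x) (hfr : f ≠ (R.rot e).symm) :
    R.SameFaceOf (endSet x e) (.inl (R.rot x)) (.inl f) := by
  have := mem_of_sameCycle (σ := R.rot) (Z := {g | g.fst = x.fst ∧ (g = x ∨ g = (R.rot e).symm ∨
    R.SameFaceOf (endSet x e) (.inl (R.rot x)) (.inl g))}) ?_ (R.rot_cyclic x f hf.symm)
    ⟨rfl, .inl rfl⟩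
  · exact (this.2.resolve_left hfx).resolve_left hfr
  rintro g ⟨hg, hg'⟩
  refine ⟨(R.rot_fst g).trans hg, ?_⟩
  by_cases hgx : g = x
  · rw [hgx]; exact .inr (.inr (.refl _))
  by_cases hgr : g = (R.rot e).symm
  · rw [hgr, rot_right hK h]; exact .inl rfl
  have hg'' := (hg'.resolve_left hgx).resolve_left hgr
  by_cases hind : (R.rot g).snd ∈ endSet x e
  · rcases eq_of_mem_endSet hK h ((R.rot_fst g).trans hg) hind with h1 | h1 | h1
    · exact .inl h1
    · exact absurd (R.rot.injective h1) hgx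
    · exact .inr (.inl h1)
  · exact .inr (.inr (hg''.trans _ _ _ (sameFaceOf_turn (k := .inl g) fun hc => hind hc.2)))

theorem sameFaceOf_next_side (hK : R.HasKites) (h : R.cross x = some e) :
    R.SameFaceOf (endSet x e) (.inl (R.rot x)) (.inl (R.rot e)) := by
  set f := R.rot.symm (R.rot e).symm with hf
  have hrf : R.rot f = (R.rot e).symm := by simp [hf]
  have hne : (R.rot e).symm ≠ x := by
    intro hc
    have h1 := cross_symm_eq_none (cross_rot_eq_none hK (R.cross_turn _ _ h))
    rw [hc, h] at h1
    cases h1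
  have hfx : f ≠ x := by
    intro hc
    have h1 := rot_snd hK h
    rw [← hc, hrf, rot_right_snd] at h1
    exact e.fst_ne_snd h1
  have hfr : f ≠ (R.rot e).symm := by
    intro hc
    rw [hc, rot_right hK h] at hrf
    exact hne hrf.symm
  have hff : f.fst = x.fst := by
    rw [← R.rot_fst f, hrf, rot_right_fst hK h]
  have h1 := sameFaceOf_corner hK h hff hfx hfr
  have h2 : R.SameFaceOf (endSet x e) (.inl (R.rot e)) (.inl f) := by
    refine .rel _ _ (.inl ?_)
    have h0 := cross_rot_eq_none hK (R.cross_turn _ _ h)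
    simp [FaceNext, turn, flip, h0, hrf]
  exact h1.trans _ _ _ h2.symm

end Local

variable [Finite G.Dart]

theorem sameFaceOf_quad (hK : R.HasKites) (h : R.cross x = some e) {y : G.Dart}
    (hy : y ∈ quad x e) : R.SameFaceOf (endSet x e) (.inl (R.rot x)) (.inl (R.rot y)) := by
  have h1 := sameFaceOf_next_side hK h
  have step : ∀ y z, y ∈ quad x e → R.cross y = some z →
      R.SameFaceOf (endSet x e) (.inl (R.rot y)) (.inl (R.rot z)) := by
    intro y z hy hyz
    obtain ⟨z', -, h2, h3⟩ := exists_cross_of_mem_quad h hy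
    have : z = z' := Option.some.inj (hyz.symm.trans h2)
    subst this
    rw [← h3]
    exact sameFaceOf_next_side hK hyz
  have h2 := step e x.symm (by simp [quad]) (R.cross_turn _ _ h)
  have h3 := step x.symm e.symm (by simp [quad]) (cross_symm h)
  rcases hy with rfl | rfl | rfl | rfl
  · exact .refl _
  · exact h1
  · exact h1.trans _ _ _ h2
  · exact h1.trans _ _ _ (h2.trans _ _ _ h3)

theorem sameFaceOf_at_end (hK : R.HasKites) (h : R.cross x = some e) {f : G.Dart}
    (hf : f.fst ∈ endSet x e) (hc : R.cross f = none) (hc' : R.cross (R.rot f) = none) :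
    R.SameFaceOf (endSet x e) (.inl (R.rot x)) (.inl f) := by
  obtain ⟨y, hy, hyf⟩ := mem_endSet_iff.1 hf
  obtain ⟨z, hz, hyz, he⟩ := exists_cross_of_mem_quad h hy
  refine (sameFaceOf_quad hK h hy).trans _ _ _ ?_
  rw [← he]
  refine sameFaceOf_corner hK hyz hyf.symm ?_ ?_
  · rintro rfl; rw [hyz] at hc; cases hc
  · rintro rfl; rw [rot_right hK hyz, hyz] at hc'; cases hc'

theorem sameFaceOf_leaving (hK : R.HasKites) (h : R.cross x = some e) {f : G.Dart}
    (hf : f.fst ∈ endSet x e) (hs : f.snd ∉ endSet x e) :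
    R.SameFaceOf (endSet x e) (.inl (R.rot x)) (.inl f) := by
  obtain ⟨y, hy, hyf⟩ := mem_endSet_iff.1 hf
  obtain ⟨z, hz, hyz, he⟩ := exists_cross_of_mem_quad h hy
  refine (sameFaceOf_quad hK h hy).trans _ _ _ ?_
  rw [← he] at hs ⊢
  refine sameFaceOf_corner hK hyz hyf.symm ?_ ?_
  · rintro rfl; exact hs (by simp [endSet])
  · rintro rfl
    rw [rot_right_snd] at hs
    exact hs (by simp [endSet])

theorem sameFaceOf_vertex {S : Set V} {f g : G.Dart} (hf : f.fst ∉ S) (hfg : f.fst = g.fst) :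
    R.SameFaceOf S (.inl f) (.inl g) := by
  refine (mem_of_sameCycle (σ := R.rot) (Z := {g | g.fst ∉ S ∧ R.SameFaceOf S (.inl f) (.inl g)}) ?_
    (R.rot_cyclic f g hfg) ⟨hf, .refl _⟩).2
  rintro g ⟨hg, hs⟩
  refine ⟨by rwa [R.rot_fst], hs.trans _ _ _ (sameFaceOf_turn (k := .inl g) fun hc => hg ?_)⟩
  have := hc.1
  rwa [turn, under, R.rot_fst] at this

theorem sameFaceOf_symm (h : R.cross x = some e) {f : G.Dart} (hf : f.fst ∉ endSet x e) :
    R.SameFaceOf (endSet x e) (.inl f) (.inl f.symm) := by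
  by_cases hc : (R.cross f).isSome
  · obtain ⟨g, hg⟩ := Option.isSome_iff_exists.1 hc
    have hgs : g.snd ∉ endSet x e := by
      intro hgf
      obtain ⟨y, hy, hyf⟩ := mem_endSet_iff.1 hgf
      obtain ⟨z, hz, hyz, -⟩ := exists_cross_of_mem_quad h hy
      have h1 := cross_symm' hg
      have h2 : y = g.symm := R.indep _ _ (by rw [hyz]; rfl) (by rw [h1]; rfl) hyf
      rw [← h2, hyz] at h1
      have h3 : z = f := Option.some.inj h1
      exact hf (mem_endSet_iff.2 ⟨z, hz, by rw [h3]⟩)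
    have hfs := R.cross_symm_isSome f hc
    have hgs' : (R.cross g.symm).isSome := by rw [cross_symm' hg]; rfl
    have t1 : R.turn (.inr ⟨f.symm, hfs⟩) = .inr ⟨g.symm, hgs'⟩ := by
      simp [turn, cross_symm hg]
    have t2 : R.turn (.inr ⟨g.symm, hgs'⟩) = .inr ⟨f, hc⟩ := by
      simp [turn, cross_symm' hg]
    have s1 : R.SameFaceOf (endSet x e) (.inl f) (.inr ⟨f.symm, hfs⟩) :=
      .rel _ _ (.inr ⟨by simp [flip, hc], fun h => hf h.1⟩)
    have s2 := sameFaceOf_turn (S := endSet x e) (k := .inr ⟨f.symm, hfs⟩)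
      (by rw [t1]; exact fun h => hgs h.1)
    have s3 := sameFaceOf_turn (S := endSet x e) (k := .inr ⟨g.symm, hgs'⟩)
      (by rw [t2]; exact fun h => hf h.1)
    rw [t1] at s2
    rw [t2] at s3
    have s4 : R.SameFaceOf (endSet x e) (.inr ⟨f, hc⟩) (.inl f.symm) :=
      .rel _ _ (.inr ⟨rfl, fun h => hf h.1⟩)
    exact s1.trans _ _ _ (s2.trans _ _ _ (s3.trans _ _ _ s4))
  · exact .rel _ _ (.inr ⟨by simp [flip, hc], fun h => hf h.1⟩)

theorem sameFaceOf_outside (hG : G.Preconnected) (hK : R.HasKites) (h : R.cross x = some e)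
    {f : G.Dart} (hf : f.fst ∉ endSet x e) :
    R.SameFaceOf (endSet x e) (.inl (R.rot x)) (.inl f) := by
  have key : ∀ u v (p : G.Walk u v), v ∈ endSet x e → u ∉ endSet x e → ∀ f : G.Dart, f.fst = u →
      R.SameFaceOf (endSet x e) (.inl (R.rot x)) (.inl f) := by
    intro u v p hv
    induction p with
    | nil => exact fun hu => absurd hv hu
    | @cons u w v huw p ih =>
      intro hu f hfu
      let g : G.Dart := ⟨(u, w), huw⟩
      have h1 : R.SameFaceOf (endSet x e) (.inl g) (.inl g.symm) := sameFaceOf_symm h hu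
      have h2 : R.SameFaceOf (endSet x e) (.inl g) (.inl f) := sameFaceOf_vertex hu hfu.symm
      have h3 : R.SameFaceOf (endSet x e) (.inl (R.rot x)) (.inl g.symm) := by
        by_cases hw : w ∈ endSet x e
        · exact sameFaceOf_leaving hK h hw hu
        · exact ih hv hw _ rfl
      exact h3.trans _ _ _ (h1.symm.trans _ _ _ h2)
  obtain ⟨p⟩ := hG f.fst x.fst
  exact key _ _ p (by simp [endSet]) hf f rfl

theorem sameFaceOf_of_uncrossed (hG : G.Preconnected) (hK : R.HasKites) (h : R.cross x = some e)
    {f : G.Dart} (hc : R.cross f = none) (hc' : R.cross (R.rot f) = none) :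
    R.SameFaceOf (endSet x e) (.inl (R.rot x)) (.inl f) := by
  by_cases hf : f.fst ∈ endSet x e
  · exact sameFaceOf_at_end hK h hf hc hc'
  · exact sameFaceOf_outside hG hK h hf

theorem adj_of_mem_endSet (hK : R.HasKites) (h : R.cross x = some e) {u v : V}
    (hu : u ∈ endSet x e) (hv : v ∈ endSet x e) (huv : u ≠ v) : G.Adj u v := by
  obtain ⟨y, hy, rfl⟩ := mem_endSet_iff.1 hu
  obtain ⟨z, hz, hyz, he⟩ := exists_cross_of_mem_quad h hy
  rw [← he] at hv
  rcases hv with rfl | rfl | rfl | rfl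
  · exact absurd rfl huv
  · exact y.adj
  · have := (R.rot z).symm.adj
    rwa [rot_right_fst hK hyz, rot_right_snd] at this
  · have := (R.rot y).adj
    rwa [R.rot_fst, rot_snd hK hyz] at this

end ICRotation

/-- In a connected graph in which the corners at the crossings are closed, and whose outer face
has no crossing on its boundary, crossing edges induce empty kites. -/
theorem ICPlaneGraph.inducesEmptyKite {n : ℕ} (G : ICPlaneGraph n) (hG : G.graph.Preconnected)
    (hK : G.emb.HasKites) {o : G.graph.Dart} (ho : G.outer = some o)
    (hc : G.emb.cross o = none) (hc' : G.emb.cross (G.emb.rot o) = none) {x e : G.graph.Dart}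
    (h : G.emb.cross x = some e) : G.InducesEmptyKite x e := by
  classical
  have hfin : Finite G.graph.Dart :=
    Finite.of_injective SimpleGraph.Dart.toProd fun _ _ => SimpleGraph.Dart.ext _ _
  have hends : G.ends x e = ICRotation.endSet x e := rfl
  have ho' := ICRotation.sameFaceOf_of_uncrossed hG hK h hc hc'
  have hout : ∀ k, G.emb.SameFaceOf (ICRotation.endSet x e) (.inl (G.emb.rot x)) k →
      G.InOuterFaceOf (G.ends x e) k := fun k hk => ⟨o, ho, ho'.symm.trans _ _ _ hk⟩
  refine ⟨⟨?_, ?_, ?_⟩, ?_⟩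
  · intro u hu v hv huv
    exact ICRotation.adj_of_mem_endSet hK h hu hv huv
  · intro v hv
    obtain ⟨y, hy, rfl⟩ := ICRotation.mem_endSet_iff.1 hv
    obtain ⟨z, hz, hyz, he⟩ := ICRotation.exists_cross_of_mem_quad h hy
    refine ⟨G.emb.rot y, G.emb.rot_fst y, ?_, hout _ (ICRotation.sameFaceOf_quad hK h hy)⟩
    rw [ICRotation.rot_snd hK hyz, hends, ← he]
    simp [ICRotation.endSet]
  · intro f hf hf' hfx hfe
    obtain ⟨y, hy, hyf⟩ := ICRotation.mem_endSet_iff.1 hf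
    obtain ⟨z, hz, hyz, he⟩ := ICRotation.exists_cross_of_mem_quad h hy
    rw [hends, ← he] at hf'
    rcases ICRotation.eq_of_mem_endSet hK hyz hyf.symm hf' with rfl | rfl | rfl
    · rcases hy with rfl | rfl | rfl | rfl
      · exact absurd rfl hfx
      · exact absurd rfl hfe
      · exact absurd (SimpleGraph.Dart.edge_symm _) hfx
      · exact absurd (SimpleGraph.Dart.edge_symm _) hfe
    · exact ⟨ICRotation.cross_rot_eq_none hK hyz, .inl (hout _ (ICRotation.sameFaceOf_quad hK h hy))⟩
    · refine ⟨ICRotation.cross_symm_eq_none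
        (ICRotation.cross_rot_eq_none hK (G.emb.cross_turn _ _ hyz)), .inr (hout _ ?_)⟩
      rw [SimpleGraph.Dart.symm_symm]
      exact ICRotation.sameFaceOf_quad hK h hz
  · intro f hf
    exact hout _ (ICRotation.sameFaceOf_outside hG hK h hf)

/-! ## The embedded graph of a system of darts -/

namespace DartSystem

variable {A : Type} {F : Frame A} {n : ℕ} (S : DartSystem F n)

/-- The graph of a system of darts. -/
def graph : SimpleGraph (Fin n) where
  Adj u v := ∃ a ∈ S.used, S.fst a = u ∧ S.fst (F.rev a) = v
  symm := ⟨by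
    rintro u v ⟨a, ha, rfl, rfl⟩
    exact ⟨F.rev a, S.rev_mem a ha, rfl, by rw [F.rev_rev]⟩⟩
  loopless := ⟨by
    rintro u ⟨a, ha, h1, h2⟩
    exact S.loopless a ha (h1.trans h2.symm)⟩

theorem adj_of_mem {a : A} (ha : a ∈ S.used) : S.graph.Adj (S.fst a) (S.fst (F.rev a)) :=
  ⟨a, ha, rfl, rfl⟩

/-- The used darts are the darts of the graph. -/
noncomputable def dartEquiv : S.used ≃ S.graph.Dart :=
  Equiv.ofBijective (fun a => ⟨(S.fst a, S.fst (F.rev a)), S.adj_of_mem a.2⟩) <| by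
    constructor
    · rintro ⟨a, ha⟩ ⟨b, hb⟩ hab
      have h1 := congrArg SimpleGraph.Dart.toProd hab
      exact Subtype.ext (S.simple a ha b hb (congrArg Prod.fst h1) (congrArg Prod.snd h1))
    · rintro ⟨⟨u, v⟩, a, ha, h1, h2⟩
      exact ⟨⟨a, ha⟩, SimpleGraph.Dart.ext _ _ (Prod.ext h1 h2)⟩

theorem dartEquiv_fst (a : S.used) : (S.dartEquiv a).fst = S.fst a := rfl

theorem dartEquiv_symm (a : S.used) :
    (S.dartEquiv a).symm = S.dartEquiv ⟨F.rev a, S.rev_mem a a.2⟩ :=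
  SimpleGraph.Dart.ext _ _ (Prod.ext rfl (by
    change S.fst a = S.fst (F.rev (F.rev a))
    rw [F.rev_rev]))

theorem mem_of_cross_eq {a e : A} (h : F.cross a = some e) : e ∈ S.used :=
  S.cross_mem e (by rw [F.cross_turn _ _ h]; rfl)

/-- The crossings as a function on the used darts. -/
def crossUsed (a : S.used) : Option S.used :=
  (F.cross a).pmap Subtype.mk fun _ he => S.mem_of_cross_eq he

theorem crossUsed_eq_some {a b : S.used} : S.crossUsed a = some b ↔ F.cross a = some b.1 := by
  obtain ⟨b, hb⟩ := b
  rw [crossUsed, Option.pmap_eq_some_iff]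
  constructor
  · rintro ⟨e, he, h1, h2⟩
    rw [h1]
    exact congrArg some (congrArg Subtype.val h2).symm
  · intro h
    exact ⟨b, hb, h, rfl⟩

theorem crossUsed_isSome {a : S.used} : (S.crossUsed a).isSome ↔ (F.cross a).isSome := by
  simp [crossUsed]

variable [Finite A] [DecidableEq A]

/-- The embedding of the graph of a system of darts. -/
noncomputable def emb : ICRotation S.graph where
  rot := S.dartEquiv.permCongr
    (S.rot.subtypePerm (p := (· ∈ S.used)) (apply_mem_iff fun _ => S.isRot.mem))
  rot_fst d := by
    obtain ⟨a, rfl⟩ := S.dartEquiv.surjective d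
    rw [Equiv.permCongr_apply, Equiv.symm_apply_apply, dartEquiv_fst, dartEquiv_fst]
    exact S.isRot.fst a a.2
  rot_cyclic d e h := by
    obtain ⟨⟨a, ha⟩, rfl⟩ := S.dartEquiv.surjective d
    obtain ⟨⟨b, hb⟩, rfl⟩ := S.dartEquiv.surjective e
    have hs := S.isRot.cyclic a ha b hb h
    rw [← Equiv.Perm.sameCycle_subtypePerm (h := apply_mem_iff fun _ => S.isRot.mem) (x := ⟨a, ha⟩)
      (y := ⟨b, hb⟩)] at hs
    obtain ⟨i, hi⟩ := hs
    refine ⟨i, ?_⟩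
    rw [← hi]
    have : ∀ (σ : Equiv.Perm S.used) (i : ℤ) (x : S.used),
        (S.dartEquiv.permCongr σ ^ i) (S.dartEquiv x) = S.dartEquiv ((σ ^ i) x) := by
      intro σ i x
      have h1 : S.dartEquiv.permCongr σ ^ i = S.dartEquiv.permCongrHom (σ ^ i) := by
        rw [map_zpow]; rfl
      rw [h1]
      simp [Equiv.permCongrHom]
    exact this _ i _
  cross d := (S.crossUsed (S.dartEquiv.symm d)).map S.dartEquiv
  cross_turn d e h := by
    obtain ⟨a, rfl⟩ := S.dartEquiv.surjective d
    obtain ⟨b, rfl⟩ := S.dartEquiv.surjective e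
    simp only [Equiv.symm_apply_apply, Option.map_eq_some_iff, EmbeddingLike.apply_eq_iff_eq,
      exists_eq_right, crossUsed_eq_some] at h ⊢
    refine ⟨_, ?_, (S.dartEquiv_symm a).symm⟩
    exact F.cross_turn _ _ h
  indep d e hd he h := by
    obtain ⟨a, rfl⟩ := S.dartEquiv.surjective d
    obtain ⟨b, rfl⟩ := S.dartEquiv.surjective e
    simp only [Equiv.symm_apply_apply, Option.isSome_map, crossUsed_isSome] at hd he
    rw [Subtype.ext (S.indep a b hd he h)]

theorem emb_rot (a : S.used) :
    S.emb.rot (S.dartEquiv a) = S.dartEquiv ⟨S.rot a, S.isRot.mem a.2⟩ := by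
  change S.dartEquiv.permCongr _ _ = _
  rw [Equiv.permCongr_apply, Equiv.symm_apply_apply]
  rfl

theorem emb_cross (a : S.used) :
    S.emb.cross (S.dartEquiv a) = (S.crossUsed a).map S.dartEquiv := by
  change (S.crossUsed (S.dartEquiv.symm _)).map S.dartEquiv = _
  rw [Equiv.symm_apply_apply]

theorem emb_cross_eq_some {a b : S.used} :
    S.emb.cross (S.dartEquiv a) = some (S.dartEquiv b) ↔ F.cross a = some b.1 := by
  rw [emb_cross]
  simp [crossUsed_eq_some]

theorem emb_cross_isSome {a : S.used} :
    (S.emb.cross (S.dartEquiv a)).isSome ↔ (F.cross a).isSome := by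
  rw [emb_cross]
  simp [crossUsed_isSome]

theorem emb_cross_eq_none {a : S.used} :
    S.emb.cross (S.dartEquiv a) = none ↔ F.cross a = none := by
  rw [← Option.not_isSome_iff_eq_none, ← Option.not_isSome_iff_eq_none, emb_cross_isSome]

theorem isSome_of_emb {d : S.graph.Dart} (h : (S.emb.cross d).isSome) :
    (F.cross (S.dartEquiv.symm d).1).isSome := by
  obtain ⟨a, rfl⟩ := S.dartEquiv.surjective d
  rw [emb_cross_isSome] at h
  simpa using h

/-- The darts of the planarization of the graph, as darts of the planarization of the system. -/
noncomputable def halfMap : S.emb.Half ⊕ {a // a ∉ S.used} → F.Half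
  | .inl (.inl d) => .inl (S.dartEquiv.symm d).1
  | .inl (.inr d) => .inr ⟨(S.dartEquiv.symm d.1).1, S.isSome_of_emb d.2⟩
  | .inr a => .inl a.1

theorem halfMap_bijective : Function.Bijective S.halfMap := by
  constructor
  · rintro ((d | d) | a) ((d' | d') | a') h
    · simp only [halfMap, Sum.inl.injEq] at h
      rw [S.dartEquiv.symm.injective (Subtype.ext h)]
    · simp [halfMap] at h
    · simp only [halfMap, Sum.inl.injEq] at h
      exact absurd (h ▸ (S.dartEquiv.symm d).2) a'.2
    · simp [halfMap] at h
    · simp only [halfMap, Sum.inr.injEq, Subtype.mk.injEq] at h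
      rw [Subtype.ext (S.dartEquiv.symm.injective (Subtype.ext h))]
    · simp [halfMap] at h
    · simp only [halfMap, Sum.inl.injEq] at h
      exact absurd (h ▸ (S.dartEquiv.symm d').2) a.2
    · simp [halfMap] at h
    · simp only [halfMap, Sum.inl.injEq] at h
      rw [Subtype.ext h]
  · rintro (a | ⟨a, ha⟩)
    · by_cases hu : a ∈ S.used
      · exact ⟨.inl (.inl (S.dartEquiv ⟨a, hu⟩)), by simp [halfMap]⟩
      · exact ⟨.inr ⟨a, hu⟩, rfl⟩
    · exact ⟨.inl (.inr ⟨S.dartEquiv ⟨a, S.cross_mem a ha⟩, S.emb_cross_isSome.2 ha⟩),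
        by simp [halfMap]⟩

theorem emb_planar : S.emb.Planar := by
  change Flat S.emb.turn S.emb.flip
  have hfin : Finite S.graph.Dart := Finite.of_equiv _ S.dartEquiv
  have hr : ∀ a : {a // a ∉ S.used}, F.rev a.1 ∉ S.used := fun a h => a.2 (S.rev_mem_iff.1 h)
  rw [← flat_sum_iff (U := {a // a ∉ S.used}) (ρ := fun a => ⟨F.rev a.1, hr a⟩)
    (fun a => Subtype.ext (F.rev_rev _)) (fun a h => F.rev_ne a.1 (congrArg Subtype.val h))]
  refine (flat_congr (Equiv.ofBijective _ S.halfMap_bijective) ?_ ?_).2 S.flat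
  · rintro ((d | ⟨d, hd⟩) | a)
    · obtain ⟨a, rfl⟩ := S.dartEquiv.surjective d
      simp [halfMap, ICRotation.turn, emb_rot, Frame.turn]
    · obtain ⟨a, rfl⟩ := S.dartEquiv.surjective d
      obtain ⟨e, he⟩ := Option.isSome_iff_exists.1 (S.emb_cross_isSome.1 hd)
      have he' : S.emb.cross (S.dartEquiv a) = some (S.dartEquiv ⟨e, S.mem_of_cross_eq he⟩) :=
        S.emb_cross_eq_some.2 he
      simp [halfMap, ICRotation.turn, Frame.turn, Frame.crossPerm, he, he']
    · simp [halfMap, Frame.turn, S.isRot.fixed a.1 a.2]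
  · rintro ((d | ⟨d, hd⟩) | a)
    · obtain ⟨a, rfl⟩ := S.dartEquiv.surjective d
      by_cases hc : (F.cross a).isSome
      · have hc' := S.emb_cross_isSome.2 hc
        simp [halfMap, ICRotation.flip, hc', dartEquiv_symm, Frame.flipPerm, Frame.flip, hc]
      · have hc' : ¬ (S.emb.cross (S.dartEquiv a)).isSome := fun h => hc (S.emb_cross_isSome.1 h)
        simp [halfMap, ICRotation.flip, hc', dartEquiv_symm, Frame.flipPerm, Frame.flip, hc]
    · obtain ⟨a, rfl⟩ := S.dartEquiv.surjective d
      simp [halfMap, ICRotation.flip, dartEquiv_symm, Frame.flipPerm, Frame.flip]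
    · have := S.cross_eq_none_of_not_mem a.2
      simp [halfMap, Frame.flipPerm, Frame.flip, this]

theorem emb_hasKites (hK : S.HasKites) : S.emb.HasKites := by
  intro x e h
  obtain ⟨a, rfl⟩ := S.dartEquiv.surjective x
  obtain ⟨b, rfl⟩ := S.dartEquiv.surjective e
  have h1 := hK a b (S.emb_cross_eq_some.1 h)
  rw [emb_rot, dartEquiv_symm, emb_rot, dartEquiv_symm]
  congr 1
  exact Subtype.ext h1

/-! ### Biconnectivity -/

/-- `x` and `y` are connected in the graph without the vertex `v`. -/
def JoinedAvoiding (v x y : Fin n) : Prop :=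
  ∃ hx hy, (S.graph.induce {u : Fin n | u ≠ v}).Reachable ⟨x, hx⟩ ⟨y, hy⟩

variable {S}

theorem JoinedAvoiding.refl {v x : Fin n} (h : x ≠ v) : S.JoinedAvoiding v x x :=
  ⟨h, h, .refl _⟩

theorem JoinedAvoiding.symm {v x y : Fin n} (h : S.JoinedAvoiding v x y) :
    S.JoinedAvoiding v y x := by
  obtain ⟨hx, hy, h⟩ := h
  exact ⟨hy, hx, h.symm⟩

theorem JoinedAvoiding.trans {v x y z : Fin n} (h : S.JoinedAvoiding v x y)
    (h' : S.JoinedAvoiding v y z) : S.JoinedAvoiding v x z := by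
  obtain ⟨hx, hy, h⟩ := h
  obtain ⟨_, hz, h'⟩ := h'
  exact ⟨hx, hz, h.trans h'⟩

theorem JoinedAvoiding.of_adj {v x y : Fin n} (h : S.graph.Adj x y) (hx : x ≠ v) (hy : y ≠ v) :
    S.JoinedAvoiding v x y :=
  ⟨hx, hy, SimpleGraph.Adj.reachable (by simpa using h)⟩

theorem adj_of_cross (hK : S.HasKites) {x e : A} (h : F.cross x = some e) :
    S.graph.Adj (S.fst x) (S.fst (F.rev e)) := by
  have hx := S.cross_mem x (by rw [h]; rfl)
  refine ⟨S.rot x, S.isRot.mem hx, S.isRot.fst x hx, ?_⟩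
  rw [← hK x e h, S.isRot.fst _ (S.rev_mem _ (S.isRot.mem hx))]

/-- Every face without crossings visits each vertex at most once. -/
def SimpleFaces (S : DartSystem F n) : Prop :=
  ∀ d d', S.Good d → S.next.SameCycle d d' → S.fst d = S.fst d' → d = d'

theorem joined_consecutive (hK : S.HasKites) (hF : S.SimpleFaces) {a : A} (ha : a ∈ S.used) :
    S.JoinedAvoiding (S.fst a) (S.fst (F.rev a)) (S.fst (F.rev (S.rot a))) := by
  have hrm := S.isRot.mem ha
  have hrf := S.isRot.fst a ha
  have hn1 : S.fst (F.rev a) ≠ S.fst a := (S.loopless a ha).symm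
  have hn2 : S.fst (F.rev (S.rot a)) ≠ S.fst a := by
    rw [← hrf]; exact (S.loopless _ hrm).symm
  by_cases h1 : F.cross a = none
  · by_cases h2 : F.cross (S.rot a) = none
    · have hg : S.Good a := ⟨ha, h1, h2⟩
      have hlast : S.next (F.rev (S.rot a)) = a := by
        rw [next_apply, F.rev_rev, perm_inv_apply]
      have hs : S.next.SameCycle a (F.rev (S.rot a)) :=
        Equiv.Perm.SameCycle.symm ⟨1, by rw [zpow_one, hlast]⟩
      have := mem_of_sameCycle (Z := {x | S.next.SameCycle a x ∧
        (x = a ∨ S.JoinedAvoiding (S.fst a) (S.fst (F.rev a)) (S.fst x))}) ?_ hs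
        ⟨.refl _ _, .inl rfl⟩
      · refine this.2.resolve_left fun hc => hn2 ?_
        rw [hc]
      · rintro x ⟨hx, hx'⟩
        have hxn : S.next.SameCycle a (S.next x) := hx.trans ⟨1, by simp⟩
        have hxm := (hg.of_sameCycle hK hx).mem
        refine ⟨hxn, ?_⟩
        by_cases hxa : x = a
        · right
          rw [hxa, S.fst_next ha]
          exact .refl hn1
        · by_cases hxn' : S.next x = a
          · exact .inl hxn'
          right
          have hj := hx'.resolve_left hxa
          have hne : S.fst (S.next x) ≠ S.fst a := fun hc => hxn' (hF _ _ hg hxn hc.symm).symm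
          rw [S.fst_next hxm] at hne ⊢
          obtain ⟨_, hxv, -⟩ := id hj
          exact hj.trans (.of_adj (S.adj_of_mem hxm) hxv hne)
    · obtain ⟨e, he⟩ := Option.ne_none_iff_exists'.1 h2
      have h3 := hK e _ (F.cross_turn _ _ he)
      rw [F.rev_rev] at h3
      have h4 := S.rot.injective h3
      have h5 := adj_of_cross hK (F.cross_rev he)
      have h6 : S.fst (F.rev a) = S.fst e := by
        rw [← h4, F.rev_rev, S.isRot.fst e (S.mem_of_cross_eq he)]
      rw [F.rev_rev, ← h6] at h5
      exact (JoinedAvoiding.of_adj h5 hn2 hn1).symm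
  · obtain ⟨e, he⟩ := Option.ne_none_iff_exists'.1 h1
    have h5 := adj_of_cross hK (F.cross_rev' he)
    have h6 : S.fst (F.rev (S.rot a)) = S.fst (F.rev e) := by
      rw [← hK a e he, S.isRot.fst _ (S.rev_mem _ hrm)]
    rw [← h6] at h5
    exact (JoinedAvoiding.of_adj h5 hn2 hn1).symm

theorem joined_neighbours (hK : S.HasKites) (hF : S.SimpleFaces) {a b : A} (ha : a ∈ S.used)
    (hb : b ∈ S.used) (hab : S.fst a = S.fst b) :
    S.JoinedAvoiding (S.fst a) (S.fst (F.rev a)) (S.fst (F.rev b)) := by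
  refine (mem_of_sameCycle (Z := {x | x ∈ S.used ∧ S.fst x = S.fst a ∧
    S.JoinedAvoiding (S.fst a) (S.fst (F.rev a)) (S.fst (F.rev x))}) ?_
    (S.isRot.cyclic a ha b hb hab) ⟨ha, rfl, .refl (S.loopless a ha).symm⟩).2.2
  rintro x ⟨hx, hxa, hj⟩
  have := joined_consecutive hK hF hx
  rw [hxa] at this
  exact ⟨S.isRot.mem hx, by rw [S.isRot.fst x hx, hxa], hj.trans this⟩

theorem biconnected (hK : S.HasKites) (hF : S.SimpleFaces) (hC : S.graph.Connected) :
    Biconnected S.graph := by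
  refine ⟨hC, fun v => ?_⟩
  rintro ⟨x, hx⟩ ⟨y, hy⟩
  have key : ∀ z (p : S.graph.Walk z y), (z ≠ v → S.JoinedAvoiding v z y) ∧
      (z = v → ∃ u, S.graph.Adj v u ∧ S.JoinedAvoiding v u y) := by
    intro z p
    induction p with
    | nil => exact ⟨fun _ => .refl hy, fun h => absurd h hy⟩
    | @cons z w _ hzw p ih =>
      obtain ⟨ih1, ih2⟩ := ih hy
      refine ⟨fun hz => ?_, fun hz => ⟨w, hz ▸ hzw, ih1 fun hw => ?_⟩⟩
      · by_cases hw : w = v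
        · obtain ⟨u, ⟨b, hb, hbv, hbu⟩, hj⟩ := ih2 hw
          obtain ⟨a, ha, haw, haz⟩ := hzw.symm
          have := joined_neighbours hK hF ha hb (by rw [haw, hbv, hw])
          rw [haw, hw, haz, hbu] at this
          exact this.trans hj
        · exact (JoinedAvoiding.of_adj hzw hz hw).trans (ih1 hw)
      · rw [hz, hw] at hzw
        exact hzw.ne rfl
  obtain ⟨p⟩ := hC.preconnected x y
  obtain ⟨_, _, h⟩ := (key x p).1 hx
  exact h

/-! ### The result in the memory -/

/-- The number of a dart that may be absent. -/
def optNum (num : A → ℕ) : Option A → ℕ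
  | none => 0
  | some a => num a + 1

theorem exists_planeGraph (hK : S.HasKites) (hF : S.SimpleFaces) (hC : S.graph.Connected)
    {num : A → ℕ} (hinj : Function.Injective num) {M : ℕ} (hused : ∀ a, a ∈ S.used ↔ num a < M)
    (hsurj : ∀ i < M, ∃ a, num a = i) {o : Option A} (ho : ∀ a, o = some a → S.Good a)
    (ho' : ∀ a ∈ S.used, o.isSome) {s : RAM.Mem} (h0 : s.reg 0 = n) (h1 : s.reg 1 = M)
    (h2 : s.reg 2 = optNum num o) (hfst : ∀ a ∈ S.used, s.arr 0 (num a) = S.fst a)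
    (hrev : ∀ a ∈ S.used, s.arr 1 (num a) = num (F.rev a))
    (hrot : ∀ a ∈ S.used, s.arr 2 (num a) = num (S.rot a))
    (hcross : ∀ a ∈ S.used, s.arr 3 (num a) = optNum num (F.cross a)) :
    ∃ G' : ICPlaneGraph n, G'.graph = S.graph ∧ Biconnected G'.graph ∧
      (∀ d e : G'.graph.Dart, G'.emb.cross d = some e → G'.InducesEmptyKite d e) ∧
      G'.StoredIn s := by
  let ι : S.graph.Dart ≃ Fin M := S.dartEquiv.symm.trans (Equiv.ofBijective
    (fun a => (⟨num a, (hused a).1 a.2⟩ : Fin M)) <| by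
      constructor
      · intro a b hab
        exact Subtype.ext (hinj (congrArg Fin.val hab))
      · rintro ⟨i, hi⟩
        obtain ⟨a, rfl⟩ := hsurj i hi
        exact ⟨⟨a, (hused a).2 hi⟩, rfl⟩)
  have hι : ∀ a : S.used, (ι (S.dartEquiv a) : ℕ) = num a := by
    intro a
    simp only [ι, Equiv.trans_apply, Equiv.symm_apply_apply]
    rfl
  let out : Option S.graph.Dart := o.pmap (fun a ha => S.dartEquiv ⟨a, ha⟩) fun a h => (ho a h).mem
  have hout : ICPlaneGraph.optIndex ι out = optNum num o := by
    rcases o with - | a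
    · rfl
    · exact congrArg (· + 1) (hι _)
  let G' : ICPlaneGraph n := ⟨S.graph, S.emb, S.emb_planar, out, by
    rintro ⟨d⟩
    obtain ⟨a, rfl⟩ := S.dartEquiv.surjective d
    simpa [out] using ho' a a.2⟩
  refine ⟨G', rfl, biconnected hK hF hC, ?_, M, ι, ?_, ?_⟩
  · intro x e h
    obtain ⟨a, ha⟩ := S.dartEquiv.surjective x
    have hsome := ho' a a.2
    obtain ⟨b, hb⟩ := Option.isSome_iff_exists.1 hsome
    have hg := ho b hb
    have hob : out = some (S.dartEquiv ⟨b, hg.mem⟩) := by simp [out, hb]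
    refine ICPlaneGraph.inducesEmptyKite G' hC.preconnected (S.emb_hasKites hK) hob ?_ ?_ h
    · exact S.emb_cross_eq_none.2 hg.uncrossed
    · change S.emb.cross (S.emb.rot _) = none
      rw [S.emb_rot]
      exact S.emb_cross_eq_none.2 hg.rot_uncrossed
  · intro r hr
    interval_cases r
    · exact h0
    · exact h1
    · rw [h2, ← hout]; rfl
  · intro k hk i hi
    obtain ⟨a, rfl⟩ := hsurj i hi
    have ha : a ∈ S.used := (hused a).2 hi
    have hs : ι.symm ⟨num a, hi⟩ = S.dartEquiv ⟨a, ha⟩ := by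
      rw [Equiv.symm_apply_eq]
      exact Fin.ext (hι ⟨a, ha⟩).symm
    simp only [ICPlaneGraph.memory, hi, dite_true]
    rw [hs]
    interval_cases k
    · exact hfst a ha
    · rw [hrev a ha]
      change _ = (ι (S.dartEquiv ⟨a, ha⟩).symm : ℕ)
      rw [S.dartEquiv_symm, hι]
    · rw [hrot a ha]
      change _ = (ι (S.emb.rot (S.dartEquiv ⟨a, ha⟩)) : ℕ)
      rw [S.emb_rot, hι]
    · rw [hcross a ha]
      change _ = ICPlaneGraph.optIndex ι (S.emb.cross (S.dartEquiv ⟨a, ha⟩))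
      rcases hc : F.cross a with - | e
      · rw [S.emb_cross_eq_none.2 hc]; rfl
      · rw [(S.emb_cross_eq_some (b := ⟨e, S.mem_of_cross_eq hc⟩)).2 hc]
        exact congrArg (· + 1) (hι ⟨e, S.mem_of_cross_eq hc⟩).symm

end DartSystem

/-! ## The number of darts is linear -/

namespace DartSystem

variable {A : Type} {F : Frame A} {n : ℕ} (S : DartSystem F n) [Finite A] [DecidableEq A]

theorem turn_face (h : F.Half) : F.turn S.rot (F.face S.rot h) = F.flip h := by
  rw [Frame.face, Equiv.Perm.mul_apply, perm_apply_inv]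
  rfl

theorem face_ne (hu : ∀ a, a ∈ S.used) (h : F.Half) : F.face S.rot h ≠ h := by
  intro hh
  have h1 := S.turn_face h
  rw [hh] at h1
  rcases h with d | d
  · by_cases hc : (F.cross d).isSome
    · rw [F.flip_inl_of_isSome hc] at h1
      simp [Frame.turn] at h1
    · rw [F.flip_inl_of_none (by simpa using hc)] at h1
      have h2 : S.rot d = F.rev d := by simpa [Frame.turn] using h1
      have h3 := S.isRot.fst d (hu d)
      rw [h2] at h3
      exact S.loopless d (hu d) h3.symm
  · simp [Frame.turn, Frame.flip] at h1

theorem eq_inl_of_face_face (hu : ∀ a, a ∈ S.used) {h : F.Half}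
    (hh : F.face S.rot (F.face S.rot h) = h) : ∃ d, h = .inl d ∧ S.rot d = d := by
  have h1 := S.turn_face h
  have h2 := S.turn_face (F.face S.rot h)
  rw [hh] at h2
  rcases h with d | ⟨d, hd⟩
  · rcases hc : F.cross d with - | e
    · rw [F.face_inl_of_none _ hc] at h2
      set k := S.rot⁻¹ (F.rev d) with hk
      have hrk : S.rot k = F.rev d := by simp [hk]
      rcases hck : F.cross k with - | e
      · rw [F.flip_inl_of_none hck] at h2
        have h3 : S.rot d = F.rev k := by simpa [Frame.turn] using h2
        have h4 : k = F.rev d := by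
          refine S.simple k (hu k) _ (hu _) ?_ ?_
          · rw [← hrk, S.isRot.fst k (hu k)]
          · rw [← h3, F.rev_rev, S.isRot.fst d (hu d)]
        refine ⟨d, rfl, ?_⟩
        rw [h3, h4, F.rev_rev]
      · rw [F.flip_inl_of_isSome (by rw [hck]; rfl)] at h2
        simp [Frame.turn] at h2
    · rw [F.face_inl_of_some _ hc] at h2
      have h3 : S.rot d = F.rev e := by simpa [Frame.turn, Frame.flip] using h2
      have h4 := S.isRot.fst d (hu d)
      rw [h3] at h4
      exact absurd h4 (S.cross_ne_self (F.cross_rev' hc))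
  · rw [F.face_inr] at h2
    set k := S.rot⁻¹ (F.rev d) with hk
    have hrk : S.rot k = F.rev d := by simp [hk]
    obtain ⟨e, he⟩ := Option.isSome_iff_exists.1 hd
    rcases hck : F.cross k with - | g
    · rw [F.flip_inl_of_none hck] at h2
      simp [Frame.turn] at h2
    · rw [F.flip_inl_of_isSome (by rw [hck]; rfl)] at h2
      have h3 : e = F.rev k := by simpa [Frame.turn, Frame.crossPerm, he] using h2
      have h4 : k = F.rev d := by
        refine S.indep _ _ (by rw [hck]; rfl) (F.isSome_rev.2 hd) ?_
        rw [← hrk, S.isRot.fst k (hu k)]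
      rw [h4, F.rev_rev] at h3
      exact absurd rfl (S.cross_ne_self (h3 ▸ he))

theorem three_mul_faces_le (hu : ∀ a, a ∈ S.used) :
    3 * orbCount (F.face S.rot) ≤ Nat.card F.Half + n := by
  classical
  let f := F.face S.rot
  let Q := Quot fun x y => f x = y
  have hsound : ∀ x, (Quot.mk (fun x y => f x = y) (f x)) = Quot.mk _ x := fun x =>
    (Quot.sound (r := fun x y => f x = y) rfl).symm
  let i : Q × Fin 3 → F.Half ⊕ Fin n := fun p =>
    if p.2 = 0 then .inl p.1.out else if p.2 = 1 then .inl (f p.1.out)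
    else if f (f p.1.out) = p.1.out then .inr (S.fst (F.under p.1.out))
    else .inl (f (f p.1.out))
  have hi : Function.Injective i := by
    have hcl : ∀ p h, i p = .inl h → Quot.mk (fun x y => f x = y) h = p.1 := by
      rintro ⟨q, j⟩ h hp
      have hq : Quot.mk (fun x y => f x = y) q.out = q := Quot.out_eq q
      simp only [i] at hp
      split_ifs at hp
      · rw [← Sum.inl.inj hp, hq]
      · rw [← Sum.inl.inj hp, hsound, hq]
      · rw [← Sum.inl.inj hp, hsound, hsound, hq]
    have hcr : ∀ p v, i p = .inr v → ∃ d, p.1.out = .inl d ∧ S.rot d = d ∧ S.fst d = v ∧ p.2 = 2 := by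
      rintro ⟨q, j⟩ v hp
      simp only [i] at hp
      split_ifs at hp with h0 h1 h2
      obtain ⟨d, hd, hd'⟩ := S.eq_inl_of_face_face hu h2
      refine ⟨d, hd, hd', ?_, ?_⟩
      · rw [← Sum.inr.inj hp]
        simp only [hd, Frame.under, Sum.elim_inl, id]
      · change j = 2
        have : ∀ j : Fin 3, j ≠ 0 → j ≠ 1 → j = 2 := by decide
        exact this j h0 h1
    rintro p p' hp
    rcases hv : i p with h | v
    · have h1 := hcl p h hv
      have h2 := hcl p' h (hp ▸ hv)
      obtain ⟨q, j⟩ := p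
      obtain ⟨q', j'⟩ := p'
      obtain rfl : q = q' := h1.symm.trans h2
      have n1 := S.face_ne hu q.out
      have n2 : f (f q.out) ≠ f q.out := fun h => n1 (f.injective h)
      have n1' : f q.out ≠ q.out := n1
      congr 1
      fin_cases j <;> fin_cases j' <;> simp [i] at hp hv ⊢
      · exact n1' hp.symm
      · split_ifs at hp with h0
        exact h0 (Sum.inl.inj hp).symm
      · exact n1' hp
      · split_ifs at hp with h0
        exact n2 (Sum.inl.inj hp).symm
      · split_ifs at hp with h0
        exact h0 (Sum.inl.inj hp)
      · split_ifs at hp with h0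
        exact n2 (Sum.inl.inj hp)
    · obtain ⟨d, h1, h2, h3, h4⟩ := hcr p v hv
      obtain ⟨d', h1', h2', h3', h4'⟩ := hcr p' v (hp ▸ hv)
      have hs := S.isRot.cyclic d (hu d) d' (hu d') (h3.trans h3'.symm)
      have hdd : d' = d := mem_of_sameCycle (Z := {d}) (by rintro x rfl; exact h2) hs rfl
      refine Prod.ext ?_ (h4.trans h4'.symm)
      rw [← Quot.out_eq p.1, ← Quot.out_eq p'.1, h1, h1', hdd]
  have := Nat.card_le_card_of_injective i hi
  rw [Nat.card_prod, Nat.card_sum] at this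
  simp only [Nat.card_fin] at this
  change 3 * Nat.card Q ≤ _
  omega

theorem vertices_le (hu : ∀ a, a ∈ S.used) : orbCount (F.turn S.rot) ≤ 2 * n := by
  let i : (Quot fun x y => F.turn S.rot x = y) → Fin n ⊕ Fin n := fun q =>
    match q.out with
    | .inl d => .inl (S.fst d)
    | .inr d => .inr (S.fst d)
  have hi : Function.Injective i := by
    intro q q' hq
    rw [← Quot.out_eq q, ← Quot.out_eq q']
    rcases h : q.out with d | d <;> rcases h' : q'.out with d' | d' <;> simp only [i, h, h'] at hq
    · have hs := S.isRot.cyclic d (hu d) d' (hu d') (Sum.inl.inj hq)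
      exact Quot.eqvGen_sound ((eqvGen_perm_iff _ _ _).2 (turn_sameCycle hs))
    · cases hq
    · cases hq
    · rw [Subtype.ext (S.indep _ _ d.2 d'.2 (Sum.inr.inj hq))]
  have := Nat.card_le_card_of_injective i hi
  rw [Nat.card_sum] at this
  simp only [Nat.card_fin] at this
  rw [orbCount]
  omega

theorem card_le (hu : ∀ a, a ∈ S.used) : Nat.card A ≤ 16 * n := by
  have h1 := S.vertices_le hu
  have h2 := S.three_mul_faces_le hu
  have h3 := card_eq_two_mul_orbCount F.flip_flip F.flip_ne
  have h4 := (flat_iff _ _).1 S.flat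
  have h5 : Nat.card A ≤ Nat.card F.Half :=
    Nat.card_le_card_of_injective Sum.inl Sum.inl_injective
  change orbCount (F.turn S.rot) + orbCount (F.face S.rot) = orbCount F.flip + _ at h4
  omega

end DartSystem

/-! ## The system of darts of an embedded graph, with unused edges -/

namespace ICPlaneGraph

variable {n : ℕ} (G : ICPlaneGraph n) (J : ℕ)

/-- The darts of `G` and the directions of `J` further edges. -/
abbrev ExtDart : Type := G.graph.Dart ⊕ (Fin J × Bool)

instance : Finite G.graph.Dart :=
  Finite.of_injective SimpleGraph.Dart.toProd fun _ _ => SimpleGraph.Dart.ext _ _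

/-- The frame of `G` with `J` further edges. -/
def frame : Frame (G.ExtDart J) where
  rev := Sum.map SimpleGraph.Dart.symm fun p => (p.1, !p.2)
  rev_rev := by rintro (d | ⟨i, b⟩) <;> simp
  rev_ne := by
    rintro (d | ⟨i, b⟩)
    · simpa using d.symm_ne
    · simp
  cross := Sum.elim (fun d => (G.emb.cross d).map .inl) fun _ => none
  cross_turn := by
    rintro (d | p) e h
    · obtain ⟨e', he, rfl⟩ := Option.map_eq_some_iff.1 h
      simp [G.emb.cross_turn _ _ he]
    · cases h

theorem frame_cross_inl (d : G.graph.Dart) :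
    (G.frame J).cross (.inl d) = (G.emb.cross d).map .inl := rfl

theorem frame_isSome_inl (d : G.graph.Dart) :
    ((G.frame J).cross (.inl d)).isSome ↔ (G.emb.cross d).isSome := by
  simp [frame_cross_inl]

/-- The darts of the planarization. -/
def halfMap : G.emb.Half ⊕ (Fin J × Bool) → (G.frame J).Half
  | .inl (.inl d) => .inl (.inl d)
  | .inl (.inr d) => .inr ⟨.inl d.1, (G.frame_isSome_inl J d.1).2 d.2⟩
  | .inr p => .inl (.inr p)

theorem halfMap_bijective : Function.Bijective (G.halfMap J) := by
  constructor
  · rintro ((d | d) | a) ((d' | d') | a') h <;> simp [halfMap] at h ⊢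
    · exact h
    · exact Subtype.ext h
    · exact h
  · rintro ((d | p) | ⟨d | p, hd⟩)
    · exact ⟨.inl (.inl d), rfl⟩
    · exact ⟨.inr p, rfl⟩
    · exact ⟨.inl (.inr ⟨d, (G.frame_isSome_inl J d).1 hd⟩), rfl⟩
    · exact absurd hd (by simp [frame])

theorem sameCycle_sumCongr {d e : G.graph.Dart} (h : G.emb.rot.SameCycle d e) :
    (Equiv.Perm.sumCongr G.emb.rot (1 : Equiv.Perm (Fin J × Bool))).SameCycle (.inl d) (.inl e) := by
  refine mem_of_sameCycle (Z := {x | (Equiv.Perm.sumCongr G.emb.rot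
    (1 : Equiv.Perm (Fin J × Bool))).SameCycle (.inl d) (.inl x)}) ?_ h (.refl _ _)
  intro x hx
  exact hx.trans ⟨1, by simp⟩

/-- The system of the darts of `G`. -/
def system (hn : 0 < n) : DartSystem (G.frame J) n where
  fst := Sum.elim (fun d => d.fst) fun _ => ⟨0, hn⟩
  rot := Equiv.Perm.sumCongr G.emb.rot 1
  used := Set.range .inl
  isRot := by
    refine ⟨?_, ?_, ?_⟩
    · rintro (d | p) h
      · exact absurd ⟨d, rfl⟩ h
      · simp
    · rintro _ ⟨d, rfl⟩
      exact G.emb.rot_fst d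
    · rintro _ ⟨d, rfl⟩ _ ⟨e, rfl⟩ h
      exact G.sameCycle_sumCongr J (G.emb.rot_cyclic d e h)
  rev_mem := by
    rintro _ ⟨d, rfl⟩
    exact ⟨d.symm, rfl⟩
  cross_mem := by
    rintro (d | p) h
    · exact ⟨d, rfl⟩
    · cases h
  indep := by
    rintro (d | p) (e | q) hd he h
    · rw [G.emb.indep d e ((G.frame_isSome_inl J d).1 hd) ((G.frame_isSome_inl J e).1 he) h]
    · cases he
    · cases hd
    · cases hd
  loopless := by
    rintro _ ⟨d, rfl⟩
    exact d.fst_ne_snd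
  simple := by
    rintro _ ⟨d, rfl⟩ _ ⟨e, rfl⟩ h h'
    exact congrArg Sum.inl (SimpleGraph.Dart.ext _ _ (Prod.ext h h'))
  flat := by
    have h := G.planar
    change Flat G.emb.turn G.emb.flip at h
    rw [← flat_sum_iff (U := Fin J × Bool) (ρ := fun p => (p.1, !p.2)) (by simp)
      (by rintro ⟨i, b⟩; simp)] at h
    refine (flat_congr (Equiv.ofBijective _ (G.halfMap_bijective J)) ?_ ?_).1 h
    · rintro ((d | ⟨d, hd⟩) | p)
      · rfl
      · obtain ⟨e, he⟩ := Option.isSome_iff_exists.1 hd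
        simp [halfMap, ICRotation.turn, Frame.turn, Frame.crossPerm, frame_cross_inl, he]
      · rfl
    · rintro ((d | ⟨d, hd⟩) | p)
      · by_cases hc : (G.emb.cross d).isSome
        · have hc' := (G.frame_isSome_inl J d).2 hc
          change G.halfMap J (.inl (G.emb.flip (.inl d))) = (G.frame J).flip (.inl (.inl d))
          rw [Frame.flip_inl_of_isSome _ hc']
          simp [halfMap, ICRotation.flip, hc, frame]
        · have hc' : (G.frame J).cross (.inl d) = none := by simpa [frame_cross_inl] using hc
          change G.halfMap J (.inl (G.emb.flip (.inl d))) = (G.frame J).flip (.inl (.inl d))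
          rw [Frame.flip_inl_of_none _ hc']
          simp [halfMap, ICRotation.flip, hc, frame]
      · rfl
      · change _ = (G.frame J).flip (.inl (.inr p))
        rw [Frame.flip_inl_of_none _ rfl]
        rfl

theorem card_dart_le {m : ℕ} (hn : 0 < n) (ι : G.graph.Dart ≃ Fin m) : m ≤ 16 * n := by
  classical
  have := (G.system 0 hn).card_le (by
    rintro (d | p)
    · exact ⟨d, rfl⟩
    · exact p.1.elim0)
  have h2 : Nat.card G.graph.Dart = m := by
    rw [Nat.card_congr ι, Nat.card_fin]
  have h3 : Nat.card G.graph.Dart ≤ Nat.card (G.ExtDart 0) :=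
    Nat.card_le_card_of_injective Sum.inl Sum.inl_injective
  omega

/-- The numbering of the darts and the further edges. -/
def extNum {m : ℕ} (ι : G.graph.Dart ≃ Fin m) : G.ExtDart J → ℕ :=
  Sum.elim (fun d => ι d) fun p => m + 2 * p.1 + p.2.toNat

end ICPlaneGraph

/-! ## Programs with expressions -/

namespace RAM

theorem reg_setReg (s : Mem) (r x q : ℕ) :
    (s.setReg r x).reg q = if q = r then x else s.reg q := Function.update_apply _ _ _ _

theorem arr_setReg (s : Mem) (r x : ℕ) : (s.setReg r x).arr = s.arr := rfl

theorem reg_setArr (s : Mem) (a i x : ℕ) : (s.setArr a i x).reg = s.reg := rfl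

theorem arr_setArr (s : Mem) (a i x b j : ℕ) :
    (s.setArr a i x).arr b j = if b = a then (if j = i then x else s.arr a j) else s.arr b j := by
  simp only [Mem.setArr, Function.update_apply]
  split_ifs <;> simp_all

/-- Arithmetic expressions over registers and arrays. -/
inductive Expr where
  | reg (r : ℕ)
  | const (k : ℕ)
  | add (a b : Expr)
  | sub (a b : Expr)
  | get (a : ℕ) (i : Expr)

namespace Expr

/-- The registers from 30 on are used for the evaluation of expressions. -/
def eval (s : Mem) : Expr → ℕ
  | reg r => s.reg r
  | const k => k
  | add a b => a.eval s + b.eval s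
  | sub a b => a.eval s - b.eval s
  | get a i => s.arr a (i.eval s)

/-- All values in the evaluation of an expression are at most `W`. -/
def Ok (W : ℕ) (s : Mem) : Expr → Prop
  | reg r => r < 30 ∧ s.reg r ≤ W
  | const k => k ≤ W
  | add a b => a.Ok W s ∧ b.Ok W s ∧ a.eval s + b.eval s ≤ W
  | sub a b => a.Ok W s ∧ b.Ok W s
  | get a i => i.Ok W s ∧ s.arr a (i.eval s) ≤ W

/-- The program that evaluates an expression into the register `t`. -/
def code (t : ℕ) : Expr → Prog
  | reg r => .move t r
  | const k => .const t k
  | add a b => .seq (a.code t) (.seq (b.code (t + 1)) (.add t t (t + 1)))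
  | sub a b => .seq (a.code t) (.seq (b.code (t + 1)) (.sub t t (t + 1)))
  | get a i => .seq (i.code t) (.load t a t)

/-- The number of steps of the evaluation. -/
def cost : Expr → ℕ
  | reg _ => 1
  | const _ => 1
  | add a b => a.cost + (b.cost + 1)
  | sub a b => a.cost + (b.cost + 1)
  | get _ i => i.cost + 1

theorem Ok.eval_le {W : ℕ} {s : Mem} {e : Expr} (h : e.Ok W s) : e.eval s ≤ W := by
  induction e with
  | reg r => exact h.2
  | const k => exact h
  | add a b iha ihb => exact h.2.2
  | sub a b iha ihb => exact (Nat.sub_le _ _).trans (iha h.1)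
  | get a i ih => exact h.2

end Expr

/-- The memories agree except for the registers used for the evaluation of expressions. -/
def Agree (s s' : Mem) : Prop := (∀ r < 30, s.reg r = s'.reg r) ∧ s.arr = s'.arr

theorem Agree.setReg {s s' : Mem} (h : Agree s s') (r x : ℕ) :
    Agree (s.setReg r x) (s'.setReg r x) := by
  refine ⟨fun q hq => ?_, h.2⟩
  rw [reg_setReg, reg_setReg, h.1 q hq]

theorem Agree.setArr {s s' : Mem} (h : Agree s s') (a i x : ℕ) :
    Agree (s.setArr a i x) (s'.setArr a i x) := by
  refine ⟨h.1, ?_⟩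
  simp only [Mem.setArr, h.2]

theorem Expr.exec {W : ℕ} {s : Mem} {e : Expr} (h : e.Ok W s) {t : ℕ} (ht : 30 ≤ t) {s₀ : Mem}
    (hs : Agree s₀ s) : ∃ s₁, Exec W (e.code t) s₀ e.cost s₁ ∧ s₁.reg t = e.eval s ∧
      s₁.arr = s₀.arr ∧ ∀ r < t, s₁.reg r = s₀.reg r := by
  induction e generalizing t s₀ with
  | reg r =>
    have h1 : s₀.reg r = s.reg r := hs.1 r h.1
    refine ⟨_, .move s₀ t r (by rw [h1]; exact h.2), ?_, rfl, fun q hq => ?_⟩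
    · rw [reg_setReg, if_pos rfl, h1]; rfl
    · rw [reg_setReg, if_neg hq.ne]
  | const k =>
    refine ⟨_, .const s₀ t k h, ?_, rfl, fun q hq => ?_⟩
    · rw [reg_setReg, if_pos rfl]; rfl
    · rw [reg_setReg, if_neg hq.ne]
  | add a b iha ihb =>
    obtain ⟨ha, hb, hle⟩ := h
    obtain ⟨s₁, x₁, v₁, a₁, r₁⟩ := iha ha ht hs
    have hs₁ : Agree s₁ s := ⟨fun r hr => (r₁ r (by omega)).trans (hs.1 r hr), a₁.trans hs.2⟩
    obtain ⟨s₂, x₂, v₂, a₂, r₂⟩ := ihb hb (t := t + 1) (by omega) hs₁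
    have e₁ : s₂.reg t = a.eval s := (r₂ t (by omega)).trans v₁
    refine ⟨_, .seq x₁ (.seq x₂ (.add s₂ t t (t + 1) (by rw [e₁, v₂]; exact hle))), ?_,
      a₂.trans a₁, fun q hq => ?_⟩
    · rw [reg_setReg, if_pos rfl, e₁, v₂]; rfl
    · rw [reg_setReg, if_neg hq.ne, r₂ q (by omega), r₁ q hq]
  | sub a b iha ihb =>
    obtain ⟨ha, hb⟩ := h
    obtain ⟨s₁, x₁, v₁, a₁, r₁⟩ := iha ha ht hs
    have hs₁ : Agree s₁ s := ⟨fun r hr => (r₁ r (by omega)).trans (hs.1 r hr), a₁.trans hs.2⟩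
    obtain ⟨s₂, x₂, v₂, a₂, r₂⟩ := ihb hb (t := t + 1) (by omega) hs₁
    have e₁ : s₂.reg t = a.eval s := (r₂ t (by omega)).trans v₁
    refine ⟨_, .seq x₁ (.seq x₂ (.sub s₂ t t (t + 1) ?_)), ?_,
      a₂.trans a₁, fun q hq => ?_⟩
    · rw [e₁]; exact (Nat.sub_le _ _).trans ha.eval_le
    · rw [reg_setReg, if_pos rfl, e₁, v₂]; rfl
    · rw [reg_setReg, if_neg hq.ne, r₂ q (by omega), r₁ q hq]
  | get a i ih =>
    obtain ⟨hi, hle⟩ := h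
    obtain ⟨s₁, x₁, v₁, a₁, r₁⟩ := ih hi ht hs
    have e₁ : s₁.arr a (s₁.reg t) = s.arr a (i.eval s) := by rw [a₁, v₁, hs.2]
    refine ⟨_, .seq x₁ (.load s₁ t a t (by rw [e₁]; exact hle)), ?_, a₁, fun q hq => ?_⟩
    · rw [reg_setReg, if_pos rfl, e₁]; rfl
    · rw [reg_setReg, if_neg hq.ne, r₁ q hq]

theorem Expr.exec_pair {W : ℕ} {s : Mem} {e₁ e₂ : Expr} (h₁ : e₁.Ok W s) (h₂ : e₂.Ok W s)
    {s₀ : Mem} (hs : Agree s₀ s) : ∃ s₁, Exec W (.seq (e₁.code 30) (e₂.code 31)) s₀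
      (e₁.cost + e₂.cost) s₁ ∧ s₁.reg 30 = e₁.eval s ∧ s₁.reg 31 = e₂.eval s ∧ Agree s₁ s := by
  obtain ⟨s₁, x₁, v₁, a₁, r₁⟩ := Expr.exec h₁ (t := 30) le_rfl hs
  have hs₁ : Agree s₁ s := ⟨fun r hr => (r₁ r (by omega)).trans (hs.1 r hr), a₁.trans hs.2⟩
  obtain ⟨s₂, x₂, v₂, a₂, r₂⟩ := Expr.exec h₂ (t := 31) (by omega) hs₁
  exact ⟨s₂, .seq x₁ x₂, (r₂ 30 (by omega)).trans v₁, v₂,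
    fun r hr => (r₂ r (by omega)).trans (hs₁.1 r hr), a₂.trans hs₁.2⟩

/-- Commands with expressions. -/
inductive Cmd where
  | skip
  | set (r : ℕ) (e : Expr)
  | put (a : ℕ) (i v : Expr)
  | seq (c₁ c₂ : Cmd)
  | ite (e₁ e₂ : Expr) (c₁ c₂ : Cmd)
  | loop (e₁ e₂ : Expr) (c : Cmd)

namespace Cmd

/-- The program of a command. -/
def code : Cmd → Prog
  | skip => .skip
  | set r e => .seq (e.code 30) (.move r 30)
  | put a i v => .seq (.seq (i.code 30) (v.code 31)) (.store a 30 31)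
  | seq c₁ c₂ => .seq c₁.code c₂.code
  | ite e₁ e₂ c₁ c₂ => .seq (.seq (e₁.code 30) (e₂.code 31)) (.ifLt 30 31 c₁.code c₂.code)
  | loop e₁ e₂ c => .seq (.seq (e₁.code 30) (e₂.code 31))
      (.whileLt 30 31 (.seq c.code (.seq (e₁.code 30) (e₂.code 31))))

end Cmd

/-- Started in memory `s` at time `k`, the program `c` halts in a memory and at a time that
satisfy `Q`. -/
def Runs (W : ℕ) (c : Prog) (s : Mem) (k : ℕ) (Q : Mem → ℕ → Prop) : Prop :=
  ∀ s₀, Agree s₀ s → ∃ t s₁ s', Exec W c s₀ t s₁ ∧ Agree s₁ s' ∧ Q s' (k + t)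

theorem Runs.mono {W : ℕ} {c : Prog} {s : Mem} {k : ℕ} {Q Q' : Mem → ℕ → Prop}
    (h : Runs W c s k Q) (hQ : ∀ s k, Q s k → Q' s k) : Runs W c s k Q' := by
  intro s₀ hs
  obtain ⟨t, s₁, s', h1, h2, h3⟩ := h s₀ hs
  exact ⟨t, s₁, s', h1, h2, hQ _ _ h3⟩

namespace Cmd

/-- A sufficient condition for `Q` to hold after the command. -/
def wp (W : ℕ) : Cmd → Mem → ℕ → (Mem → ℕ → Prop) → Prop
  | skip, s, k, Q => Q s (k + 1)
  | set r e, s, k, Q => r < 30 ∧ e.Ok W s ∧ Q (s.setReg r (e.eval s)) (k + (e.cost + 1))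
  | put a i v, s, k, Q => i.Ok W s ∧ v.Ok W s ∧
      Q (s.setArr a (i.eval s) (v.eval s)) (k + (i.cost + v.cost + 1))
  | seq c₁ c₂, s, k, Q => c₁.wp W s k fun s' k' => c₂.wp W s' k' Q
  | ite e₁ e₂ c₁ c₂, s, k, Q => e₁.Ok W s ∧ e₂.Ok W s ∧
      (e₁.eval s < e₂.eval s → c₁.wp W s (k + (e₁.cost + e₂.cost + 1)) Q) ∧
      (¬ e₁.eval s < e₂.eval s → c₂.wp W s (k + (e₁.cost + e₂.cost + 1)) Q)
  | loop e₁ e₂ c, s, k, Q => Runs W (loop e₁ e₂ c).code s k Q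

theorem wp_mono {W : ℕ} {c : Cmd} {s : Mem} {k : ℕ} {Q Q' : Mem → ℕ → Prop}
    (h : c.wp W s k Q) (hQ : ∀ s k, Q s k → Q' s k) : c.wp W s k Q' := by
  induction c generalizing s k Q Q' with
  | skip => exact hQ _ _ h
  | set r e => exact ⟨h.1, h.2.1, hQ _ _ h.2.2⟩
  | put a i v => exact ⟨h.1, h.2.1, hQ _ _ h.2.2⟩
  | seq c₁ c₂ ih₁ ih₂ => exact ih₁ h fun s k h' => ih₂ h' hQ
  | ite e₁ e₂ c₁ c₂ ih₁ ih₂ =>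
    exact ⟨h.1, h.2.1, fun hlt => ih₁ (h.2.2.1 hlt) hQ, fun hlt => ih₂ (h.2.2.2 hlt) hQ⟩
  | loop e₁ e₂ c ih => exact Runs.mono h hQ

theorem wp_seq {W : ℕ} {c₁ c₂ : Cmd} {s : Mem} {k : ℕ} {R Q : Mem → ℕ → Prop}
    (h : c₁.wp W s k R) (hQ : ∀ s k, R s k → c₂.wp W s k Q) : (seq c₁ c₂).wp W s k Q :=
  wp_mono (c := c₁) h hQ

theorem wp_of_post {W : ℕ} {c : Cmd} {s : Mem} {k : ℕ} {Q : Mem → ℕ → Prop}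
    (h : ∀ R : Mem → ℕ → Prop, (∀ s k, Q s k → R s k) → c.wp W s k R) : c.wp W s k Q :=
  h Q fun _ _ h' => h'

theorem runs {W : ℕ} {c : Cmd} {s : Mem} {k : ℕ} {Q : Mem → ℕ → Prop} (h : c.wp W s k Q) :
    Runs W c.code s k Q := by
  induction c generalizing s k Q with
  | skip => exact fun s₀ hs => ⟨1, s₀, s, .skip s₀, hs, h⟩
  | set r e =>
    intro s₀ hs
    obtain ⟨hr, he, hQ⟩ := h
    obtain ⟨s₁, x₁, v₁, a₁, r₁⟩ := Expr.exec he (t := 30) le_rfl hs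
    have hs₁ : Agree s₁ s := ⟨fun r hr => (r₁ r (by omega)).trans (hs.1 r hr), a₁.trans hs.2⟩
    refine ⟨_, _, _, .seq x₁ (.move s₁ r 30 (by rw [v₁]; exact he.eval_le)), ?_, hQ⟩
    rw [v₁]
    exact hs₁.setReg _ _
  | put a i v =>
    intro s₀ hs
    obtain ⟨hi, hv, hQ⟩ := h
    obtain ⟨s₁, x₁, v₁, v₂, hs₁⟩ := Expr.exec_pair hi hv hs
    refine ⟨_, _, _, .seq x₁ (.store s₁ a 30 31 (by rw [v₂]; exact hv.eval_le)), ?_, hQ⟩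
    rw [v₁, v₂]
    exact hs₁.setArr _ _ _
  | seq c₁ c₂ ih₁ ih₂ =>
    intro s₀ hs
    obtain ⟨t₁, s₁, s₁', x₁, h₁, q₁⟩ := ih₁ h s₀ hs
    obtain ⟨t₂, s₂, s₂', x₂, h₂, q₂⟩ := ih₂ q₁ s₁ h₁
    exact ⟨_, _, _, .seq x₁ x₂, h₂, by rwa [← add_assoc]⟩
  | ite e₁ e₂ c₁ c₂ ih₁ ih₂ =>
    intro s₀ hs
    obtain ⟨h1, h2, h3, h4⟩ := h
    obtain ⟨s₁, x₁, v₁, v₂, hs₁⟩ := Expr.exec_pair h1 h2 hs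
    by_cases hlt : e₁.eval s < e₂.eval s
    · obtain ⟨t₂, s₂, s₂', x₂, h₂, q₂⟩ := ih₁ (h3 hlt) s₁ hs₁
      refine ⟨_, _, _, .seq x₁ (.ifTrue (by rwa [v₁, v₂]) x₂), h₂, ?_⟩
      convert q₂ using 1
      omega
    · obtain ⟨t₂, s₂, s₂', x₂, h₂, q₂⟩ := ih₂ (h4 hlt) s₁ hs₁
      refine ⟨_, _, _, .seq x₁ (.ifFalse (by rwa [v₁, v₂]) x₂), h₂, ?_⟩
      convert q₂ using 1
      omega
  | loop e₁ e₂ c ih => exact h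

/-- Loops with an invariant that bounds the time. -/
theorem wp_loop {W : ℕ} {e₁ e₂ : Expr} {c : Cmd} {s : Mem} {k : ℕ} {Q : Mem → ℕ → Prop}
    (I : Mem → ℕ → Prop) (B : ℕ) (h₀ : I s k) (hB : ∀ s k, I s k → k ≤ B)
    (hok : ∀ s k, I s k → e₁.Ok W s ∧ e₂.Ok W s)
    (hbody : ∀ s k, I s k → e₁.eval s < e₂.eval s →
      c.wp W s (k + (e₁.cost + e₂.cost + 1)) I)
    (hQ : ∀ s k, I s k → ¬ e₁.eval s < e₂.eval s → Q s (k + (e₁.cost + e₂.cost + 1))) :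
    (loop e₁ e₂ c).wp W s k Q := by
  have key : ∀ j s k, B - k ≤ j → I s k → ∀ s₀, Agree s₀ s → s₀.reg 30 = e₁.eval s →
      s₀.reg 31 = e₂.eval s → ∃ t s₁ s',
        Exec W (.whileLt 30 31 (.seq c.code (.seq (e₁.code 30) (e₂.code 31)))) s₀ t s₁ ∧
          Agree s₁ s' ∧ Q s' (k + (e₁.cost + e₂.cost) + t) := by
    intro j
    induction j with
    | zero =>
      intro s k hj hI s₀ hs v₁ v₂
      by_cases hlt : e₁.eval s < e₂.eval s
      · obtain ⟨t₁, s₁, s₁', x₁, h₁, q₁⟩ := runs (hbody s k hI hlt) s₀ hs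
        have := hB _ _ q₁
        have := hB _ _ hI
        omega
      · exact ⟨1, s₀, s, .whileFalse (by rwa [v₁, v₂]), hs, hQ s k hI hlt⟩
    | succ j ihj =>
      intro s k hj hI s₀ hs v₁ v₂
      by_cases hlt : e₁.eval s < e₂.eval s
      · obtain ⟨t₁, s₁, s₁', x₁, h₁, q₁⟩ := runs (hbody s k hI hlt) s₀ hs
        obtain ⟨o₁, o₂⟩ := hok _ _ q₁
        obtain ⟨s₂, x₂, w₁, w₂, hs₂⟩ := Expr.exec_pair o₁ o₂ h₁
        obtain ⟨t₃, s₃, s₃', x₃, h₃, q₃⟩ := ihj _ _ (by omega) q₁ s₂ hs₂ w₁ w₂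
        refine ⟨_, _, _, .whileTrue (by rwa [v₁, v₂]) (.seq x₁ x₂) x₃, h₃, ?_⟩
        convert q₃ using 1
        omega
      · exact ⟨1, s₀, s, .whileFalse (by rwa [v₁, v₂]), hs, hQ s k hI hlt⟩
  intro s₀ hs
  obtain ⟨o₁, o₂⟩ := hok _ _ h₀
  obtain ⟨s₁, x₁, w₁, w₂, hs₁⟩ := Expr.exec_pair o₁ o₂ hs
  obtain ⟨t₃, s₃, s₃', x₃, h₃, q₃⟩ := key _ _ _ le_rfl h₀ s₁ hs₁ w₁ w₂
  refine ⟨_, _, _, .seq x₁ x₃, h₃, ?_⟩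
  convert q₃ using 1
  omega

end Cmd

end RAM

section

/-! ## Systems of darts in the memory -/

open RAM

infixr:60 ";;" => RAM.Cmd.seq

/-- A numbering of the darts of a frame, the first `m` of which are given, such that the two
directions of every other edge have consecutive numbers. -/
structure DartNumbering {A : Type} (F : Frame A) (m N : ℕ) where
  num : A → ℕ
  inj : Function.Injective num
  lt : ∀ a, num a < N
  surj : ∀ i < N, ∃ a, num a = i
  fresh : ∀ a, m ≤ num a → (num a - m) % 2 = 0 → num (F.rev a) = num a + 1

/-- The number of a dart that may be absent. -/
abbrev optNum {A : Type} (num : A → ℕ) : Option A → ℕ := DartSystem.optNum num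

variable {A : Type} {F : Frame A} {n m N : ℕ}

/-- The memory contains the darts with numbers below `M`, with starting vertices `f` and
rotation `σ`. -/
structure BaseRep (ν : DartNumbering F m N) (f : A → Fin n) (σ : Equiv.Perm A) (M : ℕ) (s : Mem) :
    Prop where
  le : M ≤ N
  base : m ≤ M
  even : (M - m) % 2 = 0
  closed : ∀ a, ν.num a < M → ν.num (σ a) < M
  reg0 : s.reg 0 = n
  reg1 : s.reg 1 = M
  fst : ∀ a, ν.num a < M → s.arr 0 (ν.num a) = f a
  rev : ∀ a, ν.num a < M → s.arr 1 (ν.num a) = ν.num (F.rev a)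
  rot : ∀ a, ν.num a < M → s.arr 2 (ν.num a) = ν.num (σ a)
  cross : ∀ a, s.arr 3 (ν.num a) = optNum ν.num (F.cross a)

/-- Array 4 contains, in addition, the inverse of the rotation. -/
structure PreRep (ν : DartNumbering F m N) (f : A → Fin n) (σ : Equiv.Perm A) (M : ℕ) (s : Mem) :
    Prop extends BaseRep ν f σ M s where
  inv : ∀ a, ν.num a < M → s.arr 4 (ν.num a) = ν.num (σ⁻¹ a)

/-- The memory contains the system `S` of the darts with numbers below `M`. -/
structure SysRep (ν : DartNumbering F m N) (S : DartSystem F n) (M : ℕ) (s : Mem) : Prop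
    extends PreRep ν S.fst S.rot M s where
  used : ∀ a, a ∈ S.used ↔ ν.num a < M

variable {ν : DartNumbering F m N}

theorem BaseRep.congr {f : A → Fin n} {σ : Equiv.Perm A} {M : ℕ} {s s' : Mem}
    (h : BaseRep ν f σ M s) (h0 : s'.reg 0 = s.reg 0) (h1 : s'.reg 1 = s.reg 1)
    (ha : ∀ b < 4, s'.arr b = s.arr b) : BaseRep ν f σ M s' where
  le := h.le
  base := h.base
  even := h.even
  closed := h.closed
  reg0 := h0.trans h.reg0
  reg1 := h1.trans h.reg1
  fst a h' := by rw [ha 0 (by omega), h.fst a h']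
  rev a h' := by rw [ha 1 (by omega), h.rev a h']
  rot a h' := by rw [ha 2 (by omega), h.rot a h']
  cross a := by rw [ha 3 (by omega), h.cross a]

theorem PreRep.congr {f : A → Fin n} {σ : Equiv.Perm A} {M : ℕ} {s s' : Mem}
    (h : PreRep ν f σ M s) (h0 : s'.reg 0 = s.reg 0) (h1 : s'.reg 1 = s.reg 1)
    (ha : ∀ b < 5, s'.arr b = s.arr b) : PreRep ν f σ M s' where
  toBaseRep := h.toBaseRep.congr h0 h1 fun b hb => ha b (by omega)
  inv a h' := by rw [ha 4 (by omega), h.inv a h']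

theorem SysRep.congr {S : DartSystem F n} {M : ℕ} {s s' : Mem}
    (h : SysRep ν S M s) (h0 : s'.reg 0 = s.reg 0) (h1 : s'.reg 1 = s.reg 1)
    (ha : ∀ b < 5, s'.arr b = s.arr b) : SysRep ν S M s' :=
  ⟨h.toPreRep.congr h0 h1 ha, h.used⟩

theorem PreRep.congr_fst {f g : A → Fin n} {σ : Equiv.Perm A} {M : ℕ} {s : Mem}
    (h : PreRep ν f σ M s) (hfg : ∀ a, ν.num a < M → f a = g a) : PreRep ν g σ M s :=
  { h with fst := fun a ha => by rw [← hfg a ha, h.fst a ha] }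

theorem PreRep.closed_inv [Finite A] {f : A → Fin n} {σ : Equiv.Perm A} {M : ℕ} {s : Mem}
    (h : PreRep ν f σ M s) {a : A} (ha : ν.num a < M) : ν.num (σ⁻¹ a) < M :=
  mem_of_sameCycle (Z := {x | ν.num x < M}) h.closed (σ := σ) ⟨-1, by simp⟩ ha

namespace SysRep

variable {S : DartSystem F n} {M : ℕ} {s : Mem}

theorem num_lt (h : SysRep ν S M s) {a : A} (ha : a ∈ S.used) : ν.num a < M := (h.used a).1 ha

theorem get_fst (h : SysRep ν S M s) {a : A} (ha : a ∈ S.used) : s.arr 0 (ν.num a) = S.fst a :=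
  h.fst a (h.num_lt ha)

theorem get_rev (h : SysRep ν S M s) {a : A} (ha : a ∈ S.used) :
    s.arr 1 (ν.num a) = ν.num (F.rev a) := h.rev a (h.num_lt ha)

theorem get_rot (h : SysRep ν S M s) {a : A} (ha : a ∈ S.used) :
    s.arr 2 (ν.num a) = ν.num (S.rot a) := h.rot a (h.num_lt ha)

theorem get_inv (h : SysRep ν S M s) {a : A} (ha : a ∈ S.used) :
    s.arr 4 (ν.num a) = ν.num (S.rot⁻¹ a) := h.inv a (h.num_lt ha)

theorem exists_dart (h : SysRep ν S M s) {i : ℕ} (hi : i < M) : ∃ a ∈ S.used, ν.num a = i := by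
  obtain ⟨a, rfl⟩ := ν.surj i (hi.trans_le h.le)
  exact ⟨a, (h.used a).2 hi, rfl⟩

end SysRep

variable [Finite A] [DecidableEq A]

/-- Multiply the rotation by the transposition of the darts in registers 20 and 21. -/
def swapRot : Cmd :=
  .set 22 (.get 2 (.reg 20)) ;; .set 23 (.get 2 (.reg 21)) ;;
  .put 2 (.reg 20) (.reg 23) ;; .put 2 (.reg 21) (.reg 22) ;;
  .put 4 (.reg 23) (.reg 20) ;; .put 4 (.reg 22) (.reg 21)

theorem wp_swapRot {f : A → Fin n} {σ : Equiv.Perm A} {M W t : ℕ} {s : Mem}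
    {Q : Mem → ℕ → Prop} (h : PreRep ν f σ M s) (hW : N ≤ W) {k c : A} (hk : ν.num k < M)
    (hc : ν.num c < M) (h20 : s.reg 20 = ν.num k) (h21 : s.reg 21 = ν.num c)
    (hQ : ∀ s', PreRep ν f (σ * Equiv.swap k c) M s' →
      (∀ r, r ≠ 22 → r ≠ 23 → s'.reg r = s.reg r) → (∀ b, 5 ≤ b → s'.arr b = s.arr b) →
      Q s' (t + 18)) : swapRot.wp W s t Q := by
  have hle : ∀ a, ν.num a ≤ W := fun a => (ν.lt a).le.trans hW
  have hrk := h.rot k hk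
  have hrc := h.rot c hc
  simp only [swapRot, Cmd.wp, Expr.Ok, Expr.eval, Expr.cost, reg_setReg, arr_setReg, reg_setArr]
  norm_num
  simp only [h20, h21, hrk, hrc, hle, true_and]
  refine hQ _ ?_ ?_ ?_
  · refine
      { le := h.le, base := h.base, even := h.even
        closed := fun a ha => ?_
        reg0 := by simpa [reg_setArr, reg_setReg] using h.reg0
        reg1 := by simpa [reg_setArr, reg_setReg] using h.reg1
        fst := fun a ha => by simpa [arr_setArr, arr_setReg] using h.fst a ha
        rev := fun a ha => by simpa [arr_setArr, arr_setReg] using h.rev a ha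
        rot := fun a ha => ?_
        cross := fun a => by simpa [arr_setArr, arr_setReg] using h.cross a
        inv := fun a ha => ?_ }
    · by_cases hak : a = k
      · rw [hak, mul_swap_left]; exact h.closed _ hc
      by_cases hac : a = c
      · rw [hac, mul_swap_right]; exact h.closed _ hk
      rw [mul_swap_of_ne σ hak hac]; exact h.closed _ ha
    · simp only [arr_setArr, arr_setReg, ν.inj.eq_iff]
      norm_num
      by_cases hac : a = c
      · simp [hac]
      by_cases hak : a = k
      · simp [hak, hak ▸ hac]
      simp [hak, hac, Equiv.swap_apply_of_ne_of_ne hak hac, h.rot a ha]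
    · simp only [arr_setArr, arr_setReg, ν.inj.eq_iff]
      norm_num
      by_cases hac : a = σ k
      · simp [hac]
      by_cases hak : a = σ c
      · simp [hak, hak ▸ hac]
      have h1 : σ.symm a ≠ k := fun e => hac (by rw [← e]; simp)
      have h2 : σ.symm a ≠ c := fun e => hak (by rw [← e]; simp)
      simp only [hak, hac, if_false]
      rw [h.inv a ha]
      congr 1
      exact (Equiv.swap_apply_of_ne_of_ne h1 h2).symm
  · intro r h1 h2
    simp [reg_setArr, reg_setReg, h1, h2]
  · intro b hb
    funext j
    have h1 : b ≠ 2 := by omega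
    have h2 : b ≠ 4 := by omega
    simp [arr_setArr, arr_setReg, h1, h2]

/-- Create the darts of a new edge between the vertices in registers 24 and 25. -/
def alloc : Cmd :=
  .set 26 (.reg 1) ;; .set 27 (.add (.reg 1) (.const 1)) ;;
  .put 0 (.reg 26) (.reg 24) ;; .put 0 (.reg 27) (.reg 25) ;;
  .put 1 (.reg 26) (.reg 27) ;; .put 1 (.reg 27) (.reg 26) ;;
  .put 2 (.reg 26) (.reg 26) ;; .put 2 (.reg 27) (.reg 27) ;;
  .put 4 (.reg 26) (.reg 26) ;; .put 4 (.reg 27) (.reg 27) ;;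
  .set 1 (.add (.reg 1) (.const 2))

theorem wp_alloc {f : A → Fin n} {σ : Equiv.Perm A} {M W t : ℕ} {s : Mem}
    {Q : Mem → ℕ → Prop} (h : PreRep ν f σ M s) (hW : N + n + 2 ≤ W) (hM : M + 2 ≤ N)
    {c : A} (hc : ν.num c = M) (hσ : ∀ a, M ≤ ν.num a → σ a = a) {u v : Fin n}
    (h24 : s.reg 24 = u) (h25 : s.reg 25 = v)
    (hQ : ∀ s', ν.num (F.rev c) = M + 1 →
      PreRep ν (Function.update (Function.update f c u) (F.rev c) v) σ (M + 2) s' →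
      s'.reg 26 = M → s'.reg 27 = M + 1 →
      (∀ r, r ≠ 1 → r ≠ 26 → r ≠ 27 → s'.reg r = s.reg r) → (∀ b, 5 ≤ b → s'.arr b = s.arr b) →
      Q s' (t + 34)) : alloc.wp W s t Q := by
  have hc' : ν.num (F.rev c) = M + 1 := by
    rw [← hc]
    exact ν.fresh c (by rw [hc]; exact h.base) (by rw [hc]; exact h.even)
  have hu := u.2
  have hv := v.2
  simp only [alloc, Cmd.wp, Expr.Ok, Expr.eval, Expr.cost, reg_setReg, reg_setArr]
  have e0 : M < W := by omega
  have e1 : M ≤ W := by omega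
  have e3 : 1 ≤ W := by omega
  have e4 : M + 2 ≤ W := by omega
  have e5 : (u : ℕ) ≤ W := by omega
  have e6 : (v : ℕ) ≤ W := by omega
  have e7 : 2 ≤ W := by omega
  norm_num
  simp only [h24, h25, h.reg1]
  simp only [e0, e1, e3, e4, e5, e6, e7, true_and, and_true]
  have hlt : ∀ a, ν.num a < M + 2 → a ≠ c → a ≠ F.rev c → ν.num a < M := by
    intro a ha h1 h2
    have h3 : ν.num a ≠ M := fun e => h1 (ν.inj (e.trans hc.symm))
    have h4 : ν.num a ≠ M + 1 := fun e => h2 (ν.inj (e.trans hc'.symm))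
    omega
  have hcc := F.rev_ne c
  have hσc : σ c = c := hσ c hc.ge
  have hσc' : σ (F.rev c) = F.rev c := hσ _ (by omega)
  have hval : ∀ (w : A → ℕ) (x y : ℕ) (g : ℕ → ℕ), w c = x → w (F.rev c) = y →
      (∀ a, ν.num a < M → g (ν.num a) = w a) → ∀ a, ν.num a < M + 2 →
      (if ν.num a = M + 1 then y else if ν.num a = M then x else g (ν.num a)) = w a := by
    intro w x y g h1 h2 h3 a ha
    by_cases h4 : a = F.rev c
    · rw [h4, hc', if_pos rfl, h2]
    by_cases h5 : a = c
    · rw [h5, hc, if_neg (by omega), if_pos rfl, h1]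
    have := hlt a ha h5 h4
    rw [if_neg (by omega), if_neg (by omega), h3 a this]
  refine hQ _ hc' ?_ ?_ ?_ ?_ ?_
  · refine
      { le := hM, base := h.base.trans (by omega), even := by have := h.even; have := h.base; omega
        closed := fun a ha => ?_
        reg0 := by simpa [reg_setArr, reg_setReg] using h.reg0
        reg1 := by simp [reg_setReg]
        fst := fun a ha => ?_
        rev := fun a ha => ?_
        rot := fun a ha => ?_
        cross := fun a => by simpa [arr_setArr, arr_setReg] using h.cross a
        inv := fun a ha => ?_ }
    · by_cases h4 : a = F.rev c
      · rw [h4, hσc', hc']; omega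
      by_cases h5 : a = c
      · rw [h5, hσc, hc]; omega
      exact (h.closed a (hlt a ha h5 h4)).trans (by omega)
    · simp only [arr_setArr, arr_setReg]
      norm_num
      refine hval (fun a => ((Function.update (Function.update f c u) (F.rev c) v a : Fin n) : ℕ))
        _ _ _ ?_ ?_ ?_ a ha
      · simp [hcc.symm]
      · simp
      · intro a ha
        have h1 : a ≠ c := by rintro rfl; omega
        have h2 : a ≠ F.rev c := by rintro rfl; omega
        simp [h1, h2, h.fst a ha]
    · simp only [arr_setArr, arr_setReg]
      norm_num
      refine hval (fun a => ν.num (F.rev a)) _ _ _ hc' ?_ h.rev a ha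
      simp only [F.rev_rev]
      exact hc
    · simp only [arr_setArr, arr_setReg]
      norm_num
      exact hval (fun a => ν.num (σ a)) _ _ _ (by simp only [hσc, hc]) (by simp only [hσc', hc'])
        h.rot a ha
    · simp only [arr_setArr, arr_setReg]
      norm_num
      refine hval (fun a => ν.num (σ⁻¹ a)) _ _ _ ?_ ?_ h.inv a ha
      · rw [Equiv.Perm.inv_eq_iff_eq.2 hσc.symm, hc]
      · rw [Equiv.Perm.inv_eq_iff_eq.2 hσc'.symm, hc']
  · simp [reg_setArr, reg_setReg]
  · simp [reg_setArr, reg_setReg]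
  · intro r h1 h2 h3
    simp [reg_setArr, reg_setReg, h1, h2, h3]
  · intro b hb
    funext j
    have h0 : b ≠ 0 := by omega
    have h1 : b ≠ 1 := by omega
    have h2 : b ≠ 2 := by omega
    have h3 : b ≠ 4 := by omega
    simp [arr_setArr, arr_setReg, h0, h1, h2, h3]

/-- Insert an edge between the vertices in registers 24 and 25, after the darts whose numbers,
increased by one, are in registers 28 and 29; zero stands for a vertex without darts. -/
def addEdge : Cmd :=
  alloc ;;
  .ite (.const 0) (.reg 28) (.set 20 (.sub (.reg 28) (.const 1))) (.set 20 (.reg 26)) ;;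
  .set 21 (.reg 26) ;; swapRot ;;
  .ite (.const 0) (.reg 29) (.set 20 (.sub (.reg 29) (.const 1))) (.set 20 (.reg 27)) ;;
  .set 21 (.reg 27) ;; swapRot

theorem SysRep.rot_eq_self {S : DartSystem F n} {M : ℕ} {s : Mem} (h : SysRep ν S M s) {a : A}
    (ha : M ≤ ν.num a) : S.rot a = a :=
  S.isRot.fixed a fun h' => by have := h.num_lt h'; omega

theorem wp_addEdge {S : DartSystem F n} {M W t : ℕ} {s : Mem} {Q : Mem → ℕ → Prop}
    (h : SysRep ν S M s) (hW : N + n + 2 ≤ W) (hM : M + 2 ≤ N) {c k k' : A} {u v : Fin n}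
    (hc : ν.num c = M) (hI : S.CanInsert c k k' u v) (h24 : s.reg 24 = u) (h25 : s.reg 25 = v)
    (h28 : s.reg 28 = ν.num k + 1 ∨ k = c ∧ s.reg 28 = 0)
    (h29 : s.reg 29 = ν.num k' + 1 ∨ k' = F.rev c ∧ s.reg 29 = 0)
    (hQ : ∀ s' t', ν.num (F.rev c) = M + 1 → SysRep ν (S.insert hI) (M + 2) s' →
      s'.reg 26 = M → s'.reg 27 = M + 1 → (∀ r, r ≠ 1 → r < 20 ∨ 28 ≤ r → s'.reg r = s.reg r) →
      (∀ b, 5 ≤ b → s'.arr b = s.arr b) → t' ≤ t + 100 → Q s' t') : addEdge.wp W s t Q := by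
  have hMW : M + 2 ≤ W := by omega
  have hkM : k = c ∨ ν.num k < M := by
    rcases hI.left with h1 | h1
    · exact .inr (h.num_lt h1.1)
    · exact .inl h1.1
  have hkM' : k' = F.rev c ∨ ν.num k' < M := by
    rcases hI.right with h1 | h1
    · exact .inr (h.num_lt h1.1)
    · exact .inl h1.1
  refine wp_alloc h.toPreRep hW hM hc (fun a => h.rot_eq_self) h24 h25 ?_
  intro s₁ hc' h₁ h26 h27 hr₁ ha₁
  have hkM2 : ν.num k < M + 2 := by
    rcases hkM with rfl | h1 <;> omega
  have hkM2' : ν.num k' < M + 2 := by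
    rcases hkM' with rfl | h1 <;> omega
  have first : ∀ s₂ t₂, PreRep ν (Function.update (Function.update S.fst c u) (F.rev c) v) S.rot
      (M + 2) s₂ → s₂.reg 20 = ν.num k → (∀ r, r ≠ 20 → s₂.reg r = s₁.reg r) →
      (∀ b, 5 ≤ b → s₂.arr b = s.arr b) → t₂ ≤ t + 41 →
      (Cmd.set 21 (.reg 26) ;; swapRot ;;
        .ite (.const 0) (.reg 29) (.set 20 (.sub (.reg 29) (.const 1))) (.set 20 (.reg 27)) ;;
        .set 21 (.reg 27) ;; swapRot).wp W s₂ t₂ Q := by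
    intro s₂ t₂ h₂ h20 hr₂ ha₂ ht₂
    have h26' : s₂.reg 26 = M := (hr₂ 26 (by omega)).trans h26
    refine ⟨by omega, ⟨by omega, by rw [h26']; omega⟩, ?_⟩
    refine wp_swapRot (k := k) (c := c) (h₂.congr (by simp [reg_setReg]) (by simp [reg_setReg])
      (fun b _ => rfl)) (by omega) hkM2 (by omega) (by simp [reg_setReg, h20])
      (by simp [reg_setReg, Expr.eval, h26', hc]) ?_
    intro s₃ h₃ hr₃ ha₃
    have hr₃' : ∀ r, r < 20 ∨ 24 ≤ r → s₃.reg r = s₁.reg r := by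
      intro r hr
      rw [hr₃ r (by omega) (by omega), reg_setReg, if_neg (by omega), hr₂ r (by omega)]
    have h27' : s₃.reg 27 = M + 1 := (hr₃' 27 (by omega)).trans h27
    have h29' : s₃.reg 29 = s.reg 29 :=
      (hr₃' 29 (by omega)).trans (hr₁ 29 (by omega) (by omega) (by omega))
    have second : ∀ s₄ t₄, PreRep ν (Function.update (Function.update S.fst c u) (F.rev c) v)
        (S.rot * Equiv.swap k c) (M + 2) s₄ → s₄.reg 20 = ν.num k' →
        (∀ r, r ≠ 20 → s₄.reg r = s₃.reg r) → (∀ b, 5 ≤ b → s₄.arr b = s.arr b) → t₄ ≤ t + 72 →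
        (Cmd.set 21 (.reg 27) ;; swapRot).wp W s₄ t₄ Q := by
      intro s₄ t₄ h₄ h20 hr₄ ha₄ ht₄
      have h27'' : s₄.reg 27 = M + 1 := (hr₄ 27 (by omega)).trans h27'
      refine ⟨by omega, ⟨by omega, by rw [h27'']; omega⟩, ?_⟩
      refine wp_swapRot (k := k') (c := F.rev c) (h₄.congr (by simp [reg_setReg])
        (by simp [reg_setReg]) (fun b _ => rfl)) (by omega) hkM2' (by omega)
        (by simp [reg_setReg, h20]) (by simp [reg_setReg, Expr.eval, h27'', hc']) ?_
      intro s₅ h₅ hr₅ ha₅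
      have hr₅' : ∀ r, r < 20 ∨ 24 ≤ r → s₅.reg r = s₁.reg r := by
        intro r hr
        rw [hr₅ r (by omega) (by omega), reg_setReg, if_neg (by omega), hr₄ r (by omega),
          hr₃' r hr]
      refine hQ _ _ hc' ⟨h₅, fun a => ?_⟩ ((hr₅' 26 (by omega)).trans h26)
        ((hr₅' 27 (by omega)).trans h27) ?_ ?_ ?_
      · rw [S.insert_used hI]
        constructor
        · rintro (rfl | rfl | h1)
          · omega
          · omega
          · exact (h.num_lt h1).trans (by omega)
        · intro h1
          by_cases h2 : a = c
          · exact .inr (.inl h2)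
          by_cases h3 : a = F.rev c
          · exact .inl h3
          have h4 : ν.num a ≠ M := fun e => h2 (ν.inj (e.trans hc.symm))
          have h5 : ν.num a ≠ M + 1 := fun e => h3 (ν.inj (e.trans hc'.symm))
          exact .inr (.inr ((h.used a).2 (by omega)))
      · intro r h1 h2
        rw [hr₅' r (by omega), hr₁ r h1 (by omega) (by omega)]
      · intro b hb
        rw [ha₅ b hb]
        exact ha₄ b hb
      · simp only [Expr.cost]; omega
    have ha₃' : ∀ b, 5 ≤ b → s₃.arr b = s.arr b := fun b hb => (ha₃ b hb).trans (ha₂ b hb)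
    refine ⟨by simp [Expr.Ok], ⟨by omega, ?_⟩, fun hlt => ?_, fun hlt => ?_⟩
    · rw [h29']; omega
    · refine ⟨by omega, ⟨⟨by omega, by rw [h29']; omega⟩, by simp [Expr.Ok]; omega⟩, ?_⟩
      refine second _ _ (h₃.congr (by simp [reg_setReg]) (by simp [reg_setReg])
        (fun b _ => rfl)) ?_ (fun r hr => by simp [reg_setReg, hr]) ha₃' ?_
      · simp only [Expr.eval, h29'] at hlt
        simp only [Expr.eval, reg_setReg, if_true, h29']
        omega
      · simp only [Expr.cost]; omega
    · refine ⟨by omega, ⟨by omega, by rw [h27']; omega⟩, ?_⟩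
      refine second _ _ (h₃.congr (by simp [reg_setReg]) (by simp [reg_setReg])
        (fun b _ => rfl)) ?_ (fun r hr => by simp [reg_setReg, hr]) ha₃' ?_
      · simp only [Expr.eval, h29'] at hlt
        simp only [Expr.eval, reg_setReg, if_true, h27']
        rcases h29 with h1 | ⟨rfl, h1⟩
        · omega
        · exact hc'.symm
      · simp only [Expr.cost]; omega
  have h28' : s₁.reg 28 = s.reg 28 := hr₁ 28 (by omega) (by omega) (by omega)
  refine ⟨by simp [Expr.Ok], ⟨by omega, ?_⟩, fun hlt => ?_, fun hlt => ?_⟩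
  · rw [h28']; omega
  · refine ⟨by omega, ⟨⟨by omega, by rw [h28']; omega⟩, by simp [Expr.Ok]; omega⟩, ?_⟩
    refine first _ _ (h₁.congr (by simp [reg_setReg]) (by simp [reg_setReg])
      (fun b _ => rfl)) ?_ (fun r hr => by simp [reg_setReg, hr]) ha₁ ?_
    · simp only [Expr.eval, h28'] at hlt
      simp only [Expr.eval, reg_setReg, if_true, h28']
      omega
    · simp only [Expr.cost]; omega
  · refine ⟨by omega, ⟨by omega, by rw [h26]; omega⟩, ?_⟩
    refine first _ _ (h₁.congr (by simp [reg_setReg]) (by simp [reg_setReg])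
      (fun b _ => rfl)) ?_ (fun r hr => by simp [reg_setReg, hr]) ha₁ ?_
    · simp only [Expr.eval, h28'] at hlt
      simp only [Expr.eval, reg_setReg, if_true, h26]
      rcases h28 with h1 | ⟨rfl, h1⟩
      · omega
      · exact hc.symm
    · simp only [Expr.cost]; omega

/-- Multiply the rotation by the transposition of the dart given by `e` and the dart in
register `r`. -/
def swapAt (e : Expr) (r : ℕ) : Cmd := .set 20 e ;; .set 21 (.reg r) ;; swapRot

theorem wp_swapAt {f : A → Fin n} {σ : Equiv.Perm A} {M W t r : ℕ} {s : Mem} {e : Expr}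
    {Q : Mem → ℕ → Prop} (h : PreRep ν f σ M s) (hW : N ≤ W) {k c : A} (hk : ν.num k < M)
    (hc : ν.num c < M) (he : e.Ok W s) (hek : e.eval s = ν.num k) (hr : r < 30) (hr' : r ≠ 20)
    (hrc : s.reg r = ν.num c)
    (hQ : ∀ s', PreRep ν f (σ * Equiv.swap k c) M s' →
      (∀ r, r < 20 ∨ 24 ≤ r → s'.reg r = s.reg r) → (∀ b, 5 ≤ b → s'.arr b = s.arr b) →
      Q s' (t + (e.cost + 21))) : (swapAt e r).wp W s t Q := by
  have h1 : (s.setReg 20 (e.eval s)).reg r = ν.num c := by simp [reg_setReg, hr', hrc]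
  refine ⟨by omega, he, by omega, ⟨hr, ?_⟩, ?_⟩
  · rw [h1]; exact (ν.lt c).le.trans hW
  refine wp_swapRot (k := k) (c := c) (h.congr (by simp [reg_setReg]) (by simp [reg_setReg])
    (fun b _ => rfl)) hW hk hc (by simp [reg_setReg, hek]) (by simp [Expr.eval, reg_setReg, hr', hrc])
    ?_
  intro s' h' hr' ha'
  have e1 : t + (e.cost + 21) = t + (e.cost + 1) + ((Expr.reg r).cost + 1) + 18 := by
    simp only [Expr.cost]; omega
  rw [← e1]
  refine hQ s' h' (fun q hq => ?_) ha'
  rw [hr' q (by omega) (by omega), reg_setReg, if_neg (by omega), reg_setReg, if_neg (by omega)]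

/-- Repeat a command while the register `r`, which is increased in every round, is less than the
register `q`. -/
def forLoop (r q : ℕ) (c : Cmd) : Cmd :=
  .loop (.reg r) (.reg q) (c ;; .set r (.add (.reg r) (.const 1)))

theorem wp_forLoop {W r q L K a t : ℕ} {c : Cmd} {s : Mem} {Q : Mem → ℕ → Prop}
    (I : ℕ → Mem → Prop) (hr : r < 30) (hq : q < 30) (hLW : L + 1 ≤ W) (ha : s.reg r = a)
    (haL : a ≤ L) (h₀ : I a s) (hL : ∀ i s, I i s → s.reg q = L)
    (hbody : ∀ i s t, i < L → s.reg r = i → I i s → c.wp W s t fun s' t' =>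
      s'.reg r = i ∧ I (i + 1) (s'.setReg r (i + 1)) ∧ t' ≤ t + K)
    (hQ : ∀ s' t', s'.reg r = L → I L s' → t' ≤ t + (L + 1) * (K + 10) → Q s' t') :
    (forLoop r q c).wp W s t Q := by
  refine Cmd.wp_loop (fun s' t' => ∃ i, s'.reg r = i ∧ i ≤ L ∧ I i s' ∧ t' ≤ t + i * (K + 10))
    (t + L * (K + 10)) ⟨a, ha, haL, h₀, by omega⟩ ?_ ?_ ?_ ?_
  · rintro s' t' ⟨i, h1, h2, h3, h4⟩
    have := Nat.mul_le_mul_right (K + 10) h2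
    omega
  · rintro s' t' ⟨i, h1, h2, h3, h4⟩
    exact ⟨⟨hr, by rw [h1]; omega⟩, ⟨hq, by rw [hL i s' h3]; omega⟩⟩
  · rintro s' t' ⟨i, h1, h2, h3, h4⟩ hlt
    have hiL : i < L := by
      simpa only [Expr.eval, h1, hL i s' h3] using hlt
    refine Cmd.wp_seq (hbody i s' _ hiL h1 h3) ?_
    rintro s₁ t₁ ⟨h5, h6, h7⟩
    have e1 : (Expr.add (.reg r) (.const 1)).eval s₁ = i + 1 := by simp [Expr.eval, h5]
    refine ⟨hr, ⟨⟨hr, by rw [h5]; omega⟩, by simp only [Expr.Ok]; omega, ?_⟩, i + 1, ?_, hiL, ?_, ?_⟩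
    · simp only [Expr.eval, h5]; omega
    · rw [reg_setReg, if_pos rfl, e1]
    · rw [e1]; exact h6
    · simp only [Expr.cost] at h7 ⊢
      have : (i + 1) * (K + 10) = i * (K + 10) + (K + 10) := by ring
      omega
  · rintro s' t' ⟨i, h1, h2, h3, h4⟩ hlt
    have hiL : i = L := by
      simp only [Expr.eval, h1, hL i s' h3] at hlt
      omega
    subst hiL
    refine hQ _ _ h1 h3 ?_
    have : (i + 1) * (K + 10) = i * (K + 10) + (K + 10) := by ring
    simp only [Expr.cost]
    omega

end

section

open RAM

variable {A : Type} {F : Frame A} {n m N : ℕ} {ν : DartNumbering F m N}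
variable [Finite A] [DecidableEq A]

/-! ## Preparation of the tables -/

/-- Compute the inverse of the rotation and, in array 5, the crossed dart of every vertex. -/
def initTables : Cmd :=
  .set 5 (.reg 1) ;; .set 4 (.const 0) ;;
  forLoop 4 5
    (.put 4 (.get 2 (.reg 4)) (.reg 4) ;;
    .ite (.const 0) (.get 3 (.reg 4))
      (.put 5 (.get 0 (.reg 4)) (.add (.reg 4) (.const 1))) .skip)

/-- Array 5 contains the crossed dart of every vertex, as far as it has a number below `i`. -/
structure CrossTable (ν : DartNumbering F m N) (f : A → Fin n) (i : ℕ) (s : Mem) : Prop where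
  of_dart : ∀ x, (F.cross x).isSome → ν.num x < i → s.arr 5 (f x) = ν.num x + 1
  dart : ∀ v : Fin n, s.arr 5 v ≠ 0 → ∃ x, (F.cross x).isSome ∧ f x = v ∧
    s.arr 5 v = ν.num x + 1

theorem optNum_pos_iff {num : A → ℕ} {o : Option A} : 0 < optNum num o ↔ o.isSome := by
  rcases o with - | a <;> simp [optNum, DartSystem.optNum]

theorem DartNumbering.optNum_le (ν : DartNumbering F m N) (o : Option A) :
    optNum ν.num o ≤ N := by
  rcases o with - | a
  · simp [optNum, DartSystem.optNum]
  · exact ν.lt a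

theorem wp_initTables {S : DartSystem F n} {W t : ℕ} {s : Mem} {Q : Mem → ℕ → Prop}
    (h : BaseRep ν S.fst S.rot m s) (hused : ∀ a, a ∈ S.used ↔ ν.num a < m)
    (hW : N + n + 2 ≤ W) (hzero : ∀ b, 4 ≤ b → ∀ i, s.arr b i = 0)
    (hQ : ∀ s' t', SysRep ν S m s' → CrossTable ν S.fst m s' →
      (∀ b, 6 ≤ b → ∀ i, s'.arr b i = 0) → t' ≤ t + (m + 2) * 40 → Q s' t') :
    initTables.wp W s t Q := by
  have hmN := h.le
  refine ⟨by omega, ⟨by omega, by rw [h.reg1]; omega⟩, by omega, by simp [Expr.Ok], ?_⟩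
  refine wp_forLoop (L := m) (K := 20) (fun i s' => BaseRep ν S.fst S.rot m s' ∧
    (∀ a, ν.num a < i → s'.arr 4 (ν.num (S.rot a)) = ν.num a) ∧ CrossTable ν S.fst i s' ∧
    (∀ b, 6 ≤ b → ∀ i, s'.arr b i = 0) ∧ s'.reg 5 = m) (by omega) (by omega) (by omega)
    (by simp [reg_setReg, Expr.eval]; rfl) (by omega) ?_ (fun i s hI => hI.2.2.2.2) ?_ ?_
  · refine ⟨h.congr (by simp [reg_setReg]) (by simp [reg_setReg]) (fun b _ => rfl), ?_, ?_, ?_, ?_⟩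
    · intro a ha; omega
    · refine ⟨fun x _ hx => by omega, fun v hv => absurd (hzero 5 (by omega) v) hv⟩
    · intro b hb i; exact hzero b (by omega) i
    · simp [reg_setReg, Expr.eval, h.reg1]
  · rintro i s' t' hi h4 ⟨hb, hinv, hT, hz, h5⟩
    obtain ⟨a, rfl⟩ := ν.surj i (by omega)
    have ha : a ∈ S.used := (hused a).2 hi
    have hrot := hb.rot a hi
    have hcr := hb.cross a
    have hfst := hb.fst a hi
    have l1 : ν.num (S.rot a) ≤ W := by have := ν.lt (S.rot a); omega
    have l2 := ν.optNum_le (F.cross a)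
    have l3 : ν.num a + 1 ≤ W := by omega
    have l4 := (S.fst a).2
    refine Cmd.wp_of_post fun R hR => ?_
    simp only [Cmd.wp, Expr.Ok, Expr.eval, Expr.cost, reg_setArr, arr_setArr, h4, hrot,
      Nat.reduceEqDiff, reduceIte, hcr, hfst, optNum_pos_iff]
    refine ⟨by omega, by omega, ?_⟩
    have hb' : ∀ s'', s''.reg 0 = s'.reg 0 → s''.reg 1 = s'.reg 1 →
        (∀ b < 4, s''.arr b = s'.arr b) → BaseRep ν S.fst S.rot m s'' :=
      fun s'' h1 h2 h3 => hb.congr h1 h2 h3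
    have hinv' : ∀ s'' : Mem, s''.arr 4 = (s'.setArr 4 (ν.num (S.rot a)) (ν.num a)).arr 4 →
        ∀ a', ν.num a' < ν.num a + 1 → s''.arr 4 (ν.num (S.rot a')) = ν.num a' := by
      intro s'' h1 a' ha'
      rw [h1, arr_setArr, if_pos rfl]
      split_ifs with h2
      · rw [S.rot.injective (ν.inj h2)]
      · have : ν.num a' ≠ ν.num a := fun h3 => h2 (by rw [ν.inj h3])
        exact hinv a' (by omega)
    refine ⟨by omega, by omega, fun hc => ⟨by omega, by omega, hR _ _ ?_⟩,
      fun hc => hR _ _ ?_⟩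
    · refine ⟨by simp [reg_setArr, h4], ⟨hb' _ (by simp [reg_setReg, reg_setArr])
        (by simp [reg_setReg, reg_setArr]) ?_, hinv' _ ?_, ⟨?_, ?_⟩, ?_,
        by simpa [reg_setReg, reg_setArr] using h5⟩, by omega⟩
      · intro b hb
        funext j
        rw [arr_setReg, arr_setArr, if_neg (by omega), arr_setArr, if_neg (by omega)]
      · funext j
        rw [arr_setReg, arr_setArr, if_neg (by omega)]
      · intro x hx hxi
        rw [arr_setReg, arr_setArr, if_pos rfl]
        by_cases hxa : S.fst x = S.fst a
        · rw [if_pos (by rw [hxa]), S.indep x a hx hc hxa]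
        · rw [if_neg (fun e => hxa (Fin.ext e)), arr_setArr, if_neg (by omega)]
          refine hT.of_dart x hx ?_
          have : ν.num x ≠ ν.num a := fun e => hxa (by rw [ν.inj e])
          omega
      · intro v hv
        rw [arr_setReg, arr_setArr, if_pos rfl] at hv ⊢
        by_cases hva : v = S.fst a
        · exact ⟨a, hc, hva.symm, by rw [if_pos (by rw [hva])]⟩
        · rw [if_neg (fun e => hva (Fin.ext e)), arr_setArr, if_neg (by omega)] at hv ⊢
          exact hT.dart v hv
      · intro b hb j
        rw [arr_setReg, arr_setArr, if_neg (by omega), arr_setArr, if_neg (by omega)]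
        exact hz b hb j
    · refine ⟨by simp [reg_setArr, h4], ⟨hb' _ (by simp [reg_setReg, reg_setArr])
        (by simp [reg_setReg, reg_setArr]) ?_, hinv' _ rfl, ⟨?_, ?_⟩, ?_,
        by simpa [reg_setReg, reg_setArr] using h5⟩, by omega⟩
      · intro b hb
        funext j
        rw [arr_setReg, arr_setArr, if_neg (by omega)]
      · intro x hx hxi
        rw [arr_setReg, arr_setArr, if_neg (by omega)]
        refine hT.of_dart x hx ?_
        have : ν.num x ≠ ν.num a := fun e => hc (by rw [← ν.inj e]; exact hx)
        omega
      · intro v hv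
        rw [arr_setReg, arr_setArr, if_neg (by omega)] at hv ⊢
        exact hT.dart v hv
      · intro b hb j
        rw [arr_setReg, arr_setArr, if_neg (by omega)]
        exact hz b hb j
  · rintro s' t' h4 ⟨hb, hinv, hT, hz, h5⟩ ht
    refine hQ s' t' ⟨⟨hb, fun a ha => ?_⟩, hused⟩ hT hz ?_
    · have := hinv (S.rot⁻¹ a)
      rw [perm_apply_inv] at this
      exact this ((hused _).1 (S.isRot.inv_mem ((hused _).2 ha)))
    · simp only [Expr.cost] at ht; omega

/-- Find, for every vertex with a crossed dart, the dart in array 6 that can close the corner to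
the left of the crossed dart. -/
def findSides : Cmd :=
  .set 4 (.const 0) ;;
  forLoop 4 1
    (.set 10 (.get 5 (.get 0 (.reg 4))) ;;
    .ite (.const 0) (.reg 10)
      (.set 11 (.sub (.get 3 (.sub (.reg 10) (.const 1))) (.const 1)) ;;
      .set 12 (.get 0 (.get 1 (.reg 4))) ;; .set 13 (.get 0 (.get 1 (.reg 11))) ;;
      .ite (.const 0) (.add (.sub (.reg 12) (.reg 13)) (.sub (.reg 13) (.reg 12))) .skip
        (.put 6 (.get 0 (.reg 4)) (.add (.reg 4) (.const 1))))
      .skip)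

/-- The entry of array 6 for the crossed dart `x`. -/
def SideEntry (ν : DartNumbering F m N) (S : DartSystem F n) (s : Mem) (i : ℕ) (x e : A) : Prop :=
  (s.arr 6 (S.fst x) = 0 ∧ ∀ a ∈ S.used, ν.num a < i → S.fst a = S.fst x →
      S.fst (F.rev a) ≠ S.fst (F.rev e)) ∨
  ∃ c ∈ S.used, S.fst c = S.fst x ∧ S.fst (F.rev c) = S.fst (F.rev e) ∧
    s.arr 6 (S.fst x) = ν.num c + 1

theorem wp_findSides {S : DartSystem F n} {W t : ℕ} {s : Mem} {Q : Mem → ℕ → Prop}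
    (h : SysRep ν S m s) (hW : 2 * N + 2 * n + 2 ≤ W) (hT : CrossTable ν S.fst m s)
    (hzero : ∀ b, 6 ≤ b → ∀ i, s.arr b i = 0)
    (hQ : ∀ s' t', SysRep ν S m s' → (∀ x e, F.cross x = some e → SideEntry ν S s' m x e) →
      (∀ b, 7 ≤ b → ∀ i, s'.arr b i = 0) → t' ≤ t + (m + 2) * 80 → Q s' t') :
    findSides.wp W s t Q := by
  have hmN := h.le
  refine ⟨by omega, by simp [Expr.Ok], ?_⟩
  refine wp_forLoop (L := m) (K := 60) (fun i s' => SysRep ν S m s' ∧ s'.arr 5 = s.arr 5 ∧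
    (∀ x e, F.cross x = some e → SideEntry ν S s' i x e) ∧
    (∀ b, 7 ≤ b → ∀ i, s'.arr b i = 0)) (by omega) (by omega) (by omega)
    (by simp [reg_setReg, Expr.eval]; rfl) (by omega) ?_ (fun i s hI => hI.1.reg1) ?_ ?_
  · refine ⟨h.congr (by simp [reg_setReg]) (by simp [reg_setReg]) (fun b _ => rfl), rfl, ?_, ?_⟩
    · intro x e _
      exact .inl ⟨hzero 6 (by omega) _, fun a _ ha => by omega⟩
    · intro b hb i; exact hzero b (by omega) i
  · rintro i s' t' hi h4 ⟨hb, h5, hE, hz⟩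
    obtain ⟨a, ha, rfl⟩ := hb.exists_dart hi
    have hrev := hb.get_rev ha
    have hfr := hb.get_fst (S.rev_mem a ha)
    have hfst := hb.get_fst ha
    have l1 := ν.lt (F.rev a)
    have l4 := (S.fst a).2
    have l5 := (S.fst (F.rev a)).2
    have keep : ∀ s'' : Mem, SysRep ν S m s'' → s''.arr 6 = s'.arr 6 → s''.arr 5 = s'.arr 5 →
        (∀ b, 7 ≤ b → s''.arr b = s'.arr b) →
        (∀ x e, F.cross x = some e → S.fst a = S.fst x → S.fst (F.rev a) ≠ S.fst (F.rev e)) →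
        SysRep ν S m s'' ∧ s''.arr 5 = s.arr 5 ∧
          (∀ x e, F.cross x = some e → SideEntry ν S s'' (ν.num a + 1) x e) ∧
          (∀ b, 7 ≤ b → ∀ i, s''.arr b i = 0) := by
      intro s'' h1 h2 h3 h4 h6
      refine ⟨h1, h3.trans h5, fun x e hx => ?_, fun b hb i => by rw [h4 b hb]; exact hz b hb i⟩
      rw [SideEntry, h2]
      refine (hE x e hx).imp_left ?_
      rintro ⟨h7, h8⟩
      refine ⟨h7, fun a' ha' hlt => ?_⟩
      by_cases haa : a' = a
      · subst haa; exact h6 x e hx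
      · refine h8 a' ha' ?_
        have : ν.num a' ≠ ν.num a := fun h => haa (ν.inj h)
        omega
    have l6 : s.arr 5 (S.fst a) ≤ N := by
      by_cases h0 : s.arr 5 (S.fst a) = 0
      · omega
      · obtain ⟨x, -, -, hx⟩ := hT.dart _ h0
        have := ν.lt x
        omega
    refine Cmd.wp_of_post fun R hR => ?_
    simp only [Cmd.wp, Expr.Ok, Expr.eval, Expr.cost, reg_setReg, arr_setReg, h4, hfst,
      hrev, hfr, h5, Nat.reduceEqDiff, reduceIte]
    refine ⟨by omega, by omega, by omega, by omega, fun hpos => ?_, fun hzer => hR _ _ ?_⟩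
    · obtain ⟨x, hx, hxa, hx5⟩ := hT.dart _ hpos.ne'
      obtain ⟨e, he⟩ := Option.isSome_iff_exists.1 hx
      have hxm := S.cross_mem x hx
      have hem := S.mem_of_cross_eq he
      have hcr : s'.arr 3 (ν.num x) = ν.num e + 1 := by rw [hb.cross, he]; rfl
      have hre := hb.get_rev hem
      have hfre := hb.get_fst (S.rev_mem e hem)
      have l7 := ν.lt x
      have l8 := ν.lt e
      have l9 := ν.lt (F.rev e)
      have l10 := (S.fst (F.rev e)).2
      rw [hx5]
      simp only [Nat.add_sub_cancel, hcr, hre, hfre]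
      refine ⟨by omega, by omega, by omega, by omega, by omega, by omega, by omega, by omega,
        ?_, ?_⟩
      · intro hne
        refine hR _ _ ⟨by simp [reg_setReg, h4], keep _ (hb.congr (by simp [reg_setReg]) (by simp [reg_setReg]) (fun b _ => rfl))
          rfl rfl (fun b _ => rfl) ?_, by omega⟩
        intro x' e' he' h1 h2
        obtain rfl : x' = x := S.indep _ _ (by rw [he']; rfl) hx (h1.symm.trans hxa.symm)
        rw [he] at he'
        obtain rfl := Option.some.inj he'
        rw [h2] at hne
        omega
      · intro heq
        have hff : S.fst (F.rev a) = S.fst (F.rev e) := Fin.ext (by omega)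
        refine ⟨by omega, by omega, hR _ _ ⟨by simp [reg_setReg, reg_setArr, h4],
          ⟨?_, ?_, ?_, ?_⟩, by omega⟩⟩
        · refine hb.congr (by simp [reg_setReg, reg_setArr]) (by simp [reg_setReg, reg_setArr]) ?_
          intro b hb
          funext j
          rw [arr_setReg, arr_setArr, if_neg (by omega)]
          rfl
        · funext j
          rw [arr_setReg, arr_setArr, if_neg (by omega), ← h5]
          rfl
        · intro x' e' he'
          by_cases hxx : x' = x
          · subst hxx
            rw [he] at he'
            obtain rfl := Option.some.inj he'
            refine .inr ⟨a, ha, hxa.symm, hff, ?_⟩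
            rw [arr_setReg, arr_setArr, if_pos rfl, if_pos (by rw [hxa])]
          · have hne : S.fst x' ≠ S.fst a := fun h1 =>
              hxx (S.indep _ _ (by rw [he']; rfl) hx (h1.trans hxa.symm))
            rw [SideEntry, arr_setReg, arr_setArr, if_pos rfl, if_neg (fun e => hne (Fin.ext e))]
            refine (hE x' e' he').imp_left ?_
            rintro ⟨h7, h8⟩
            refine ⟨h7, fun a' ha' hlt hf => ?_⟩
            have : ν.num a' ≠ ν.num a := fun h => hne (by rw [← hf, ν.inj h])
            exact h8 a' ha' (by omega) hf
        · intro b hb j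
          rw [arr_setReg, arr_setArr, if_neg (by omega)]
          exact hz b hb j
    · refine ⟨by simp [reg_setReg, h4], keep _ (hb.congr (by simp [reg_setReg]) (by simp [reg_setReg]) (fun b _ => rfl))
          rfl rfl (fun b _ => rfl) ?_, by omega⟩
      intro x e he h1 _
      have hxs : (F.cross x).isSome := by rw [he]; rfl
      have := hT.of_dart x hxs (h.num_lt (S.cross_mem x hxs))
      rw [← h1] at this
      omega
  · rintro s' t' h4 ⟨hb, h5, hE, hz⟩ ht
    refine hQ s' t' hb hE hz ?_
    simp only [Expr.cost] at ht; omega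

end

section

open RAM

variable {A : Type} {F : Frame A} {n m N : ℕ} {ν : DartNumbering F m N}
variable [Finite A] [DecidableEq A]

/-! ## Closing the corners at the crossings -/

/-- The edges of `S` are edges of `S'`. -/
def DartSystem.Extends (S S' : DartSystem F n) : Prop :=
  ∀ a ∈ S.used, a ∈ S'.used ∧ S'.fst a = S.fst a

theorem DartSystem.Extends.refl (S : DartSystem F n) : S.Extends S := fun _ ha => ⟨ha, rfl⟩

theorem DartSystem.Extends.trans {S S' S'' : DartSystem F n} (h : S.Extends S')
    (h' : S'.Extends S'') : S.Extends S'' := fun a ha =>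
  ⟨(h' a (h a ha).1).1, (h' a (h a ha).1).2.trans (h a ha).2⟩

theorem DartSystem.Extends.graph_le {S S' : DartSystem F n} (h : S.Extends S') :
    S.graph ≤ S'.graph := by
  rintro u v ⟨a, ha, rfl, rfl⟩
  exact ⟨a, (h a ha).1, (h a ha).2, (h _ (S.rev_mem a ha)).2⟩

theorem DartSystem.extends_insert {S : DartSystem F n} {c k k' : A} {u v : Fin n}
    (h : S.CanInsert c k k' u v) : S.Extends (S.insert h) := fun _ ha =>
  ⟨DartSystem.mem_insert_of_mem h ha, DartSystem.insert_fst_of_mem h ha⟩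

theorem DartSystem.ClosesCorner.extends_close {S : DartSystem F n} {x e c : A}
    (h : S.ClosesCorner x e c) : S.Extends h.close := fun _ ha => ⟨h.mem_close.2 (.inl ha), h.close_fst ha⟩

/-- Move the edge of the dart in register 26 into the corner at the dart in register 4. -/
def moveEdge : Cmd :=
  swapAt (.get 4 (.reg 26)) 26 ;; swapAt (.get 4 (.reg 27)) 27 ;; .set 14 (.get 4 (.reg 10)) ;;
  swapAt (.reg 4) 26 ;; swapAt (.reg 14) 27

theorem wp_moveEdge {f : A → Fin n} {S : DartSystem F n} {x e c : A} (hcl : S.ClosesCorner x e c)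
    {M W t : ℕ} {s : Mem} {Q : Mem → ℕ → Prop} (h : PreRep ν f S.rot M s) (hW : N ≤ W)
    (hx : ν.num x < M) (he : ν.num (F.rev e) < M) (hc : ν.num c < M) (hc' : ν.num (F.rev c) < M)
    (h26 : s.reg 26 = ν.num c) (h27 : s.reg 27 = ν.num (F.rev c)) (h4 : s.reg 4 = ν.num x)
    (h10 : s.reg 10 = ν.num (F.rev e))
    (hQ : ∀ s' t', PreRep ν f hcl.close.rot M s' → (∀ r < 14, s'.reg r = s.reg r) →
      (∀ b, 5 ≤ b → s'.arr b = s.arr b) → t' ≤ t + 100 → Q s' t') : moveEdge.wp W s t Q := by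
  have hle : ∀ a, ν.num a ≤ W := fun a => (ν.lt a).le.trans hW
  have i1 := h.inv c hc
  refine wp_swapAt h hW (h.closed_inv hc) hc ⟨⟨by omega, by rw [h26]; exact hle _⟩, ?_⟩ ?_
    (by omega) (by omega) h26 ?_
  · simp only [Expr.eval, h26, i1]; exact hle _
  · simp only [Expr.eval, h26, i1]
  intro s₁ p₁ r₁ a₁
  have h27₁ : s₁.reg 27 = ν.num (F.rev c) := (r₁ 27 (by omega)).trans h27
  have i2 := p₁.inv _ hc'
  refine wp_swapAt p₁ hW (p₁.closed_inv hc') hc' ⟨⟨by omega, by rw [h27₁]; exact hle _⟩, ?_⟩ ?_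
    (by omega) (by omega) h27₁ ?_
  · simp only [Expr.eval, h27₁, i2]; exact hle _
  · simp only [Expr.eval, h27₁, i2]
  intro s₂ p₂ r₂ a₂
  have e₂ : ∀ r, r < 20 ∨ 24 ≤ r → s₂.reg r = s.reg r := fun r hr => (r₂ r hr).trans (r₁ r hr)
  have i3 := p₂.inv _ he
  have h10₂ : s₂.reg 10 = ν.num (F.rev e) := (e₂ 10 (by omega)).trans h10
  refine ⟨by omega, ⟨⟨by omega, by rw [h10₂]; exact hle _⟩, ?_⟩, ?_⟩
  · simp only [Expr.eval, h10₂, i3]; exact hle _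
  simp only [Expr.eval, h10₂, i3]
  generalize hs₃ : s₂.setReg 14 _ = s₃
  have e₃ : ∀ r, r ≠ 14 → s₃.reg r = s₂.reg r := fun r hr => by rw [← hs₃, reg_setReg, if_neg hr]
  have h14 := congrArg (fun s : Mem => s.reg 14) hs₃.symm
  simp only [reg_setReg, if_pos] at h14
  have p₃ : PreRep ν f _ M s₃ := p₂.congr (e₃ 0 (by omega)) (e₃ 1 (by omega))
    (fun b _ => by rw [← hs₃]; rfl)
  refine wp_swapAt (k := x) (c := c) p₃ hW hx hc ⟨by omega, ?_⟩ ?_ (by omega) (by omega) ?_ ?_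
  · rw [e₃ 4 (by omega), e₂ 4 (by omega), h4]; exact hle _
  · simp only [Expr.eval]
    rw [e₃ 4 (by omega), e₂ 4 (by omega), h4]
  · rw [e₃ 26 (by omega), e₂ 26 (by omega), h26]
  intro s₄ p₄ r₄ a₄
  have h14₄ := (r₄ 14 (by omega)).trans h14
  refine wp_swapAt p₄ hW (p₂.closed_inv he) hc' ⟨by omega, ?_⟩ h14₄ (by omega) (by omega) ?_ ?_
  · rw [h14₄]; exact hle _
  · rw [r₄ 27 (by omega), e₃ 27 (by omega), e₂ 27 (by omega), h27]
  intro s₅ p₅ r₅ a₅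
  refine hQ s₅ _ p₅ ?_ ?_ ?_
  · intro r hr
    rw [r₅ r (by omega), r₄ r (by omega), e₃ r (by omega), e₂ r (by omega)]
  · intro b hb
    rw [a₅ b hb, a₄ b hb, ← hs₃, arr_setReg, a₂ b hb, a₁ b hb]
  · simp only [Expr.cost]; omega

/-- Close the corners at all crossings. -/
def closeCorners : Cmd :=
  .set 5 (.reg 1) ;; .set 4 (.const 0) ;;
  forLoop 4 5
    (.ite (.const 0) (.get 3 (.reg 4))
      (.set 10 (.get 1 (.sub (.get 3 (.reg 4)) (.const 1))) ;;
      .set 24 (.get 0 (.reg 4)) ;; .set 25 (.get 0 (.reg 10)) ;;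
      .ite (.const 0) (.get 6 (.reg 24))
        (.set 26 (.sub (.get 6 (.reg 24)) (.const 1)) ;; .set 27 (.get 1 (.reg 26)))
        alloc ;;
      moveEdge)
      .skip)

theorem wp_closeCorners {S₀ : DartSystem F n} {W t : ℕ} {s : Mem} {Q : Mem → ℕ → Prop}
    (h : SysRep ν S₀ m s) (hW : 2 * N + 2 * n + 2 ≤ W) (hN : 3 * m ≤ N)
    (hE : ∀ x e, F.cross x = some e → SideEntry ν S₀ s m x e)
    (hzero : ∀ b, 7 ≤ b → ∀ i, s.arr b i = 0)
    (hQ : ∀ S M s' t', S₀.Extends S → S.HasKites → M ≤ 3 * m → SysRep ν S M s' →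
      (∀ b, 7 ≤ b → ∀ i, s'.arr b i = 0) → t' ≤ t + (m + 2) * 250 → Q s' t') :
    closeCorners.wp W s t Q := by
  refine ⟨by omega, ⟨by omega, by rw [h.reg1]; omega⟩, by omega, by simp [Expr.Ok], ?_⟩
  refine wp_forLoop (L := m) (K := 240) (fun i s' => s'.reg 5 = m ∧ ∃ S M, S₀.Extends S ∧
    SysRep ν S M s' ∧ M ≤ m + 2 * i ∧ (∀ x, ν.num x < i → S.KiteAt x) ∧
    (∀ x e, F.cross x = some e → i ≤ ν.num x → SideEntry ν S s' N x e) ∧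
    (∀ b, 7 ≤ b → ∀ i, s'.arr b i = 0)) (by omega) (by omega) (by omega)
    (by simp [reg_setReg, Expr.eval]; rfl) (by omega) ?_ (fun i s hI => hI.1) ?_ ?_
  · refine ⟨by simp [reg_setReg, Expr.eval, h.reg1], S₀, m, .refl _, h.congr (by simp [reg_setReg])
      (by simp [reg_setReg]) (fun b _ => rfl), by omega, fun x hx => by omega, ?_, hzero⟩
    intro x e hx _
    refine (hE x e hx).imp_left ?_
    rintro ⟨h1, h2⟩
    exact ⟨h1, fun a ha _ => h2 a ha (h.num_lt ha)⟩
  · rintro i s' t' hi h4 ⟨h5, S, M, hext, hb, hM, hK, hS, hz⟩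
    obtain ⟨x, hx, rfl⟩ := hb.exists_dart (hi.trans_le hb.base)
    have hcr := hb.cross x
    have l1 := ν.optNum_le (F.cross x)
    have hfst := hb.get_fst hx
    have l2 := (S.fst x).2
    have l3 := ν.lt x
    refine Cmd.wp_of_post fun R hR => ?_
    refine ⟨by simp [Expr.Ok], ?_, fun hc => ?_, fun hc => hR _ _ ?_⟩
    · simp only [Expr.Ok, Expr.eval, h4, hcr]; omega
    · simp only [Expr.eval, h4, hcr, optNum_pos_iff] at hc
      obtain ⟨e, he⟩ := Option.isSome_iff_exists.1 hc
      have hem := S.mem_of_cross_eq he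
      have hcr' : s'.arr 3 (ν.num x) = ν.num e + 1 := by rw [hcr, he]; rfl
      have hre := hb.get_rev hem
      have hfre := hb.get_fst (S.rev_mem e hem)
      have l4 := ν.lt e
      have l5 := ν.lt (F.rev e)
      have l6 := (S.fst (F.rev e)).2
      have finish : ∀ (c : A) (hcl : S.ClosesCorner x e c) (M' : ℕ) (s₁ : Mem) (t₁ : ℕ),
          PreRep ν hcl.close.fst S.rot M' s₁ → (∀ a, a ∈ hcl.close.used ↔ ν.num a < M') →
          M' ≤ M + 2 → s₁.reg 26 = ν.num c → s₁.reg 27 = ν.num (F.rev c) →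
          s₁.reg 4 = ν.num x → s₁.reg 5 = m → s₁.reg 10 = ν.num (F.rev e) →
          (∀ b, 6 ≤ b → s₁.arr b = s'.arr b) → t₁ ≤ t' + 100 → moveEdge.wp W s₁ t₁ R := by
        intro c hcl M' s₁ t₁ p₁ hu hM' h26 h27 h4' h5' h10 ha₁ ht₁
        refine wp_moveEdge hcl p₁ (by omega) ((hu _).1 (hcl.mem_close.2 (.inl hx)))
          ((hu _).1 (hcl.mem_close.2 (.inl (S.rev_mem _ hem))))
          ((hu _).1 (hcl.mem_close.2 (.inr (.inl rfl))))
          ((hu _).1 (hcl.mem_close.2 (.inr (.inr rfl)))) h26 h27 h4' h10 ?_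
        intro s₂ t₂ p₂ r₂ a₂ ht₂
        refine hR _ _ ⟨(r₂ 4 (by omega)).trans h4', ⟨?_, hcl.close, M',
          hext.trans hcl.extends_close, ⟨?_, hu⟩, by omega, ?_, ?_, ?_⟩, by omega⟩
        · rw [reg_setReg, if_neg (by omega), r₂ 5 (by omega), h5']
        · exact p₂.congr (by simp [reg_setReg]) (by simp [reg_setReg]) (fun b _ => rfl)
        · intro x' hx'
          by_cases hxx : x' = x
          · rw [hxx]; exact hcl.kiteAt_self
          · refine hcl.kiteAt_of_ne hxx (hK x' ?_)
            have : ν.num x' ≠ ν.num x := fun h => hxx (ν.inj h)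
            omega
        · intro x' e' he' hlt
          have hxm' := S.cross_mem x' (by rw [he']; rfl)
          have hem' := S.rev_mem _ (S.mem_of_cross_eq he')
          have hxx : x' ≠ x := by rintro rfl; omega
          rw [SideEntry, arr_setReg, a₂ 6 (by omega), ha₁ 6 (by omega), hcl.close_fst hxm',
            hcl.close_fst hem']
          rcases hS x' e' he' (by omega) with ⟨h6, h7⟩ | ⟨c', hc', h7, h8, h9⟩
          · refine .inl ⟨h6, fun a ha hlt hf hf' => ?_⟩
            obtain ⟨n1, n2⟩ := hcl.side_ne he' hxx hf hf'
            rcases hcl.mem_close.1 ha with ha | ha | ha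
            · rw [hcl.close_fst ha] at hf
              rw [hcl.close_fst (S.rev_mem a ha)] at hf'
              exact h7 a ha hlt hf hf'
            · exact n1 ha
            · exact n2 ha
          · refine .inr ⟨c', hcl.mem_close.2 (.inl hc'), ?_, ?_, h9⟩
            · rw [hcl.close_fst hc', h7]
            · rw [hcl.close_fst (S.rev_mem _ hc'), h8]
        · intro b hb j
          rw [arr_setReg, a₂ b (by omega), ha₁ b (by omega), hz b hb]
      have hS' := hS x e he le_rfl
      have l7 : s'.arr 6 (S.fst x) ≤ N := by
        rcases hS' with ⟨h6, -⟩ | ⟨c, -, -, -, h6⟩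
        · omega
        · have := ν.lt c; omega
      refine ⟨by omega, ?_, by omega, ?_, by omega, ?_, ?_⟩
      · simp only [Expr.Ok, Expr.eval, h4, hcr', Nat.add_sub_cancel, hre]
        omega
      · simp only [Expr.Ok, Expr.eval, reg_setReg, arr_setReg, Nat.reduceEqDiff, reduceIte, h4, hfst]
        omega
      · simp only [Expr.Ok, Expr.eval, reg_setReg, arr_setReg, Nat.reduceEqDiff, reduceIte, h4, hcr',
          Nat.add_sub_cancel, hre, hfre]
        omega
      · simp only [Expr.eval, reg_setReg, arr_setReg, Nat.reduceEqDiff, reduceIte, h4, hcr',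
          Nat.add_sub_cancel, hre, hfre, hfst]
        generalize hs₁ : ((s'.setReg 10 _).setReg 24 _).setReg 25 _ = s₁
        have e₁ : ∀ r, r ≠ 10 → r ≠ 24 → r ≠ 25 → s₁.reg r = s'.reg r := by
          intro r h1 h2 h3
          rw [← hs₁, reg_setReg, if_neg h3, reg_setReg, if_neg h2, reg_setReg, if_neg h1]
        have h10 : s₁.reg 10 = ν.num (F.rev e) := by rw [← hs₁]; simp [reg_setReg]
        have h24 : s₁.reg 24 = S.fst x := by rw [← hs₁]; simp [reg_setReg]
        have h25 : s₁.reg 25 = S.fst (F.rev e) := by rw [← hs₁]; simp [reg_setReg]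
        have a₁ : s₁.arr = s'.arr := by rw [← hs₁]; rfl
        have p₁ : SysRep ν S M s₁ := hb.congr (e₁ 0 (by omega) (by omega) (by omega))
          (e₁ 1 (by omega) (by omega) (by omega)) (fun b _ => by rw [a₁])
        have h4₁ : s₁.reg 4 = ν.num x := (e₁ 4 (by omega) (by omega) (by omega)).trans h4
        have h5₁ : s₁.reg 5 = m := (e₁ 5 (by omega) (by omega) (by omega)).trans h5
        refine ⟨by simp [Expr.Ok], ?_, fun hlt => ?_, fun hlt => ?_⟩
        · simp only [Expr.Ok, Expr.eval, h24, a₁]; omega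
        · simp only [Expr.eval, h24, a₁] at hlt
          rcases hS' with ⟨h6, -⟩ | ⟨c, hc, h6, h7, h8⟩
          · omega
          have hcl : S.ClosesCorner x e c := ⟨he, .inl ⟨hc, h6, h7⟩⟩
          have hrc := p₁.get_rev hc
          rw [a₁] at hrc
          have l8 := ν.lt c
          have l9 := ν.lt (F.rev c)
          refine ⟨by omega, ?_, by omega, ?_, ?_⟩
          · simp only [Expr.Ok, Expr.eval, h24, a₁, h8]; omega
          · simp only [Expr.Ok, Expr.eval, h24, a₁, h8, reg_setReg, arr_setReg, reduceIte,
              Nat.add_sub_cancel, hrc]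
            omega
          · simp only [Expr.eval, h24, a₁, h8, reg_setReg, arr_setReg, reduceIte,
              Nat.add_sub_cancel, hrc]
            refine finish c hcl M _ _ ?_ ?_ (by omega) ?_ ?_ ?_ ?_ ?_ ?_ ?_
            · refine PreRep.congr_fst ?_ fun a ha => (hcl.close_fst ((p₁.used a).2 ha)).symm
              exact p₁.toPreRep.congr (by simp [reg_setReg]) (by simp [reg_setReg]) (fun b _ => rfl)
            · intro a
              rw [hcl.mem_close, ← p₁.used]
              constructor
              · rintro (h | rfl | rfl)
                · exact h
                · exact hc
                · exact S.rev_mem _ hc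
              · exact .inl
            · simp [reg_setReg]
            · simp [reg_setReg]
            · simp [reg_setReg, h4₁]
            · simp [reg_setReg, h5₁]
            · simp [reg_setReg, h10]
            · intro b _; rw [arr_setReg, arr_setReg, a₁]
            · simp only [Expr.cost]; omega
        · simp only [Expr.eval, h24, a₁] at hlt
          rcases hS' with ⟨h6, h7⟩ | ⟨c, hc, h6, h7, h8⟩
          swap
          · omega
          obtain ⟨c, hc⟩ := ν.surj M (by omega)
          have hcu : c ∉ S.used := fun h => by have := hb.num_lt h; omega
          have hcl : S.ClosesCorner x e c :=
            ⟨he, .inr ⟨hcu, fun a ha => h7 a ha (ν.lt a)⟩⟩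
          refine wp_alloc p₁.toPreRep (by omega) (by omega) hc (fun a => p₁.rot_eq_self) h24 h25 ?_
          intro s₂ hc' p₂ h26 h27 r₂ a₂
          refine finish c hcl (M + 2) _ _ p₂ ?_ le_rfl (h26.trans hc.symm) (h27.trans hc'.symm)
            ((r₂ 4 (by omega) (by omega) (by omega)).trans h4₁)
            ((r₂ 5 (by omega) (by omega) (by omega)).trans h5₁)
            ((r₂ 10 (by omega) (by omega) (by omega)).trans h10)
            (fun b hb => by rw [a₂ b (by omega), a₁]) ?_
          · intro a
            rw [hcl.mem_close]
            constructor
            · rintro (h | rfl | rfl)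
              · have := hb.num_lt h; omega
              · omega
              · omega
            · intro h1
              by_cases h2 : a = c
              · exact .inr (.inl h2)
              by_cases h3 : a = F.rev c
              · exact .inr (.inr h3)
              have h4 : ν.num a ≠ M := fun e => h2 (ν.inj (e.trans hc.symm))
              have h5 : ν.num a ≠ M + 1 := fun e => h3 (ν.inj (e.trans hc'.symm))
              exact .inl ((hb.used a).2 (by omega))
          · simp only [Expr.cost]; omega
    · simp only [Expr.eval, h4, hcr, optNum_pos_iff] at hc
      refine ⟨h4, ⟨by simp [reg_setReg, h5], S, M, hext, hb.congr (by simp [reg_setReg])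
        (by simp [reg_setReg]) (fun b _ => rfl), by omega, ?_, ?_, hz⟩, ?_⟩
      · intro x' hx'
        by_cases hxx : x' = x
        · subst hxx
          intro e he
          rw [he] at hc
          exact absurd rfl hc
        · refine hK x' ?_
          have : ν.num x' ≠ ν.num x := fun h => hxx (ν.inj h)
          omega
      · intro x' e' he' hlt
        exact hS x' e' he' (by omega)
      · simp only [Expr.cost]; omega
  · rintro s' t' h4 ⟨h5, S, M, hext, hb, hM, hK, hS, hz⟩ ht
    refine hQ S M s' t' hext ?_ (by omega) hb hz ?_
    · intro x
      by_cases hx : (F.cross x).isSome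
      · exact hK x (h.num_lt (S₀.cross_mem x hx))
      · intro e he
        rw [he] at hx
        exact absurd rfl hx
    · simp only [Expr.cost] at ht; omega

end

section

open RAM

variable {A : Type} {F : Frame A} {n m N : ℕ} {ν : DartNumbering F m N}
variable [Finite A] [DecidableEq A]

/-! ## Connecting the components -/

/-- Find, in array 7, a dart for every vertex such that the face to the left of the dart has no
crossing on its boundary. -/
def findFirst : Cmd :=
  .set 4 (.const 0) ;;
  forLoop 4 1
    (.ite (.const 0) (.add (.get 3 (.reg 4)) (.get 3 (.get 2 (.reg 4)))) .skip
      (.put 7 (.get 0 (.reg 4)) (.add (.reg 4) (.const 1))))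

/-- The entry of array 7 for the vertex `v`. -/
def FirstEntry (ν : DartNumbering F m N) (S : DartSystem F n) (s : Mem) (v : Fin n) : Prop :=
  (s.arr 7 v = 0 ∧ ∀ a ∈ S.used, S.fst a ≠ v) ∨
    ∃ d, S.Good d ∧ S.fst d = v ∧ s.arr 7 v = ν.num d + 1

theorem SysRep.get_cross {S : DartSystem F n} {M : ℕ} {s : Mem} (h : SysRep ν S M s) (a : A) :
    s.arr 3 (ν.num a) = optNum ν.num (F.cross a) := h.cross a

theorem good_iff_optNum {S : DartSystem F n} {a : A} (ha : a ∈ S.used) :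
    S.Good a ↔ ¬ 0 < optNum ν.num (F.cross a) + optNum ν.num (F.cross (S.rot a)) := by
  have h1 := optNum_pos_iff (num := ν.num) (o := F.cross a)
  have h2 := optNum_pos_iff (num := ν.num) (o := F.cross (S.rot a))
  constructor
  · rintro ⟨-, h3, h4⟩
    rw [h3] at h1 ⊢
    rw [h4] at h2 ⊢
    simp [optNum, DartSystem.optNum]
  · intro h
    refine ⟨ha, ?_, ?_⟩
    · rw [← Option.not_isSome_iff_eq_none, ← h1]; omega
    · rw [← Option.not_isSome_iff_eq_none, ← h2]; omega

theorem wp_findFirst {S : DartSystem F n} {M W t : ℕ} {s : Mem} {Q : Mem → ℕ → Prop}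
    (h : SysRep ν S M s) (hK : S.HasKites) (hW : 2 * N + 2 * n + 2 ≤ W)
    (hzero : ∀ b, 7 ≤ b → ∀ i, s.arr b i = 0)
    (hQ : ∀ s' t', SysRep ν S M s' → (∀ v, FirstEntry ν S s' v) →
      (∀ b, 8 ≤ b → ∀ i, s'.arr b i = 0) → t' ≤ t + (N + 2) * 40 → Q s' t') :
    findFirst.wp W s t Q := by
  have hMN := h.le
  refine ⟨by omega, by simp [Expr.Ok], ?_⟩
  refine wp_forLoop (L := M) (K := 25) (fun i s' => SysRep ν S M s' ∧
    (∀ v : Fin n, (s'.arr 7 v = 0 ∧ ∀ a, S.Good a → ν.num a < i → S.fst a ≠ v) ∨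
      ∃ d, S.Good d ∧ S.fst d = v ∧ s'.arr 7 v = ν.num d + 1) ∧
    (∀ b, 8 ≤ b → ∀ i, s'.arr b i = 0)) (by omega) (by omega) (by omega)
    (by simp [reg_setReg, Expr.eval]; rfl) (by omega) ?_ (fun i s hI => hI.1.reg1) ?_ ?_
  · refine ⟨h.congr (by simp [reg_setReg]) (by simp [reg_setReg]) (fun b _ => rfl), ?_, ?_⟩
    · intro v
      exact .inl ⟨hzero 7 (by omega) _, fun a _ ha => by omega⟩
    · intro b hb i; exact hzero b (by omega) i
  · rintro i s' t' hi h4 ⟨hb, hE, hz⟩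
    obtain ⟨a, ha, rfl⟩ := hb.exists_dart hi
    have hrot := hb.get_rot ha
    have hfst := hb.get_fst ha
    have hc1 := hb.get_cross a
    have hc2 := hb.get_cross (S.rot a)
    have l1 := ν.lt (S.rot a)
    have l2 := ν.optNum_le (F.cross a)
    have l3 := ν.optNum_le (F.cross (S.rot a))
    have l4 := (S.fst a).2
    refine Cmd.wp_of_post fun R hR => ?_
    simp only [Cmd.wp, Expr.Ok, Expr.eval, Expr.cost, h4, hrot, hc1, hc2, hfst]
    refine ⟨by omega, by omega, fun hpos => hR _ _ ⟨h4, ⟨?_, ?_, hz⟩, by omega⟩,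
      fun hg => ⟨by omega, by omega, hR _ _ ⟨h4, ⟨?_, ?_, ?_⟩, by omega⟩⟩⟩
    · exact hb.congr (by simp [reg_setReg]) (by simp [reg_setReg]) (fun b _ => rfl)
    · intro v
      refine (hE v).imp_left ?_
      rintro ⟨h1, h2⟩
      refine ⟨h1, fun a' ha' hlt => ?_⟩
      have : ν.num a' ≠ ν.num a := fun h => (good_iff_optNum ha).1 (ν.inj h ▸ ha') hpos
      exact h2 a' ha' (by omega)
    · refine hb.congr (by simp [reg_setReg, reg_setArr]) (by simp [reg_setReg, reg_setArr]) ?_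
      intro b hb
      funext j
      rw [arr_setReg, arr_setArr, if_neg (by omega)]
    · intro v
      rw [arr_setReg, arr_setArr, if_pos rfl]
      by_cases hv : v = S.fst a
      · exact .inr ⟨a, (good_iff_optNum ha).2 hg, hv.symm, by rw [if_pos (by rw [hv])]⟩
      · rw [if_neg (fun e => hv (Fin.ext e))]
        refine (hE v).imp_left ?_
        rintro ⟨h1, h2⟩
        refine ⟨h1, fun a' ha' hlt hf => ?_⟩
        have : ν.num a' ≠ ν.num a := fun h => hv (by rw [← hf, ν.inj h])
        exact h2 a' ha' (by omega) hf
    · intro b hb j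
      rw [arr_setReg, arr_setArr, if_neg (by omega)]
      exact hz b hb j
  · rintro s' t' h4 ⟨hb, hE, hz⟩ ht
    refine hQ s' t' hb (fun v => (hE v).imp_left ?_) hz ?_
    · rintro ⟨h1, h2⟩
      refine ⟨h1, fun a ha hf => ?_⟩
      obtain ⟨d, hd, hda⟩ := DartSystem.exists_good hK ha
      exact h2 d hd (h.num_lt hd.mem) (hda.trans hf)
    · simp only [Expr.cost] at ht
      have : (M + 1) * 35 ≤ (N + 1) * 35 := Nat.mul_le_mul_right _ (by omega)
      omega

/-- The list `q` is in array 9, its length is in register 7, and its elements are marked in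
array 8. -/
structure QueueRep (ν : DartNumbering F m N) (q : List A) (s : Mem) : Prop where
  nodup : q.Nodup
  length : s.reg 7 = q.length
  get : ∀ j (h : j < q.length), s.arr 9 j = ν.num q[j]
  mark : ∀ a, s.arr 8 (ν.num a) = if a ∈ q then 1 else 0

theorem QueueRep.congr {q : List A} {s s' : Mem} (h : QueueRep ν q s) (h7 : s'.reg 7 = s.reg 7)
    (h8 : s'.arr 8 = s.arr 8) (h9 : s'.arr 9 = s.arr 9) : QueueRep ν q s' where
  nodup := h.nodup
  length := h7.trans h.length
  get j hj := by rw [h9, h.get j hj]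
  mark a := by rw [h8, h.mark a]

theorem DartNumbering.length_le (ν : DartNumbering F m N) {q : List A} (h : q.Nodup) :
    q.length ≤ N := by
  have h1 : (q.map ν.num).Nodup := h.map ν.inj
  have h2 : (q.map ν.num).toFinset ⊆ Finset.range N := by
    intro i hi
    simp only [List.mem_toFinset, List.mem_map] at hi
    obtain ⟨a, -, rfl⟩ := hi
    exact Finset.mem_range.2 (ν.lt a)
  have h3 := Finset.card_le_card h2
  rwa [List.toFinset_card_of_nodup h1, List.length_map, Finset.card_range] at h3

/-- Append a dart to the queue unless it is marked. -/
def push (e : Expr) : Cmd :=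
  .set 11 e ;;
  .ite (.const 0) (.get 8 (.reg 11)) .skip
    (.put 8 (.reg 11) (.const 1) ;; .put 9 (.reg 7) (.reg 11) ;;
    .set 7 (.add (.reg 7) (.const 1)))

theorem wp_push {W t : ℕ} {s : Mem} {e : Expr} {q : List A} {Q : Mem → ℕ → Prop}
    (h : QueueRep ν q s) (hW : N + 1 ≤ W) {a : A} (he : e.Ok W s) (hea : e.eval s = ν.num a)
    (hQ : ∀ s' t' q', QueueRep ν q' s' → q <+: q' → a ∈ q' → (∀ b ∈ q', b ∈ q ∨ b = a) →
      (∀ r, r ≠ 7 → r ≠ 11 → s'.reg r = s.reg r) → (∀ b, b ≠ 8 → b ≠ 9 → s'.arr b = s.arr b) →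
      t' ≤ t + e.cost + 20 → Q s' t') : (push e).wp W s t Q := by
  have hm := h.mark a
  have hl := h.length
  have l1 := ν.length_le h.nodup
  have l2 := ν.lt a
  have hmark : (if a ∈ q then 1 else 0) ≤ 1 := by split_ifs <;> omega
  refine ⟨by omega, he, ?_⟩
  simp only [Cmd.wp, Expr.Ok, Expr.eval, Expr.cost, reg_setReg, arr_setReg, reg_setArr, hea, hm, hl,
    Nat.reduceEqDiff, reduceIte]
  refine ⟨by omega, by omega, fun hlt => ?_, fun hlt => ⟨by omega, by omega, by omega, by omega,
    by omega, by omega, ?_⟩⟩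
  · have ha : a ∈ q := by
      by_contra hc
      simp [hc] at hlt
    refine hQ _ _ q (h.congr (by simp [reg_setReg]) rfl rfl) (List.prefix_refl q) ha
      (fun b hb => .inl hb) ?_ (fun b _ _ => rfl) (by omega)
    intro r h1 h2
    rw [reg_setReg, if_neg h2]
  · have ha : a ∉ q := by
      intro hc
      simp [hc] at hlt
    refine hQ _ _ (q ++ [a]) ⟨?_, ?_, ?_, ?_⟩ (List.prefix_append _ _) (by simp)
      (fun b hb => by simpa using hb) ?_ ?_ (by omega)
    · exact h.nodup.append (List.nodup_singleton a) (by simpa using ha)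
    · simp [reg_setReg]
    · intro j hj
      rw [arr_setReg, arr_setArr, if_pos rfl]
      by_cases hjl : j = q.length
      · subst hjl; simp
      · have hj' : j < q.length := by simp at hj; omega
        rw [if_neg hjl, arr_setArr, if_neg (by omega), arr_setReg, h.get j hj',
          List.getElem_append_left hj']
    · intro b
      rw [arr_setReg, arr_setArr, if_neg (by omega), arr_setArr, if_pos rfl]
      by_cases hba : b = a
      · subst hba; simp
      · rw [if_neg (fun e => hba (ν.inj e)), arr_setReg, h.mark b]
        simp [hba]
    · intro r h1 h2
      rw [reg_setReg, if_neg h1, reg_setArr, reg_setArr, reg_setReg, if_neg h2]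
    · intro b h1 h2
      funext j
      rw [arr_setReg, arr_setArr, if_neg h2, arr_setArr, if_neg h1, arr_setReg]

/-- The state of the search: the darts in `q` belong to the component of the vertex `z`, and the
first `h` of them have been processed; the vertices before `v` belong to this component. -/
structure SearchState (S : DartSystem F n) (z : Fin n) (q : List A) (h v : ℕ) : Prop where
  kites : S.HasKites
  mem : ∀ a ∈ q, a ∈ S.used
  head_le : h ≤ q.length
  rot_mem : ∀ a ∈ q.take h, S.rot a ∈ q
  rev_mem : ∀ a ∈ q.take h, F.rev a ∈ q
  reach : ∀ a ∈ q, S.graph.Reachable z (S.fst a)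
  before : ∀ w : Fin n, (w : ℕ) < v → S.graph.Reachable z w
  root : ∀ a ∈ S.used, S.fst a = z → ∃ d ∈ q, S.fst d = z

namespace SearchState

variable {S : DartSystem F n} {z : Fin n} {q : List A} {h v : ℕ}

theorem grow (H : SearchState S z q h v) (hh : h < q.length) {q' : List A} (hq : q <+: q')
    (h1 : S.rot q[h] ∈ q') (h2 : F.rev q[h] ∈ q')
    (h3 : ∀ b ∈ q', b ∈ q ∨ b = S.rot q[h] ∨ b = F.rev q[h]) : SearchState S z q' (h + 1) v := by
  have hm := H.mem _ (List.getElem_mem hh)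
  have hr := H.reach _ (List.getElem_mem hh)
  have hsub : ∀ a ∈ q, a ∈ q' := fun a ha => hq.subset ha
  have htake : ∀ a ∈ q'.take (h + 1), a ∈ q.take h ∨ a = q[h] := by
    obtain ⟨r, rfl⟩ := hq
    intro a ha
    rw [List.take_append_of_le_length (by omega), List.take_succ_eq_append_getElem hh,
      List.mem_append, List.mem_singleton] at ha
    exact ha
  refine ⟨H.kites, ?_, ?_, ?_, ?_, ?_, H.before, ?_⟩
  · intro b hb
    rcases h3 b hb with hb | rfl | rfl
    · exact H.mem b hb
    · exact S.isRot.mem hm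
    · exact S.rev_mem _ hm
  · have := hq.length_le; omega
  · intro a ha
    rcases htake a ha with ha | rfl
    · exact hsub _ (H.rot_mem a ha)
    · exact h1
  · intro a ha
    rcases htake a ha with ha | rfl
    · exact hsub _ (H.rev_mem a ha)
    · exact h2
  · intro b hb
    rcases h3 b hb with hb | rfl | rfl
    · exact H.reach b hb
    · rw [S.isRot.fst _ hm]; exact hr
    · exact hr.trans (S.adj_of_mem hm).reachable
  · intro a ha hf
    obtain ⟨d, hd, hd'⟩ := H.root a ha hf
    exact ⟨d, hsub d hd, hd'⟩

/-- When the queue is exhausted, its elements are the darts of a component. -/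
theorem mem_of_fst (H : SearchState S z q q.length v) {a d : A} (hd : d ∈ q) (ha : a ∈ S.used)
    (hf : S.fst a = S.fst d) : a ∈ q := by
  refine mem_of_sameCycle (Z := {x | x ∈ q}) (fun x hx => ?_)
    (S.isRot.cyclic d (H.mem d hd) a ha hf.symm) hd
  exact H.rot_mem x (by rwa [List.take_length])

theorem skip (H : SearchState S z q h v) {d : A} (hd : d ∈ q) (hv : (S.fst d : ℕ) = v) :
    SearchState S z q h (v + 1) := by
  refine { H with before := fun w hw => ?_ }
  by_cases hwv : (w : ℕ) = v
  · rw [show w = S.fst d from Fin.ext (hwv.trans hv.symm)]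
    exact H.reach d hd
  · exact H.before w (by omega)

theorem canInsert (H : SearchState S z q q.length v) {c k k' : A} {u : Fin n} (hu : u ≠ z)
    (hc : c ∉ S.used) (hk : (k ∈ q ∧ S.fst k = z) ∨ (k = c ∧ ∀ a ∈ S.used, S.fst a ≠ z))
    (hk' : (k' ∈ S.used ∧ k' ∉ q ∧ S.fst k' = u) ∨ (k' = F.rev c ∧ ∀ a ∈ S.used, S.fst a ≠ u)) :
    S.CanInsert c k k' z u := by
  have hrot : ∀ a ∈ q, S.rot a ∈ q := fun a ha => H.rot_mem a (by rwa [List.take_length])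
  have hrev : ∀ a ∈ q, F.rev a ∈ q := fun a ha => H.rev_mem a (by rwa [List.take_length])
  refine ⟨hc, ?_, ?_, hu.symm, ?_, ?_⟩
  · exact hk.imp_left fun h => ⟨H.mem k h.1, h.2⟩
  · exact hk'.imp_left fun h => ⟨h.1, h.2.2⟩
  · intro a ha h1 h2
    rcases hk' with ⟨h3, h4, h5⟩ | ⟨-, h3⟩
    · obtain ⟨d, hd, hd'⟩ := H.root a ha h1
      have h6 := hrev a (H.mem_of_fst hd ha (h1.trans hd'.symm))
      exact h4 (H.mem_of_fst h6 h3 (h5.trans h2.symm))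
    · exact h3 _ (S.rev_mem a ha) h2
  · refine S.flat_insert_of_comp hc {a | a ∈ q} hrot hrev ?_ ?_ ?_
    · intro d e hde hd
      have h1 := hrot _ (hrev _ (hrot d hd))
      rw [H.kites d e hde] at h1
      have h2 := hrev _ h1
      rwa [F.rev_rev] at h2
    · rcases hk with hk | hk
      · exact .inl ⟨H.mem k hk.1, hk.1⟩
      · exact .inr hk.1
    · rcases hk' with hk' | hk'
      · exact .inl ⟨hk'.1, hk'.2.1⟩
      · exact .inr hk'.1

theorem insert (H : SearchState S z q q.length v) {c k k' : A} {u : Fin n}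
    (hI : S.CanInsert c k k' z u) (hu : (u : ℕ) = v) (hk : S.Good k ∨ k = c)
    (hk' : S.Good k' ∧ k' ∉ q ∨ k' = F.rev c) :
    ∀ q', q <+: q' → c ∈ q' → F.rev c ∈ q' → (∀ b ∈ q', b ∈ q ∨ b = c ∨ b = F.rev c) →
      SearchState (S.insert hI) z q' q.length (v + 1) := by
  intro q' hq h1 h2 h3
  have hsub : ∀ a ∈ q, a ∈ q' := fun a ha => hq.subset ha
  have htake : ∀ a ∈ q'.take q.length, a ∈ q := by
    obtain ⟨r, rfl⟩ := hq
    intro a ha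
    rwa [List.take_append_of_le_length le_rfl, List.take_length] at ha
  have hle : S.graph ≤ (S.insert hI).graph := (DartSystem.extends_insert hI).graph_le
  have hadj : (S.insert hI).graph.Adj z u :=
    ⟨c, .inr (.inl rfl), DartSystem.insert_fst_new hI, DartSystem.insert_fst_new' hI⟩
  refine ⟨DartSystem.insert_hasKites hI H.kites hk (hk'.imp_left And.left), ?_, hq.length_le, ?_,
    ?_, ?_, ?_, fun _ _ _ => ⟨c, h1, DartSystem.insert_fst_new hI⟩⟩
  · intro b hb
    rcases h3 b hb with hb | rfl | rfl
    · exact DartSystem.mem_insert_of_mem hI (H.mem b hb)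
    · exact .inr (.inl rfl)
    · exact .inl rfl
  · intro a ha
    have haq := htake a ha
    rw [DartSystem.insert_rot]
    by_cases hak : a = k
    · rw [hak, hI.rot_left]; exact h1
    by_cases hak' : a = k'
    · rcases hk' with hk' | hk'
      · exact absurd (hak' ▸ haq) hk'.2
      · exact absurd (hk' ▸ hak' ▸ H.mem a haq) hI.new'
    · rw [hI.rot_of_ne (H.mem a haq) hak hak']
      exact hsub _ (H.rot_mem a (by rwa [List.take_length]))
  · intro a ha
    exact hsub _ (H.rev_mem a (by rw [List.take_length]; exact htake a ha))
  · intro b hb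
    rcases h3 b hb with hb | rfl | rfl
    · rw [DartSystem.insert_fst_of_mem hI (H.mem b hb)]
      exact (H.reach b hb).mono hle
    · rw [DartSystem.insert_fst_new]
    · rw [DartSystem.insert_fst_new']
      exact hadj.reachable
  · intro w hw
    by_cases hwv : (w : ℕ) = v
    · rw [show w = u from Fin.ext (hwv.trans hu.symm)]
      exact hadj.reachable
    · exact (H.before w (by omega)).mono hle

end SearchState

/-- One step of the search, or, if the queue is exhausted, the treatment of one vertex. -/
def connectStep : Cmd :=
  .ite (.reg 6) (.reg 7)
    (.set 10 (.get 9 (.reg 6)) ;; .set 6 (.add (.reg 6) (.const 1)) ;;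
    push (.get 2 (.reg 10)) ;; push (.get 1 (.reg 10)))
    (.set 10 (.get 7 (.reg 8)) ;; .set 9 (.const 0) ;;
    .ite (.const 0) (.reg 10) (.set 9 (.get 8 (.sub (.reg 10) (.const 1)))) .skip ;;
    .ite (.const 0) (.reg 9) .skip
      (.set 24 (.const 0) ;; .set 25 (.reg 8) ;; .set 28 (.get 7 (.const 0)) ;; .set 29 (.reg 10) ;;
      addEdge ;; .put 7 (.const 0) (.add (.reg 26) (.const 1)) ;;
      .put 7 (.reg 8) (.add (.reg 27) (.const 1)) ;; push (.reg 26) ;; push (.reg 27)) ;;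
    .set 8 (.add (.reg 8) (.const 1)))

/-- The invariant of the search. -/
structure SearchInv (ν : DartNumbering F m N) (S₀ : DartSystem F n) (M₀ : ℕ) (z : Fin n)
    (S : DartSystem F n) (M : ℕ) (q : List A) (h v : ℕ) (s : Mem) : Prop where
  rep : SysRep ν S M s
  queue : QueueRep ν q s
  ext : S₀.Extends S
  first : ∀ v, FirstEntry ν S s v
  root : ∀ d, S.Good d → s.arr 7 z = ν.num d + 1 → d ∈ q
  state : SearchState S z q h v
  reg6 : s.reg 6 = h
  reg8 : s.reg 8 = v
  pos : 0 < v
  le : v ≤ n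
  size : M ≤ M₀ + 2 * v
  zero : ∀ b, 10 ≤ b → ∀ i, s.arr b i = 0

theorem FirstEntry.congr {S : DartSystem F n} {s s' : Mem} {v : Fin n} (h : FirstEntry ν S s v)
    (h7 : s'.arr 7 v = s.arr 7 v) : FirstEntry ν S s' v := by
  rw [FirstEntry, h7]; exact h

theorem FirstEntry.le {S : DartSystem F n} {s : Mem} {v : Fin n} (h : FirstEntry ν S s v) :
    s.arr 7 v ≤ N := by
  rcases h with ⟨h1, -⟩ | ⟨d, -, -, h1⟩
  · omega
  · have := ν.lt d; omega

theorem wp_connectStep {S₀ S : DartSystem F n} {M₀ M h v W t : ℕ} {q : List A} {z : Fin n} {s : Mem}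
    {Q : Mem → ℕ → Prop} (H : SearchInv ν S₀ M₀ z S M q h v s) (hz : (z : ℕ) = 0)
    (hW : 2 * N + 2 * n + 2 ≤ W) (hN : M₀ + 2 * n ≤ N) (hlt : h + v < q.length + n)
    (hQ : ∀ S' M' q' h' v' s' t', SearchInv ν S₀ M₀ z S' M' q' h' v' s' → h + v < h' + v' →
      t' + 300 * (h + v) ≤ t + 300 * (h' + v') - 10 → Q s' t') : connectStep.wp W s t Q := by
  have hq7 := H.queue.length
  have l0 := ν.length_le H.queue.nodup
  have l1 := H.state.head_le
  have l2 := H.le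
  have h6 := H.reg6
  have h8 := H.reg8
  refine ⟨⟨by omega, by omega⟩, ⟨by omega, by omega⟩, fun hlt' => ?_, fun hge => ?_⟩
  · simp only [Expr.eval, h6, hq7] at hlt'
    have hg := H.queue.get h hlt'
    set a := q[h] with ha
    have ham := H.state.mem a (List.getElem_mem hlt')
    have l3 := ν.lt a
    have l4 := ν.lt (S.rot a)
    have l5 := ν.lt (F.rev a)
    refine ⟨by omega, ?_, by omega, ?_, ?_⟩
    · simp only [Expr.Ok, Expr.eval, h6, hg]; omega
    · simp only [Expr.Ok, Expr.eval, reg_setReg, Nat.reduceEqDiff, reduceIte, h6]; omega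
    simp only [Expr.eval, reg_setReg, Nat.reduceEqDiff, reduceIte, h6, hg]
    generalize hs₁ : (s.setReg 10 _).setReg 6 _ = s₁
    have e₁ : ∀ r, r ≠ 10 → r ≠ 6 → s₁.reg r = s.reg r := by
      intro r h1 h2
      rw [← hs₁, reg_setReg, if_neg h2, reg_setReg, if_neg h1]
    have h10 : s₁.reg 10 = ν.num a := by rw [← hs₁]; simp [reg_setReg]
    have h6₁ : s₁.reg 6 = h + 1 := by rw [← hs₁]; simp [reg_setReg]
    have a₁ : s₁.arr = s.arr := by rw [← hs₁]; rfl
    have g1 := H.rep.get_rot ham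
    have g2 := H.rep.get_rev ham
    refine wp_push (a := S.rot a) (H.queue.congr (e₁ 7 (by omega) (by omega)) (by rw [a₁])
      (by rw [a₁])) (by omega) ?_ ?_ ?_
    · simp only [Expr.Ok, Expr.eval, h10, a₁, g1]; omega
    · simp only [Expr.eval, h10, a₁, g1]
    intro s₂ t₂ q₂ p₂ f₂ m₂ i₂ r₂ a₂ ht₂
    have h10₂ : s₂.reg 10 = ν.num a := (r₂ 10 (by omega) (by omega)).trans h10
    have a₂' : ∀ b, b ≠ 8 → b ≠ 9 → s₂.arr b = s.arr b := fun b h1 h2 => by rw [a₂ b h1 h2, a₁]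
    refine wp_push (a := F.rev a) p₂ (by omega) ?_ ?_ ?_
    · simp only [Expr.Ok, Expr.eval, h10₂, a₂' 1 (by omega) (by omega), g2]; omega
    · simp only [Expr.eval, h10₂, a₂' 1 (by omega) (by omega), g2]
    intro s₃ t₃ q₃ p₃ f₃ m₃ i₃ r₃ a₃ ht₃
    have a₃' : ∀ b, b ≠ 8 → b ≠ 9 → s₃.arr b = s.arr b := fun b h1 h2 => by
      rw [a₃ b h1 h2, a₂' b h1 h2]
    have e₃ : ∀ r, r ≠ 10 → r ≠ 6 → r ≠ 7 → r ≠ 11 → s₃.reg r = s.reg r := by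
      intro r h1 h2 h3 h4
      rw [r₃ r h3 h4, r₂ r h3 h4, e₁ r h1 h2]
    have hst : SearchState S z q₃ (h + 1) v := by
      refine H.state.grow hlt' (f₂.trans f₃) (f₃.subset m₂) m₃ ?_
      intro b hb
      rcases i₃ b hb with hb | hb
      · rcases i₂ b hb with hb | hb
        · exact .inl hb
        · exact .inr (.inl hb)
      · exact .inr (.inr hb)
    refine hQ S M q₃ (h + 1) v s₃ t₃ ⟨?_, p₃, H.ext, ?_, ?_, hst, ?_, ?_, H.pos, H.le, H.size, ?_⟩
      (by omega) ?_
    · exact H.rep.congr (e₃ 0 (by omega) (by omega) (by omega) (by omega))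
        (e₃ 1 (by omega) (by omega) (by omega) (by omega)) fun b hb => a₃' b (by omega) (by omega)
    · exact fun w => (H.first w).congr (by rw [a₃' 7 (by omega) (by omega)])
    · intro d hd hd'
      rw [a₃' 7 (by omega) (by omega)] at hd'
      exact f₃.subset (f₂.subset (H.root d hd hd'))
    · rw [r₃ 6 (by omega) (by omega), r₂ 6 (by omega) (by omega), h6₁]
    · rw [e₃ 8 (by omega) (by omega) (by omega) (by omega), h8]
    · intro b hb i
      rw [a₃' b (by omega) (by omega)]; exact H.zero b hb i
    · simp only [Expr.cost] at ht₂ ht₃; omega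
  · simp only [Expr.eval, h6, hq7] at hge
    obtain rfl : h = q.length := by omega
    have hvn : v < n := by omega
    let u : Fin n := ⟨v, hvn⟩
    have huv : (u : ℕ) = v := rfl
    have huz : u ≠ z := fun e => by have := H.pos; rw [← e, huv] at hz; omega
    have hf := H.first u
    have l3 := hf.le
    rw [huv] at l3
    refine ⟨by omega, ?_, by omega, by simp [Expr.Ok], ?_⟩
    · simp only [Expr.Ok, Expr.eval, h8]; omega
    simp only [Expr.eval, h8]
    generalize hs₁ : (s.setReg 10 _).setReg 9 _ = s₁
    have e₁ : ∀ r, r ≠ 9 → r ≠ 10 → s₁.reg r = s.reg r := by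
      intro r h1 h2
      rw [← hs₁, reg_setReg, if_neg h1, reg_setReg, if_neg h2]
    have h10 : s₁.reg 10 = s.arr 7 v := by rw [← hs₁]; simp [reg_setReg]
    have h9 : s₁.reg 9 = 0 := by rw [← hs₁]; simp [reg_setReg]
    have a₁ : s₁.arr = s.arr := by rw [← hs₁]; rfl
    have rest : ∀ s₂ t₂, (∀ r, r ≠ 9 → r ≠ 10 → s₂.reg r = s.reg r) → s₂.reg 10 = s.arr 7 v →
        s₂.arr = s.arr → s₂.reg 9 ≤ 1 →
        (s₂.reg 9 ≠ 0 → ∃ d ∈ q, S.fst d = u) →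
        (s₂.reg 9 = 0 → ∀ d, s.arr 7 v = ν.num d + 1 → d ∉ q) → t₂ ≤ t + 40 →
        (Cmd.ite (.const 0) (.reg 9) .skip
          (.set 24 (.const 0) ;; .set 25 (.reg 8) ;; .set 28 (.get 7 (.const 0)) ;;
          .set 29 (.reg 10) ;;
          addEdge ;; .put 7 (.const 0) (.add (.reg 26) (.const 1)) ;;
          .put 7 (.reg 8) (.add (.reg 27) (.const 1)) ;; push (.reg 26) ;; push (.reg 27)) ;;
          .set 8 (.add (.reg 8) (.const 1))).wp W s₂ t₂ Q := by
      intro s₂ t₂ e₂ h10₂ a₂ l9 hseen hnew ht₂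
      have h8₂ : s₂.reg 8 = v := (e₂ 8 (by omega) (by omega)).trans h8
      refine ⟨by simp [Expr.Ok], ⟨by omega, by omega⟩, fun hpos => ?_, fun hzer => ?_⟩
      · obtain ⟨d, hd, hd'⟩ := hseen (by simp only [Expr.eval] at hpos; omega)
        refine ⟨by omega, ?_, ?_⟩
        · simp only [Expr.Ok, Expr.eval, h8₂]; omega
        simp only [Expr.eval, h8₂]
        refine hQ S M q q.length (v + 1) _ _ ⟨?_, ?_, H.ext, ?_, ?_, H.state.skip hd (by rw [hd']),
          ?_, by simp [reg_setReg], by omega, by omega, ?_, ?_⟩ (by omega) ?_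
        · exact H.rep.congr (by simp [reg_setReg, e₂]) (by simp [reg_setReg, e₂])
            (fun b _ => by rw [arr_setReg, a₂])
        · exact H.queue.congr (by simp [reg_setReg, e₂]) (by rw [arr_setReg, a₂])
            (by rw [arr_setReg, a₂])
        · exact fun w => (H.first w).congr (by rw [arr_setReg, a₂])
        · intro d hd hd'
          rw [arr_setReg, a₂] at hd'
          exact H.root d hd hd'
        · simp [reg_setReg, e₂, h6]
        · have := H.size; omega
        · intro b hb i
          rw [arr_setReg, a₂]; exact H.zero b hb i
        · simp only [Expr.cost]; omega
      · have h90 : s₂.reg 9 = 0 := by simp only [Expr.eval] at hzer; omega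
        have hf0 := H.first z
        have l4 := hf0.le
        rw [hz] at l4
        have l5 := H.size
        refine ⟨by omega, by simp [Expr.Ok], by omega, ?_, by omega, ?_, by omega, ?_, ?_⟩
        · simp only [Expr.Ok, reg_setReg, Nat.reduceEqDiff, reduceIte, h8₂]; omega
        · simp only [Expr.Ok, Expr.eval, arr_setReg, a₂]; omega
        · simp only [Expr.Ok, reg_setReg, Nat.reduceEqDiff, reduceIte, h10₂]; omega
        simp only [Expr.eval, reg_setReg, arr_setReg, Nat.reduceEqDiff, reduceIte, h8₂, h10₂, a₂]
        generalize hs₃ : (((s₂.setReg 24 _).setReg 25 _).setReg 28 _).setReg 29 _ = s₃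
        have e₃ : ∀ r < 20, s₃.reg r = s₂.reg r := by
          intro r hr
          rw [← hs₃, reg_setReg, if_neg (by omega), reg_setReg, if_neg (by omega), reg_setReg,
            if_neg (by omega), reg_setReg, if_neg (by omega)]
        have h24 : s₃.reg 24 = 0 := by rw [← hs₃]; simp [reg_setReg]
        have h25 : s₃.reg 25 = v := by rw [← hs₃]; simp [reg_setReg]
        have h28 : s₃.reg 28 = s.arr 7 0 := by rw [← hs₃]; simp [reg_setReg]
        have h29 : s₃.reg 29 = s.arr 7 v := by rw [← hs₃]; simp [reg_setReg]
        have a₃ : s₃.arr = s.arr := by rw [← a₂, ← hs₃]; rfl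
        obtain ⟨c, hc⟩ := ν.surj M (by omega)
        have hcu : c ∉ S.used := fun h => by have := H.rep.num_lt h; omega
        obtain ⟨k, hk, hkg, hk28⟩ : ∃ k, ((k ∈ q ∧ S.fst k = z) ∨
            (k = c ∧ ∀ a ∈ S.used, S.fst a ≠ z)) ∧ (S.Good k ∨ k = c) ∧
            (s₃.reg 28 = ν.num k + 1 ∨ k = c ∧ s₃.reg 28 = 0) := by
          rcases hf0 with ⟨h1, h2⟩ | ⟨d, h1, h2, h3⟩
          · exact ⟨c, .inr ⟨rfl, h2⟩, .inr rfl, .inr ⟨rfl, by rw [h28]; rwa [hz] at h1⟩⟩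
          · exact ⟨d, .inl ⟨H.root d h1 h3, h2⟩, .inl h1, .inl (by rw [h28]; rwa [hz] at h3)⟩
        obtain ⟨k', hk', hkg', hk29⟩ : ∃ k', ((k' ∈ S.used ∧ k' ∉ q ∧ S.fst k' = u) ∨
            (k' = F.rev c ∧ ∀ a ∈ S.used, S.fst a ≠ u)) ∧ (S.Good k' ∧ k' ∉ q ∨ k' = F.rev c) ∧
            (s₃.reg 29 = ν.num k' + 1 ∨ k' = F.rev c ∧ s₃.reg 29 = 0) := by
          rcases hf with ⟨h1, h2⟩ | ⟨d, h1, h2, h3⟩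
          · exact ⟨F.rev c, .inr ⟨rfl, h2⟩, .inr rfl, .inr ⟨rfl, by rw [h29, ← huv, h1]⟩⟩
          · have := hnew h90 d h3
            exact ⟨d, .inl ⟨h1.mem, this, h2⟩, .inl ⟨h1, this⟩, .inl (by rw [h29, ← huv, h3])⟩
        have hI := H.state.canInsert huz hcu hk hk'
        refine wp_addEdge (H.rep.congr ((e₃ 0 (by omega)).trans (e₂ 0 (by omega) (by omega)))
          ((e₃ 1 (by omega)).trans (e₂ 1 (by omega) (by omega))) (fun b _ => by rw [a₃]))
          (by omega) (by omega) hc hI (by rw [h24, hz]) h25 hk28 hk29 ?_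
        intro s₄ t₄ hc' p₄ h26 h27 r₄ a₄ ht₄
        have e₄ : ∀ r < 20, r ≠ 1 → r ≠ 9 → r ≠ 10 → s₄.reg r = s.reg r := by
          intro r hr h1 h2 h3
          rw [r₄ r h1 (.inl hr), e₃ r hr, e₂ r h2 h3]
        have h8₄ : s₄.reg 8 = v := (e₄ 8 (by omega) (by omega) (by omega) (by omega)).trans h8
        refine ⟨by simp [Expr.Ok], ?_, ?_, ?_, ?_⟩
        · simp only [Expr.Ok, Expr.eval, h26]; omega
        · simp only [Expr.Ok, reg_setArr, h8₄]; omega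
        · simp only [Expr.Ok, Expr.eval, reg_setArr, h27]; omega
        simp only [Expr.eval, reg_setArr, h8₄, h26, h27]
        generalize hs₅ : (s₄.setArr 7 _ _).setArr 7 _ _ = s₅
        have e₅ : s₅.reg = s₄.reg := by rw [← hs₅]; rfl
        have a₅ : ∀ b, b ≠ 7 → s₅.arr b = s₄.arr b := by
          intro b hb
          funext j
          rw [← hs₅, arr_setArr, if_neg hb, arr_setArr, if_neg hb]
        have f₅ : ∀ w, s₅.arr 7 w = if w = v then M + 2 else if w = 0 then M + 1 else s.arr 7 w := by
          intro w
          rw [← hs₅, arr_setArr, if_pos rfl, arr_setArr, if_pos rfl, a₄ 7 (by omega), a₃]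
        refine wp_push (a := c) (H.queue.congr ?_ ?_ ?_) (by omega) ?_ ?_ ?_
        · rw [e₅, e₄ 7 (by omega) (by omega) (by omega) (by omega)]
        · rw [a₅ 8 (by omega), a₄ 8 (by omega), a₃]
        · rw [a₅ 9 (by omega), a₄ 9 (by omega), a₃]
        · simp only [Expr.Ok, e₅, h26]; omega
        · simp only [Expr.eval, e₅, h26, hc]
        intro s₆ t₆ q₆ p₆ f₆ m₆ i₆ r₆ a₆ ht₆
        have h27₆ : s₆.reg 27 = M + 1 := by rw [r₆ 27 (by omega) (by omega), e₅, h27]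
        refine wp_push (a := F.rev c) p₆ (by omega) ?_ ?_ ?_
        · simp only [Expr.Ok, h27₆]; omega
        · simp only [Expr.eval, h27₆, hc']
        intro s₇ t₇ q₇ p₇ f₇ m₇ i₇ r₇ a₇ ht₇
        have e₇ : ∀ r, r ≠ 7 → r ≠ 11 → s₇.reg r = s₄.reg r := fun r h1 h2 => by
          rw [r₇ r h1 h2, r₆ r h1 h2, e₅]
        have a₇' : ∀ b, b ≠ 8 → b ≠ 9 → s₇.arr b = s₅.arr b := fun b h1 h2 => by
          rw [a₇ b h1 h2, a₆ b h1 h2]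
        have h8₇ : s₇.reg 8 = v := (e₇ 8 (by omega) (by omega)).trans h8₄
        have hst : SearchState (S.insert hI) z q₇ q.length (v + 1) := by
          refine H.state.insert hI huv hkg hkg' q₇ (f₆.trans f₇) (f₇.subset m₆) m₇ ?_
          intro b hb
          rcases i₇ b hb with hb | hb
          · rcases i₆ b hb with hb | hb
            · exact .inl hb
            · exact .inr (.inl hb)
          · exact .inr (.inr hb)
        refine ⟨by omega, ?_, ?_⟩
        · simp only [Expr.Ok, Expr.eval, h8₇]; omega
        simp only [Expr.eval, h8₇]
        refine hQ (S.insert hI) (M + 2) q₇ q.length (v + 1) _ _ ⟨?_, ?_,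
          H.ext.trans (DartSystem.extends_insert hI), ?_, ?_, hst, ?_, by simp [reg_setReg],
          by omega, by omega, by omega, ?_⟩ (by omega) ?_
        · refine p₄.congr (by simp [reg_setReg, e₇]) (by simp [reg_setReg, e₇]) fun b hb => ?_
          rw [arr_setReg, a₇' b (by omega) (by omega), a₅ b (by omega)]
        · exact p₇.congr (by simp [reg_setReg]) rfl rfl
        · intro w
          rw [FirstEntry, arr_setReg, a₇' 7 (by omega) (by omega), f₅]
          by_cases hwv : (w : ℕ) = v
          · rw [if_pos hwv]
            refine .inr ⟨F.rev c, DartSystem.good_insert_new' hI (hkg'.imp_left And.left), ?_,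
              by rw [hc']⟩
            rw [DartSystem.insert_fst_new']
            exact Fin.ext hwv.symm
          rw [if_neg hwv]
          by_cases hw0 : (w : ℕ) = 0
          · rw [if_pos hw0]
            refine .inr ⟨c, DartSystem.good_insert_new hI hkg, ?_, by rw [hc]⟩
            rw [DartSystem.insert_fst_new]
            exact Fin.ext (hz.trans hw0.symm)
          rw [if_neg hw0]
          rcases H.first w with ⟨h1, h2⟩ | ⟨d, h1, h2, h3⟩
          · refine .inl ⟨h1, ?_⟩
            rintro a (rfl | rfl | ha)
            · rw [DartSystem.insert_fst_new']
              exact fun e => hwv (by rw [← e])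
            · rw [DartSystem.insert_fst_new]
              exact fun e => hw0 (by rw [← e, hz])
            · rw [DartSystem.insert_fst_of_mem hI ha]
              exact h2 a ha
          · refine .inr ⟨d, h1.insert hI, ?_, h3⟩
            rw [DartSystem.insert_fst_of_mem hI h1.mem, h2]
        · intro d _ hd
          rw [arr_setReg, a₇' 7 (by omega) (by omega), f₅, hz, if_neg (by have := H.pos; omega),
            if_pos rfl, ← hc] at hd
          rw [← ν.inj (Nat.succ_injective hd)]
          exact f₇.subset m₆
        · simp [reg_setReg, e₇, e₄, h6]
        · intro b hb i
          rw [arr_setReg, a₇' b (by omega) (by omega), a₅ b (by omega), a₄ b (by omega), a₃]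
          exact H.zero b hb i
        · simp only [Expr.cost] at ht₄ ht₆ ht₇ ⊢; omega
    refine ⟨by simp [Expr.Ok], ⟨by omega, by omega⟩, fun hpos => ?_, fun hzer => ?_⟩
    · simp only [Expr.eval, h10] at hpos
      obtain ⟨d, hd, hdu, hd7⟩ : ∃ d, S.Good d ∧ S.fst d = u ∧ s.arr 7 v = ν.num d + 1 := by
        rcases hf with ⟨h1, -⟩ | h1
        · rw [huv] at h1; omega
        · exact h1
      have hm := H.queue.mark d
      have hm1 : s.arr 8 (ν.num d) ≤ 1 := by rw [hm]; split_ifs <;> omega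
      refine ⟨by omega, ?_, ?_⟩
      · simp only [Expr.Ok, Expr.eval, h10, hd7, a₁, Nat.add_sub_cancel]
        have := ν.lt d
        omega
      simp only [Expr.eval, h10, hd7, a₁, Nat.add_sub_cancel]
      refine rest _ _ ?_ (by simp [reg_setReg, h10]) (by rw [arr_setReg, a₁])
        (by simp only [reg_setReg, reduceIte]; exact hm1) ?_ ?_ ?_
      · intro r h1 h2
        rw [reg_setReg, if_neg h1, e₁ r h1 h2]
      · intro h1
        simp only [reg_setReg, reduceIte, hm] at h1
        exact ⟨d, by by_contra hc; simp [hc] at h1, hdu⟩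
      · intro h1 d' hd'
        simp only [reg_setReg, reduceIte, hm] at h1
        rw [hd7] at hd'
        rw [← ν.inj (Nat.succ_injective hd')]
        intro hc
        simp [hc] at h1
      · simp only [Expr.cost]; omega
    · simp only [Expr.eval, h10] at hzer
      refine rest _ _ e₁ h10 a₁ (by omega) (fun h1 => absurd h9 h1) ?_ ?_
      · intro _ d hd
        omega
      · simp only [Expr.cost]; omega

/-- Connect the components of the graph. -/
def connect : Cmd :=
  findFirst ;; .set 6 (.const 0) ;; .set 7 (.const 0) ;;
  .ite (.const 0) (.get 7 (.const 0)) (push (.sub (.get 7 (.const 0)) (.const 1))) .skip ;;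
  .set 8 (.const 1) ;;
  .loop (.add (.reg 6) (.reg 8)) (.add (.reg 7) (.reg 0)) connectStep

theorem wp_connect {S₀ : DartSystem F n} {M₀ W t : ℕ} {s : Mem} {Q : Mem → ℕ → Prop}
    (h : SysRep ν S₀ M₀ s) (hK : S₀.HasKites) (hn : 0 < n) (hW : 2 * N + 2 * n + 2 ≤ W)
    (hN : M₀ + 2 * n ≤ N) (hzero : ∀ b, 7 ≤ b → ∀ i, s.arr b i = 0)
    (hQ : ∀ S M s' t', SysRep ν S M s' → S₀.Extends S → S.HasKites → S.graph.Connected →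
      M ≤ M₀ + 2 * n → (∀ b, 10 ≤ b → ∀ i, s'.arr b i = 0) →
      t' ≤ t + 340 * (N + n + 2) → Q s' t') : connect.wp W s t Q := by
  let z : Fin n := ⟨0, hn⟩
  have hz : (z : ℕ) = 0 := rfl
  refine wp_findFirst h hK hW hzero ?_
  intro s₁ t₁ p₁ f₁ z₁ ht₁
  refine ⟨by omega, by simp [Expr.Ok], by omega, by simp [Expr.Ok], ?_⟩
  simp only [Expr.eval]
  generalize hs₂ : (s₁.setReg 6 _).setReg 7 _ = s₂
  have e₂ : ∀ r, r ≠ 6 → r ≠ 7 → s₂.reg r = s₁.reg r := by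
    intro r h1 h2
    rw [← hs₂, reg_setReg, if_neg h2, reg_setReg, if_neg h1]
  have h6 : s₂.reg 6 = 0 := by rw [← hs₂]; simp [reg_setReg]
  have h7 : s₂.reg 7 = 0 := by rw [← hs₂]; simp [reg_setReg]
  have a₂ : s₂.arr = s₁.arr := by rw [← hs₂]; rfl
  have hf := f₁ z
  have l1 := hf.le
  rw [hz] at l1
  have q₂ : QueueRep ν [] s₂ := by
    refine ⟨List.nodup_nil, h7, fun j hj => absurd hj (by simp), fun a => ?_⟩
    rw [a₂, z₁ 8 (by omega)]; simp
  have loop : ∀ q s₃ t₃, QueueRep ν q s₃ → (∀ r, r ≠ 6 → r ≠ 7 → r ≠ 11 → s₃.reg r = s₁.reg r) →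
      s₃.reg 6 = 0 → (∀ b, b ≠ 8 → b ≠ 9 → s₃.arr b = s₁.arr b) →
      (∀ a ∈ q, a ∈ S₀.used ∧ S₀.fst a = z) → (∀ d, s₁.arr 7 z = ν.num d + 1 → d ∈ q) →
      t₃ ≤ t₁ + 100 →
      (Cmd.set 8 (.const 1) ;;
        .loop (.add (.reg 6) (.reg 8)) (.add (.reg 7) (.reg 0)) connectStep).wp W s₃ t₃ Q := by
    intro q s₃ t₃ q₃ e₃ h6₃ a₃ m₃ r₃ ht₃
    refine ⟨by omega, by simp only [Expr.Ok]; omega, ?_⟩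
    simp only [Expr.eval]
    refine Cmd.wp_loop (fun s' t' => ∃ S M q h v, SearchInv ν S₀ M₀ z S M q h v s' ∧
      t' ≤ t₃ + 2 + 300 * (h + v)) (t₃ + 2 + 300 * (N + n)) ?_ ?_ ?_ ?_ ?_
    · refine ⟨S₀, M₀, q, 0, 1, ⟨?_, ?_, .refl _, ?_, ?_, ⟨hK, fun a ha => (m₃ a ha).1, by omega,
        by simp, by simp, ?_, ?_, ?_⟩, by simp [reg_setReg, h6₃], by simp [reg_setReg], by omega, hn,
        by omega, ?_⟩, by simp only [Expr.cost]; omega⟩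
      · exact p₁.congr (by simp [reg_setReg, e₃]) (by simp [reg_setReg, e₃])
          (fun b _ => by rw [arr_setReg, a₃ b (by omega) (by omega)])
      · exact q₃.congr (by simp [reg_setReg]) rfl rfl
      · exact fun w => (f₁ w).congr (by rw [arr_setReg, a₃ 7 (by omega) (by omega)])
      · intro d _ hd
        rw [arr_setReg, a₃ 7 (by omega) (by omega)] at hd
        exact r₃ d hd
      · intro a ha
        rw [(m₃ a ha).2]
      · intro w hw
        rw [show w = z from Fin.ext (by omega)]
      · intro a ha hfa
        rcases hf with ⟨-, h1⟩ | ⟨d, -, h2, h3⟩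
        · exact absurd hfa (h1 a ha)
        · exact ⟨d, r₃ d h3, h2⟩
      · intro b hb i
        rw [arr_setReg, a₃ b (by omega) (by omega)]
        exact z₁ b (by omega) i
    · rintro s' t' ⟨S, M, q, h, v, H, ht⟩
      have := H.le
      have := H.state.head_le
      have := ν.length_le H.queue.nodup
      omega
    · rintro s' t' ⟨S, M, q, h, v, H, ht⟩
      have := H.le
      have := H.state.head_le
      have := ν.length_le H.queue.nodup
      simp only [Expr.Ok, Expr.eval, H.reg6, H.reg8, H.queue.length, H.rep.reg0]
      omega
    · rintro s' t' ⟨S, M, q, h, v, H, ht⟩ hlt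
      simp only [Expr.eval, H.reg6, H.reg8, H.queue.length, H.rep.reg0] at hlt
      refine wp_connectStep H hz hW hN hlt ?_
      intro S' M' q' h' v' s'' t'' H' hlt' ht'
      refine ⟨S', M', q', h', v', H', ?_⟩
      simp only [Expr.cost] at ht'
      omega
    · rintro s' t' ⟨S, M, q, h, v, H, ht⟩ hge
      simp only [Expr.eval, H.reg6, H.reg8, H.queue.length, H.rep.reg0] at hge
      have l2 := H.le
      have l3 := H.state.head_le
      have l4 := ν.length_le H.queue.nodup
      obtain rfl : v = n := by omega
      refine hQ S M s' _ H.rep H.ext H.state.kites ?_ H.size H.zero ?_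
      · have : Nonempty (Fin v) := ⟨z⟩
        refine ⟨fun x y => ?_⟩
        exact (H.state.before x x.2).symm.trans (H.state.before y y.2)
      · simp only [Expr.cost]; omega
  refine ⟨by simp [Expr.Ok], ?_, fun hpos => ?_, fun hzer => ?_⟩
  · simp only [Expr.Ok, Expr.eval, a₂]; omega
  · simp only [Expr.eval, a₂] at hpos
    obtain ⟨d, hd, hdz, hd7⟩ : ∃ d, S₀.Good d ∧ S₀.fst d = z ∧ s₁.arr 7 0 = ν.num d + 1 := by
      rcases hf with ⟨h1, -⟩ | h1
      · rw [hz] at h1; omega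
      · exact h1
    refine wp_push (a := d) q₂ (by omega) ?_ ?_ ?_
    · simp only [Expr.Ok, Expr.eval, a₂]; omega
    · simp only [Expr.eval, a₂, hd7, Nat.add_sub_cancel]
    intro s₃ t₃ q₃ p₃ g₃ m₃ i₃ r₃ a₃ ht₃
    refine loop q₃ s₃ t₃ p₃ ?_ ?_ ?_ ?_ ?_ ?_
    · intro r h1 h2 h3
      rw [r₃ r h2 h3, e₂ r h1 h2]
    · rw [r₃ 6 (by omega) (by omega), h6]
    · intro b h1 h2
      rw [a₃ b h1 h2, a₂]
    · intro a ha
      rcases i₃ a ha with ha | rfl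
      · simp at ha
      · exact ⟨hd.mem, hdz⟩
    · intro d' hd'
      rw [hz, hd7] at hd'
      rw [← ν.inj (Nat.succ_injective hd')]
      exact m₃
    · simp only [Expr.cost] at ht₃; omega
  · simp only [Expr.eval, a₂] at hzer
    refine loop [] s₂ _ q₂ (fun r h1 h2 _ => e₂ r h1 h2) h6 (fun b _ _ => by rw [a₂]) (by simp) ?_ ?_
    · intro d hd
      rw [hz] at hd
      omega
    · simp only [Expr.cost]; omega

end

section

variable {A : Type} {F : Frame A} {n m N : ℕ}
variable [Finite A] [DecidableEq A]

/-! ## Walks along faces -/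

namespace DartSystem

variable {S : DartSystem F n}

theorem Good.of_insert {c k k' : A} {u v : Fin n} {h : S.CanInsert c k k' u v} (hk : S.Good k)
    (hk' : S.Good k') {a : A} (ha : a ∈ S.used) (hg : (S.insert h).Good a) : S.Good a := by
  by_cases h1 : a = k
  · rw [h1]; exact hk
  by_cases h2 : a = k'
  · rw [h2]; exact hk'
  have h3 := hg.rot_uncrossed
  rw [insert_rot, h.rot_of_ne ha h1 h2] at h3
  exact ⟨ha, hg.uncrossed, h3⟩

/-- The darts in `D` belong to faces that visit every vertex at most once. -/
structure FaceDone (S : DartSystem F n) (D : Set A) : Prop where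
  mem : ∀ a ∈ D, a ∈ S.used
  next : ∀ a ∈ D, S.next a ∈ D
  simple : ∀ a ∈ D, ∀ b, S.next.SameCycle a b → S.fst a = S.fst b → a = b

/-- The darts `d :: r`, in reversed order, are a part of the boundary of a face that starts
with `i` and visits every vertex at most once; the faces in `D` are done. -/
structure Walk (S : DartSystem F n) (i d : A) (r : List A) (D : Set A) : Prop where
  kites : S.HasKites
  done : S.FaceDone D
  good : S.Good i
  not_mem : i ∉ D
  chain : (d :: r).IsChain fun b a => S.next a = b
  last : (d :: r).getLast? = some i
  nodup : ((d :: r).map S.fst).Nodup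

theorem sameCycle_of_chain {σ : Equiv.Perm A} {i d : A} {r : List A}
    (h : (d :: r).IsChain fun b a => σ a = b) (hl : (d :: r).getLast? = some i) :
    ∀ a ∈ d :: r, σ.SameCycle i a := by
  induction r generalizing d with
  | nil =>
    intro a ha
    simp only [List.getLast?_singleton, Option.some.injEq] at hl
    rw [List.mem_singleton.1 ha, hl]
  | cons p r ih =>
    rw [List.isChain_cons_cons] at h
    rw [List.getLast?_cons_cons] at hl
    have ih := ih h.2 hl
    intro a ha
    rcases List.mem_cons.1 ha with rfl | ha
    · exact (ih p (by simp)).trans ⟨1, by simpa using h.1⟩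
    · exact ih a ha

theorem eq_or_exists_of_chain {σ : Equiv.Perm A} {i d : A} {r : List A}
    (h : (d :: r).IsChain fun b a => σ a = b) (hl : (d :: r).getLast? = some i) :
    ∀ x ∈ d :: r, x = i ∨ ∃ y ∈ r, σ y = x := by
  induction r generalizing d with
  | nil =>
    intro x hx
    simp only [List.getLast?_singleton, Option.some.injEq] at hl
    rw [List.mem_singleton.1 hx, hl]
    exact .inl rfl
  | cons p r ih =>
    rw [List.isChain_cons_cons] at h
    rw [List.getLast?_cons_cons] at hl
    have ih := ih h.2 hl
    intro x hx
    rcases List.mem_cons.1 hx with rfl | hx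
    · exact .inr ⟨p, by simp, h.1⟩
    · refine (ih x hx).imp_right ?_
      rintro ⟨y, hy, hyx⟩
      exact ⟨y, List.mem_cons_of_mem _ hy, hyx⟩

theorem apply_mem_of_chain {σ : Equiv.Perm A} {d : A} {r : List A}
    (h : (d :: r).IsChain fun b a => σ a = b) : ∀ x ∈ r, σ x ∈ d :: r := by
  induction r generalizing d with
  | nil => simp
  | cons p r ih =>
    rw [List.isChain_cons_cons] at h
    have ih := ih h.2
    intro x hx
    rcases List.mem_cons.1 hx with rfl | hx
    · simp [h.1]
    · exact List.mem_cons_of_mem _ (ih x hx)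

theorem FaceDone.mem_iff {D : Set A} (h : S.FaceDone D) {a b : A} (hab : S.next.SameCycle a b) :
    a ∈ D ↔ b ∈ D :=
  ⟨mem_of_sameCycle (Z := D) h.next hab, mem_of_sameCycle (Z := D) h.next hab.symm⟩

theorem FaceDone.insert {D : Set A} (hD : S.FaceDone D) {c k k' : A} {u v : Fin n}
    (h : S.CanInsert c k k' u v) (hk : k ∉ D) (hk' : k' ∉ D) : (S.insert h).FaceDone D := by
  have hnext : ∀ a ∈ D, (S.insert h).next a = S.next a := by
    intro a ha
    have h1 := hD.next a ha
    have h2 : S.next a ≠ k := fun e => hk (by rwa [← e])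
    have h3 : S.next a ≠ k' := fun e => hk' (by rwa [← e])
    have h4 : S.next a ≠ c := fun e => h.new (by rw [← e]; exact hD.mem _ h1)
    have h5 : S.next a ≠ F.rev c := fun e => h.new' (by rw [← e]; exact hD.mem _ h1)
    rw [insert_next, Equiv.swap_apply_of_ne_of_ne h2 h4, Equiv.swap_apply_of_ne_of_ne h3 h5]
  refine ⟨fun a ha => mem_insert_of_mem h (hD.mem a ha), fun a ha => ?_, fun a ha b hab hf => ?_⟩
  · rw [hnext a ha]; exact hD.next a ha
  · have h1 := mem_of_sameCycle (Z := {x | x ∈ D ∧ S.next.SameCycle a x}) ?_ hab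
      ⟨ha, .refl _ _⟩
    · rw [insert_fst_of_mem h (hD.mem a ha), insert_fst_of_mem h (hD.mem b h1.1)] at hf
      exact hD.simple a ha b h1.2 hf
    · rintro x ⟨hx, hax⟩
      rw [Set.mem_ofPred_eq, hnext x hx]
      exact ⟨hD.next x hx, hax.trans ⟨1, by simp⟩⟩

theorem FaceDone.union {D E : Set A} (hD : S.FaceDone D) (hE : S.FaceDone E) :
    S.FaceDone (D ∪ E) where
  mem a ha := ha.elim (hD.mem a) (hE.mem a)
  next a ha := ha.imp (hD.next a) (hE.next a)
  simple a ha := ha.elim (hD.simple a) (hE.simple a)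

theorem faceDone_of_nodup {l : List A} (h1 : ∀ a ∈ l, a ∈ S.used) (h2 : ∀ a ∈ l, S.next a ∈ l)
    (h3 : (l.map S.fst).Nodup) : S.FaceDone {a | a ∈ l} := by
  refine ⟨h1, h2, fun a ha b hab hf => ?_⟩
  exact List.inj_on_of_nodup_map h3 ha (mem_of_sameCycle (Z := {a | a ∈ l}) h2 hab ha) hf

namespace Walk

variable {i d : A} {r : List A} {D : Set A}

theorem start (hK : S.HasKites) (hD : S.FaceDone D) (hi : S.Good i) (hi' : i ∉ D) :
    S.Walk i i [] D :=
  ⟨hK, hD, hi, hi', List.isChain_singleton i, rfl, by simp⟩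

theorem sameCycle (h : S.Walk i d r D) {a : A} (ha : a ∈ d :: r) : S.next.SameCycle i a :=
  sameCycle_of_chain h.chain h.last a ha

theorem good_of_mem (h : S.Walk i d r D) {a : A} (ha : a ∈ d :: r) : S.Good a :=
  h.good.of_sameCycle h.kites (h.sameCycle ha)

theorem not_mem_done (h : S.Walk i d r D) {a : A} (ha : a ∈ d :: r) : a ∉ D := fun h' =>
  h.not_mem ((h.done.mem_iff (h.sameCycle ha)).2 h')

theorem good_next (h : S.Walk i d r D) : S.Good (S.next d) :=
  (h.good_of_mem (by simp)).next h.kites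

theorem next_not_mem_done (h : S.Walk i d r D) : S.next d ∉ D := fun h' =>
  h.not_mem_done (a := d) (by simp) ((h.done.mem_iff ⟨1, by simp⟩).2 h')

theorem head_not_mem (h : S.Walk i d r D) : d ∉ r := by
  have := h.nodup.of_map
  exact (List.nodup_cons.1 this).1

theorem next_not_mem (h : S.Walk i d r D) (hne : S.next d ≠ i) : S.next d ∉ d :: r := by
  intro hm
  rcases eq_or_exists_of_chain h.chain h.last _ hm with h1 | ⟨y, hy, hyd⟩
  · exact hne h1
  · exact h.head_not_mem (S.next.injective hyd ▸ hy)

theorem finish (h : S.Walk i d r D) (hi : S.next d = i) : S.FaceDone (D ∪ {a | a ∈ d :: r}) := by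
  refine h.done.union (faceDone_of_nodup (fun a ha => (h.good_of_mem ha).mem) ?_ h.nodup)
  intro a ha
  rcases List.mem_cons.1 ha with rfl | ha
  · rw [hi]
    exact List.mem_of_getLast? h.last
  · exact apply_mem_of_chain h.chain a ha

theorem step (h : S.Walk i d r D) (hw : S.fst (S.next d) ∉ (d :: r).map S.fst) :
    S.Walk i (S.next d) (d :: r) D where
  kites := h.kites
  done := h.done
  good := h.good
  not_mem := h.not_mem
  chain := List.isChain_cons_cons.2 ⟨rfl, h.chain⟩
  last := by rw [List.getLast?_cons_cons]; exact h.last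
  nodup := by rw [List.map_cons]; exact List.nodup_cons.2 ⟨hw, h.nodup⟩

theorem canInsert (h : S.Walk i d r D) (hne : S.next d ≠ i)
    (hw : S.fst (S.next d) ∈ (d :: r).map S.fst) {c : A} (hc : c ∉ S.used) :
    S.CanInsert c d (S.next (S.next d)) (S.fst d) (S.fst (F.rev (S.next d))) := by
  obtain ⟨g, hg, hgw⟩ := List.mem_map.1 hw
  refine canInsert_chord h.kites hc (h.good_of_mem (by simp))
    ((h.sameCycle (by simp)).symm.trans (h.sameCycle hg)) ?_ hgw
  rintro rfl
  exact h.next_not_mem hne hg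

theorem chord (h : S.Walk i d r D) {e : A} (hde : S.next d = e) (hne : e ≠ i)
    (hw : S.fst e ∈ (d :: r).map S.fst) {c : A}
    (hI : S.CanInsert c d (S.next e) (S.fst d) (S.fst (F.rev e))) :
    (S.insert hI).Walk i c r (D ∪ {a | a ∈ [F.rev c, d, e]}) := by
  have hd := h.good_of_mem (a := d) (by simp)
  have he := h.good_next
  rw [hde] at he
  have hk' := he.next h.kites
  have hek : e ≠ S.next e := by
    intro h1
    have h2 := S.fst_next he.mem
    rw [← h1] at h2
    exact S.loopless e he.mem h2
  have hem : e ∉ d :: r := hde ▸ h.next_not_mem (hde ▸ hne)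
  have hdk : d ≠ S.next e := hI.ne'
  have hck : c ≠ S.next e := fun h1 => hI.new (h1 ▸ hk'.mem)
  have hcd : c ≠ d := fun h1 => hI.new (h1 ▸ hd.mem)
  have hce : c ≠ e := fun h1 => hI.new (h1 ▸ he.mem)
  have hcd' : F.rev c ≠ d := fun h1 => hI.new' (h1 ▸ hd.mem)
  have hce' : F.rev c ≠ e := fun h1 => hI.new' (h1 ▸ he.mem)
  have hcc := F.rev_ne c
  have hed : e ≠ d := fun h1 => hem (by simp [h1])
  have hr : r ≠ [] := by
    rintro rfl
    obtain ⟨g, hg, hgw⟩ := List.mem_map.1 hw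
    rw [List.mem_singleton.1 hg] at hgw
    rw [← hde, S.fst_next hd.mem] at hgw
    exact S.loopless d hd.mem hgw
  have hid : i ≠ d := by
    obtain ⟨p, r', rfl⟩ := List.exists_cons_of_ne_nil hr
    have h1 := h.last
    rw [List.getLast?_cons_cons] at h1
    rintro rfl
    exact h.head_not_mem (List.mem_of_getLast? h1)
  have n1 : (S.insert hI).next d = e := by
    rw [insert_next, hde, Equiv.swap_apply_of_ne_of_ne hed hce.symm,
      Equiv.swap_apply_of_ne_of_ne hek hce'.symm]
  have n2 : (S.insert hI).next e = F.rev c := by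
    rw [insert_next, Equiv.swap_apply_of_ne_of_ne hdk.symm hck.symm, Equiv.swap_apply_left]
  have n3 : (S.insert hI).next (F.rev c) = d := by
    have h1 : S.next (F.rev c) = c := by
      rw [S.next_apply, F.rev_rev, Equiv.Perm.inv_eq_iff_eq]
      exact (S.isRot.fixed c hI.new).symm
    rw [insert_next, h1, Equiv.swap_apply_right, Equiv.swap_apply_of_ne_of_ne hdk hcd'.symm]
  have hfd : (S.insert hI).fst d = S.fst d := insert_fst_of_mem hI hd.mem
  have hfe : (S.insert hI).fst e = S.fst e := insert_fst_of_mem hI he.mem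
  have hfe' : S.fst e ≠ S.fst (F.rev e) := S.loopless e he.mem
  have hfde : S.fst d ≠ S.fst e := by
    rw [← hde, S.fst_next hd.mem]; exact S.loopless d hd.mem
  have hrm : ∀ a ∈ r, a ∈ S.used := fun a ha => (h.good_of_mem (List.mem_cons_of_mem _ ha)).mem
  refine ⟨insert_hasKites hI h.kites (.inl hd) (.inl hk'), ?_, h.good.insert hI, ?_, ?_, ?_, ?_⟩
  · refine (h.done.insert hI (h.not_mem_done (by simp)) fun h1 => ?_).union (faceDone_of_nodup ?_ ?_ ?_)
    · exact h.next_not_mem_done ((h.done.mem_iff ⟨1, by simp [hde]⟩).2 h1)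
    · intro a ha
      simp only [List.mem_cons, List.not_mem_nil, or_false] at ha
      rcases ha with rfl | rfl | rfl
      · exact .inl rfl
      · exact mem_insert_of_mem hI hd.mem
      · exact mem_insert_of_mem hI he.mem
    · intro a ha
      simp only [List.mem_cons, List.not_mem_nil, or_false] at ha ⊢
      rcases ha with rfl | rfl | rfl
      · rw [n3]; simp
      · rw [n1]; simp
      · rw [n2]; simp
    · have h1 := hI.ne
      simp only [List.map_cons, List.map_nil, insert_fst_new', hfd, hfe, List.nodup_cons,
        List.mem_cons, List.not_mem_nil, or_false, not_or, not_false_eq_true, List.nodup_nil,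
        and_true]
      exact ⟨⟨h1.symm, hfe'.symm⟩, hfde⟩
  · rintro (h1 | h1)
    · exact h.not_mem h1
    · simp only [Set.mem_ofPred_eq, List.mem_cons, List.not_mem_nil, or_false] at h1
      rcases h1 with h1 | h1 | h1
      · exact hI.new' (h1 ▸ h.good.mem)
      · exact hid h1
      · exact hne h1.symm
  · have key : ∀ (l : List A), (∀ a ∈ l, a ∈ d :: r) → d ∉ l →
        (l.IsChain fun b a => S.next a = b) →
        l.IsChain fun b a => (S.insert hI).next a = b := by
      intro l hl hdl hch
      refine hch.imp_of_mem_imp fun b a hb ha hab => ?_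
      have h1 : b ≠ d := fun h1 => hdl (h1 ▸ hb)
      have h2 : b ∈ S.used := (h.good_of_mem (hl b hb)).mem
      have h3 : b ≠ S.next e := by
        rintro rfl
        exact hem (S.next.injective hab ▸ hl a ha)
      have h4 : b ≠ c := fun h5 => hI.new (h5 ▸ h2)
      have h5 : b ≠ F.rev c := fun h5 => hI.new' (h5 ▸ h2)
      rw [insert_next, hab, Equiv.swap_apply_of_ne_of_ne h1 h4, Equiv.swap_apply_of_ne_of_ne h3 h5]
    obtain ⟨p, r', rfl⟩ := List.exists_cons_of_ne_nil hr
    have hch := List.isChain_cons_cons.1 h.chain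
    refine List.isChain_cons_cons.2 ⟨?_, key _ (fun a ha => List.mem_cons_of_mem _ ha)
      h.head_not_mem hch.2⟩
    rw [insert_next, hch.1, Equiv.swap_apply_left, Equiv.swap_apply_of_ne_of_ne hck hcc.symm]
  · obtain ⟨p, r', rfl⟩ := List.exists_cons_of_ne_nil hr
    have h1 := h.last
    rw [List.getLast?_cons_cons] at h1 ⊢
    exact h1
  · have h1 := h.nodup
    rw [List.map_cons] at h1 ⊢
    rw [insert_fst_new, List.map_congr_left (f := (S.insert hI).fst) (g := S.fst)
      fun a ha => insert_fst_of_mem hI (hrm a ha)]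
    exact h1

end Walk

end DartSystem

end

section

open RAM

variable {A : Type} {F : Frame A} {n m N : ℕ} {ν : DartNumbering F m N}
variable [Finite A] [DecidableEq A]

/-! ## Subdividing the faces -/

/-- The number of darts below `M` that are not marked in array 10. -/
def undone (M : ℕ) (s : Mem) : ℕ := ((Finset.range M).filter fun j => s.arr 10 j = 0).card

theorem undone_le (M : ℕ) (s : Mem) : undone M s ≤ M :=
  (Finset.card_filter_le _ _).trans (Finset.card_range M).le

theorem undone_mono {M : ℕ} {s s' : Mem} (h : ∀ j, s'.arr 10 j = 0 → s.arr 10 j = 0) :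
    undone M s' ≤ undone M s :=
  Finset.card_le_card fun j hj => by
    rw [Finset.mem_filter] at hj ⊢
    exact ⟨hj.1, h j hj.2⟩

theorem undone_lt {M e : ℕ} {s s' : Mem} (he : e < M) (he' : s.arr 10 e = 0)
    (h : ∀ j, s'.arr 10 j = 0 → s.arr 10 j = 0 ∧ j ≠ e) : undone M s' < undone M s := by
  refine Finset.card_lt_card (Finset.ssubset_iff_of_subset (fun j hj => ?_) |>.2 ⟨e, ?_, ?_⟩)
  · rw [Finset.mem_filter] at hj ⊢
    exact ⟨hj.1, (h j hj.2).1⟩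
  · exact Finset.mem_filter.2 ⟨Finset.mem_range.2 he, he'⟩
  · intro h1
    exact (h e (Finset.mem_filter.1 h1).2).2 rfl

/-- Visit the next dart of the face, or cut off a triangle if its vertex has been visited. -/
def walkStep : Cmd :=
  .set 12 (.get 0 (.reg 11)) ;; .put 10 (.reg 11) (.const 1) ;; .set 13 (.get 11 (.reg 12)) ;;
  .ite (.const 0) (.add (.sub (.reg 13) (.add (.reg 4) (.const 1)))
      (.sub (.add (.reg 4) (.const 1)) (.reg 13)))
    (.put 11 (.reg 12) (.add (.reg 4) (.const 1)) ;; .set 10 (.reg 11))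
    (.set 24 (.get 0 (.reg 10)) ;; .set 25 (.get 0 (.get 1 (.reg 11))) ;;
    .set 28 (.add (.reg 10) (.const 1)) ;;
    .set 29 (.add (.get 4 (.get 1 (.reg 11))) (.const 1)) ;; addEdge ;;
    .put 10 (.reg 26) (.const 1) ;; .put 10 (.reg 27) (.const 1) ;; .set 10 (.reg 26)) ;;
  .set 11 (.get 4 (.get 1 (.reg 10)))

/-- The invariant of the walk along a face. -/
structure WalkInv (ν : DartNumbering F m N) (S₀ : DartSystem F n) (M₂ : ℕ) (i : A)
    (S : DartSystem F n) (M : ℕ) (d : A) (r : List A) (D : Set A) (s : Mem) : Prop where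
  rep : SysRep ν S M s
  ext : S₀.Extends S
  walk : S.Walk i d r D
  prev : ∀ a, S.Good a → ν.num a < ν.num i → a ∈ D
  fresh : ∀ a ∈ S.used, M₂ ≤ ν.num a → a ∈ D ∨ a ∈ d :: r
  done : ∀ a, s.arr 10 (ν.num a) ≠ 0 ↔ a ∈ D ∨ a ∈ d :: r
  done_le : ∀ j, s.arr 10 j ≤ 1
  mark_le : ∀ v : Fin n, s.arr 11 v ≤ ν.num i + 1
  mark : ∀ v : Fin n, s.arr 11 v = ν.num i + 1 ↔ v ∈ (d :: r).map S.fst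
  reg4 : s.reg 4 = ν.num i
  reg5 : s.reg 5 = M₂
  reg10 : s.reg 10 = ν.num d
  size : M + 2 * undone M₂ s ≤ 3 * M₂

theorem SysRep.get_next {S : DartSystem F n} {M : ℕ} {s : Mem} (h : SysRep ν S M s) {a : A}
    (ha : a ∈ S.used) : s.arr 4 (s.arr 1 (ν.num a)) = ν.num (S.next a) := by
  rw [h.get_rev ha, h.get_inv (S.rev_mem a ha), S.next_apply]

theorem wp_walkStep {S₀ S : DartSystem F n} {M₂ M W t : ℕ} {i d : A} {r : List A} {D : Set A}
    {s : Mem} {Q : Mem → ℕ → Prop} (H : WalkInv ν S₀ M₂ i S M d r D s)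
    (h11 : s.reg 11 = ν.num (S.next d)) (hne : S.next d ≠ i) (hW : 2 * N + 2 * n + 4 ≤ W)
    (hN : 3 * M₂ ≤ N)
    (hQ : ∀ S' M' d' r' D' s' t', WalkInv ν S₀ M₂ i S' M' d' r' D' s' →
      s'.reg 11 = ν.num (S'.next d') → undone M₂ s' < undone M₂ s → t' ≤ t + 250 → Q s' t') :
    walkStep.wp W s t Q := by
  have hd := H.walk.good_of_mem (a := d) (by simp)
  have he := H.walk.good_next
  have hem := H.walk.next_not_mem hne
  have heD := H.walk.next_not_mem_done
  generalize hde : S.next d = e at h11 hne he hem heD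
  have he0 : s.arr 10 (ν.num e) = 0 := by
    by_contra h1
    exact ((H.done e).1 h1).elim heD hem
  have heM : ν.num e < M₂ := by
    by_contra h1
    exact (H.fresh e he.mem (by omega)).elim heD hem
  have hfe := H.rep.get_fst he.mem
  have l1 := (S.fst e).2
  have l2 := ν.lt e
  have l3 := ν.lt i
  have l4 := H.mark_le (S.fst e)
  have h4 := H.reg4
  refine ⟨by omega, ?_, ?_, ?_, by omega, ?_, ?_⟩
  · simp only [Expr.Ok, Expr.eval, h11, hfe]; omega
  · simp only [Expr.Ok, reg_setReg, Nat.reduceEqDiff, reduceIte, h11]; omega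
  · simp only [Expr.Ok]; omega
  · simp only [Expr.Ok, Expr.eval, reg_setReg, reg_setArr, arr_setReg, arr_setArr, Nat.reduceEqDiff,
      reduceIte, h11, hfe]
    omega
  simp only [Expr.eval, reg_setReg, reg_setArr, arr_setReg, arr_setArr, Nat.reduceEqDiff,
    reduceIte, h11, hfe]
  generalize hs₁ : ((s.setReg 12 _).setArr 10 _ _).setReg 13 _ = s₁
  have e₁ : ∀ r, r ≠ 12 → r ≠ 13 → s₁.reg r = s.reg r := by
    intro r h1 h2
    rw [← hs₁, reg_setReg, if_neg h2, reg_setArr, reg_setReg, if_neg h1]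
  have h12 : s₁.reg 12 = S.fst e := by rw [← hs₁]; simp [reg_setReg, reg_setArr]
  have h13 : s₁.reg 13 = s.arr 11 (S.fst e) := by rw [← hs₁]; simp [reg_setReg]
  have a₁ : ∀ b, b ≠ 10 → s₁.arr b = s.arr b := by
    intro b hb
    funext j
    rw [← hs₁, arr_setReg, arr_setArr, if_neg hb, arr_setReg]
  have d₁ : ∀ j, s₁.arr 10 j = if j = ν.num e then 1 else s.arr 10 j := by
    intro j
    rw [← hs₁, arr_setReg, arr_setArr, if_pos rfl, arr_setReg]
  have h4₁ : s₁.reg 4 = ν.num i := (e₁ 4 (by omega) (by omega)).trans h4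
  have h10₁ : s₁.reg 10 = ν.num d := (e₁ 10 (by omega) (by omega)).trans H.reg10
  have h11₁ : s₁.reg 11 = ν.num e := (e₁ 11 (by omega) (by omega)).trans h11
  have rep₁ : SysRep ν S M s₁ := H.rep.congr (e₁ 0 (by omega) (by omega))
    (e₁ 1 (by omega) (by omega)) (fun b hb => a₁ b (by omega))
  have hU : undone M₂ s₁ < undone M₂ s := by
    refine undone_lt heM he0 fun j hj => ?_
    rw [d₁] at hj
    split_ifs at hj with h1
    exact ⟨hj, h1⟩
  have hsize := H.size
  have last : ∀ S' M' d' r' D' s₂ t₂, WalkInv ν S₀ M₂ i S' M' d' r' D' s₂ →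
      undone M₂ s₂ < undone M₂ s → t₂ ≤ t + 230 →
      (Cmd.set 11 (.get 4 (.get 1 (.reg 10)))).wp W s₂ t₂ Q := by
    intro S' M' d' r' D' s₂ t₂ H₂ hU₂ ht₂
    have hd' := H₂.walk.good_of_mem (a := d') (by simp)
    have g1 := H₂.rep.get_next hd'.mem
    have g2 := H₂.rep.get_rev hd'.mem
    have l5 := ν.lt d'
    have l6 := ν.lt (F.rev d')
    have l7 := ν.lt (S'.next d')
    refine ⟨by omega, ?_, ?_⟩
    · simp only [Expr.Ok, Expr.eval, H₂.reg10, g2]; rw [← g2, g1]; omega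
    simp only [Expr.eval, H₂.reg10, g1]
    refine hQ S' M' d' r' D' _ _ ⟨?_, H₂.ext, H₂.walk, H₂.prev, H₂.fresh, H₂.done,
      H₂.done_le, H₂.mark_le, H₂.mark, ?_, ?_, ?_, H₂.size⟩ (by simp [reg_setReg]) hU₂ (by simp only [Expr.cost]; omega)
    · exact H₂.rep.congr (by simp [reg_setReg]) (by simp [reg_setReg]) (fun b _ => rfl)
    · simp [reg_setReg, H₂.reg4]
    · simp [reg_setReg, H₂.reg5]
    · simp [reg_setReg, H₂.reg10]
  refine ⟨by simp [Expr.Ok], ?_, fun hlt => ?_, fun hge => ?_⟩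
  · simp only [Expr.Ok, Expr.eval, h13, h4₁]; omega
  · simp only [Expr.eval, h13, h4₁] at hlt
    have hw : S.fst e ∉ (d :: r).map S.fst := fun h1 => by
      rw [← H.mark] at h1
      omega
    refine ⟨?_, ?_, by omega, ?_, ?_⟩
    · simp only [Expr.Ok, h12]; omega
    · simp only [Expr.Ok, Expr.eval, h4₁]; omega
    · simp only [Expr.Ok, reg_setArr, h11₁]; omega
    simp only [Expr.eval, reg_setArr, h12, h4₁, h11₁]
    refine last S M e (d :: r) D _ _ ⟨?_, H.ext, ?_, H.prev, ?_, ?_, ?_, ?_, ?_, ?_, ?_, ?_, ?_⟩ ?_ ?_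
    · refine rep₁.congr (by simp [reg_setReg, reg_setArr]) (by simp [reg_setReg, reg_setArr]) ?_
      intro b hb
      funext j
      rw [arr_setReg, arr_setArr, if_neg (by omega)]
    · have := H.walk.step (by rwa [hde])
      rwa [hde] at this
    · intro a ha hM
      exact (H.fresh a ha hM).imp_right (List.mem_cons_of_mem _)
    · intro a
      rw [arr_setReg, arr_setArr, if_neg (by omega), d₁, List.mem_cons]
      by_cases hae : a = e
      · simp [hae]
      · rw [if_neg (fun h => hae (ν.inj h)), H.done a]
        simp [hae]
    · intro j
      rw [arr_setReg, arr_setArr, if_neg (by omega), d₁]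
      split_ifs
      · exact le_rfl
      · exact H.done_le j
    · intro v
      rw [arr_setReg, arr_setArr, if_pos rfl, a₁ 11 (by omega)]
      split_ifs
      · omega
      · exact H.mark_le v
    · intro v
      rw [arr_setReg, arr_setArr, if_pos rfl, a₁ 11 (by omega), List.map_cons, List.mem_cons]
      by_cases hv : v = S.fst e
      · simp [hv]
      · rw [if_neg (fun h => hv (Fin.ext h)), H.mark v]
        simp [hv]
    · simp [reg_setReg, reg_setArr, h4₁]
    · simp [reg_setReg, reg_setArr, e₁, H.reg5]
    · simp [reg_setReg]
    · have : undone M₂ ((s₁.setArr 11 (S.fst e) (ν.num i + 1)).setReg 10 (ν.num e)) ≤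
          undone M₂ s₁ := undone_mono fun j hj => by
        rwa [arr_setReg, arr_setArr, if_neg (by omega)] at hj
      omega
    · refine lt_of_le_of_lt (undone_mono fun j hj => ?_) hU
      rwa [arr_setReg, arr_setArr, if_neg (by omega)] at hj
    · simp only [Expr.cost]; omega
  · simp only [Expr.eval, h13, h4₁] at hge
    have hw : S.fst e ∈ (d :: r).map S.fst := by
      rw [← H.mark]; omega
    have hfd := rep₁.get_fst hd.mem
    have hre := rep₁.get_rev he.mem
    have hfr := rep₁.get_fst (S.rev_mem e he.mem)
    have hnx := rep₁.get_next he.mem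
    rw [hre] at hnx
    have l5 := (S.fst d).2
    have l6 := ν.lt d
    have l7 := ν.lt (F.rev e)
    have l8 := (S.fst (F.rev e)).2
    have l9 := ν.lt (S.next e)
    refine ⟨by omega, ?_, by omega, ?_, by omega, ?_, by omega, ?_, ?_⟩
    · simp only [Expr.Ok, Expr.eval, h10₁, hfd]; omega
    · simp only [Expr.Ok, Expr.eval, reg_setReg, arr_setReg, Nat.reduceEqDiff, reduceIte, h11₁, hre,
        hfr]
      omega
    · simp only [Expr.Ok, Expr.eval, reg_setReg, Nat.reduceEqDiff, reduceIte, h10₁]; omega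
    · simp only [Expr.Ok, Expr.eval, reg_setReg, arr_setReg, Nat.reduceEqDiff, reduceIte, h11₁, hre,
        hnx]
      omega
    simp only [Expr.eval, reg_setReg, arr_setReg, Nat.reduceEqDiff, reduceIte, h10₁, h11₁, hfd, hre,
      hfr, hnx]
    generalize hs₂ : (((s₁.setReg 24 _).setReg 25 _).setReg 28 _).setReg 29 _ = s₂
    have e₂ : ∀ r < 20, s₂.reg r = s₁.reg r := by
      intro r hr
      rw [← hs₂, reg_setReg, if_neg (by omega), reg_setReg, if_neg (by omega), reg_setReg,
        if_neg (by omega), reg_setReg, if_neg (by omega)]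
    have h24 : s₂.reg 24 = S.fst d := by rw [← hs₂]; simp [reg_setReg]
    have h25 : s₂.reg 25 = S.fst (F.rev e) := by rw [← hs₂]; simp [reg_setReg]
    have h28 : s₂.reg 28 = ν.num d + 1 := by rw [← hs₂]; simp [reg_setReg]
    have h29 : s₂.reg 29 = ν.num (S.next e) + 1 := by rw [← hs₂]; simp [reg_setReg]
    have a₂ : s₂.arr = s₁.arr := by rw [← hs₂]; rfl
    obtain ⟨c, hc⟩ := ν.surj M (by omega)
    have hcu : c ∉ S.used := fun h => by have := H.rep.num_lt h; omega
    have hI := H.walk.canInsert (by rwa [hde]) (by rwa [hde]) hcu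
    rw [hde] at hI
    refine wp_addEdge (rep₁.congr (e₂ 0 (by omega)) (e₂ 1 (by omega)) (fun b _ => by rw [a₂]))
      (by omega) (by omega) hc hI h24 h25 (.inl h28) (.inl h29) ?_
    intro s₃ t₃ hc' p₃ h26 h27 r₃ a₃ ht₃
    refine ⟨?_, ?_, ?_, ?_, by omega, ?_, ?_⟩
    · simp only [Expr.Ok, h26]; omega
    · simp only [Expr.Ok]; omega
    · simp only [Expr.Ok, reg_setArr, h27]; omega
    · simp only [Expr.Ok]; omega
    · simp only [Expr.Ok, reg_setArr, h26]; omega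
    simp only [Expr.eval, reg_setArr, h26, h27]
    generalize hs₄ : ((s₃.setArr 10 _ _).setArr 10 _ _).setReg 10 _ = s₄
    have e₄ : ∀ r < 20, r ≠ 10 → r ≠ 1 → r ≠ 12 → r ≠ 13 → s₄.reg r = s.reg r := by
      intro r hr h1 h2 h3 h4
      rw [← hs₄, reg_setReg, if_neg h1, reg_setArr, reg_setArr, r₃ r h2 (.inl hr), e₂ r hr,
        e₁ r h3 h4]
    have e₄' : s₄.reg 1 = s₃.reg 1 := by rw [← hs₄]; simp [reg_setReg, reg_setArr]
    have h10₄ : s₄.reg 10 = M := by rw [← hs₄]; simp [reg_setReg]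
    have a₄ : ∀ b, b ≠ 10 → s₄.arr b = s₃.arr b := by
      intro b hb
      funext j
      rw [← hs₄, arr_setReg, arr_setArr, if_neg hb, arr_setArr, if_neg hb]
    have d₄ : ∀ j, s₄.arr 10 j = if j = M + 1 then 1 else if j = M then 1 else s₁.arr 10 j := by
      intro j
      rw [← hs₄, arr_setReg, arr_setArr, if_pos rfl, arr_setArr, if_pos rfl, a₃ 10 (by omega), a₂]
    have m₄ : s₄.arr 11 = s.arr 11 := by
      rw [a₄ 11 (by omega), a₃ 11 (by omega), a₂, a₁ 11 (by omega)]
    have hU₄ : undone M₂ s₄ ≤ undone M₂ s₁ := undone_mono fun j hj => by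
      rw [d₄] at hj
      split_ifs at hj
      exact hj
    have hwalk := H.walk.chord hde hne hw hI
    have hfr : ∀ a ∈ r, (S.insert hI).fst a = S.fst a := fun a ha =>
      DartSystem.insert_fst_of_mem hI (H.walk.good_of_mem (List.mem_cons_of_mem _ ha)).mem
    refine last (S.insert hI) (M + 2) c r _ s₄ _ ⟨?_, H.ext.trans (DartSystem.extends_insert hI),
      hwalk, ?_, ?_, ?_, ?_, ?_, ?_, ?_, ?_, ?_, ?_⟩ ?_ ?_
    · refine p₃.congr ?_ e₄' (fun b hb => a₄ b (by omega))
      rw [e₄ 0 (by omega) (by omega) (by omega) (by omega) (by omega), H.rep.reg0, p₃.reg0]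
    · intro a ha hlt
      have hau : a ∈ S.used := by
        rw [H.rep.used]
        have := H.rep.num_lt H.walk.good.mem
        omega
      exact .inl (H.prev a (DartSystem.Good.of_insert hd (he.next H.walk.kites) hau ha) hlt)
    · rintro a (rfl | rfl | ha) hM
      · exact .inl (.inr (by simp))
      · exact .inr (by simp)
      · rcases H.fresh a ha hM with h1 | h1
        · exact .inl (.inl h1)
        · rcases List.mem_cons.1 h1 with rfl | h1
          · exact .inl (.inr (by simp))
          · exact .inr (List.mem_cons_of_mem _ h1)
    · intro a
      rw [d₄, d₁]
      by_cases h1 : a = F.rev c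
      · rw [h1, if_pos hc']
        simp
      rw [if_neg (fun h => h1 (ν.inj (h.trans hc'.symm)))]
      by_cases h2 : a = c
      · rw [h2, if_pos hc]
        simp
      rw [if_neg (fun h => h2 (ν.inj (h.trans hc.symm)))]
      by_cases h3 : a = e
      · rw [h3, if_pos rfl]
        simp
      rw [if_neg (fun h => h3 (ν.inj h)), H.done a]
      simp only [Set.mem_union, Set.mem_ofPred_eq, List.mem_cons, List.not_mem_nil, or_false, h1, h2,
        h3, false_or]
      tauto
    · intro j
      rw [d₄, d₁]
      split_ifs
      · exact le_rfl
      · exact le_rfl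
      · exact le_rfl
      · exact H.done_le j
    · intro v
      rw [m₄]; exact H.mark_le v
    · intro v
      rw [m₄, H.mark v, List.map_cons, List.map_cons, DartSystem.insert_fst_new,
        List.map_congr_left hfr]
    · rw [e₄ 4 (by omega) (by omega) (by omega) (by omega) (by omega), h4]
    · rw [e₄ 5 (by omega) (by omega) (by omega) (by omega) (by omega), H.reg5]
    · rw [h10₄, hc]
    · omega
    · omega
    · simp only [Expr.cost] at ht₃ ⊢; omega

/-- Subdivide the faces until they visit every vertex at most once. -/
def subdivideFaces : Cmd :=
  .set 5 (.reg 1) ;; .set 4 (.const 0) ;;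
  .loop (.reg 4) (.reg 5)
    (.ite (.const 0) (.add (.get 10 (.reg 4)) (.add (.get 3 (.reg 4)) (.get 3 (.get 2 (.reg 4)))))
      .skip
      (.put 10 (.reg 4) (.const 1) ;; .put 11 (.get 0 (.reg 4)) (.add (.reg 4) (.const 1)) ;;
      .set 10 (.reg 4) ;; .set 11 (.get 4 (.get 1 (.reg 10))) ;;
      .loop (.const 0) (.add (.sub (.reg 11) (.reg 4)) (.sub (.reg 4) (.reg 11))) walkStep) ;;
    .set 4 (.add (.reg 4) (.const 1)))

/-- The invariant of the subdivision. -/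
structure FacesInv (ν : DartNumbering F m N) (S₀ : DartSystem F n) (M₂ i : ℕ)
    (S : DartSystem F n) (M : ℕ) (D : Set A) (s : Mem) : Prop where
  rep : SysRep ν S M s
  ext : S₀.Extends S
  kites : S.HasKites
  faces : S.FaceDone D
  prev : ∀ a, S.Good a → ν.num a < i → a ∈ D
  fresh : ∀ a ∈ S.used, M₂ ≤ ν.num a → a ∈ D
  done : ∀ a, s.arr 10 (ν.num a) ≠ 0 ↔ a ∈ D
  done_le : ∀ j, s.arr 10 j ≤ 1
  mark_le : ∀ v : Fin n, s.arr 11 v ≤ i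
  reg4 : s.reg 4 = i
  reg5 : s.reg 5 = M₂
  le : i ≤ M₂
  size : M + 2 * undone M₂ s ≤ 3 * M₂

theorem wp_subdivideFaces {S₀ : DartSystem F n} {M₂ W t : ℕ} {s : Mem} {Q : Mem → ℕ → Prop}
    (h : SysRep ν S₀ M₂ s) (hK : S₀.HasKites) (hW : 2 * N + 2 * n + 4 ≤ W) (hN : 3 * M₂ ≤ N)
    (hzero : ∀ b, 10 ≤ b → ∀ i, s.arr b i = 0)
    (hQ : ∀ S M s' t', SysRep ν S M s' → S₀.Extends S → S.HasKites → S.SimpleFaces →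
      t' ≤ t + 700 * (N + 2) → Q s' t') : subdivideFaces.wp W s t Q := by
  refine ⟨by omega, ⟨by omega, by rw [h.reg1]; omega⟩, by omega, by simp [Expr.Ok], ?_⟩
  refine Cmd.wp_loop (fun s' t' => ∃ i S M D, FacesInv ν S₀ M₂ i S M D s' ∧
    t' + 300 * undone M₂ s' + 300 * (M₂ - i) ≤ t + 4 + 600 * M₂) (t + 4 + 600 * M₂) ?_ ?_ ?_ ?_ ?_
  · have hu := undone_le M₂
    refine ⟨0, S₀, M₂, ∅, ⟨?_, .refl _, hK, ⟨by simp, by simp, by simp⟩, by simp, ?_, ?_, ?_, ?_,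
      by simp [reg_setReg, Expr.eval], by simp [reg_setReg, Expr.eval, h.reg1], by omega, ?_⟩, ?_⟩
    · exact h.congr (by simp [reg_setReg]) (by simp [reg_setReg]) (fun b _ => rfl)
    · intro a ha hM
      have := h.num_lt ha
      omega
    · intro a
      rw [arr_setReg, arr_setReg, hzero 10 (by omega)]
      simp
    · intro j
      rw [arr_setReg, arr_setReg, hzero 10 (by omega)]
      omega
    · intro v
      rw [arr_setReg, arr_setReg, hzero 11 (by omega)]
    · have := hu ((s.setReg 5 ((Expr.reg 1).eval s)).setReg 4
        ((Expr.const 0).eval (s.setReg 5 ((Expr.reg 1).eval s))))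
      omega
    · have := hu ((s.setReg 5 ((Expr.reg 1).eval s)).setReg 4
        ((Expr.const 0).eval (s.setReg 5 ((Expr.reg 1).eval s))))
      simp only [Expr.cost]
      omega
  · rintro s' t' ⟨i, S, M, D, H, ht⟩
    omega
  · rintro s' t' ⟨i, S, M, D, H, ht⟩
    have := H.le
    simp only [Expr.Ok, H.reg4, H.reg5]
    omega
  · rintro s' t' ⟨j, S, M, D, H, ht⟩ hlt
    simp only [Expr.eval, H.reg4, H.reg5] at hlt
    simp only [Expr.cost]
    have l0 : M₂ ≤ M := by
      by_contra hc
      obtain ⟨a, ha⟩ := ν.surj (M₂ - 1) (by omega)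
      have := (H.ext a ((h.used a).2 (by omega))).1
      have := H.rep.num_lt this
      omega
    obtain ⟨i, hi, rfl⟩ := H.rep.exists_dart (hlt.trans_le l0)
    have h4 := H.reg4
    have hrot := H.rep.get_rot hi
    have hc1 := H.rep.get_cross i
    have hc2 := H.rep.get_cross (S.rot i)
    have hfst := H.rep.get_fst hi
    have l1 := H.done_le (ν.num i)
    have l2 := ν.optNum_le (F.cross i)
    have l3 := ν.optNum_le (F.cross (S.rot i))
    have l4 := ν.lt i
    have l5 := ν.lt (S.rot i)
    have l6 := (S.fst i).2
    have last : ∀ S₁ M₁ D₁ s₁ t₁, SysRep ν S₁ M₁ s₁ → S₀.Extends S₁ → S₁.HasKites →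
        S₁.FaceDone D₁ → (∀ a, S₁.Good a → ν.num a < ν.num i + 1 → a ∈ D₁) →
        (∀ a ∈ S₁.used, M₂ ≤ ν.num a → a ∈ D₁) → (∀ a, s₁.arr 10 (ν.num a) ≠ 0 ↔ a ∈ D₁) →
        (∀ j, s₁.arr 10 j ≤ 1) → (∀ v : Fin n, s₁.arr 11 v ≤ ν.num i + 1) →
        s₁.reg 4 = ν.num i → s₁.reg 5 = M₂ → M₁ + 2 * undone M₂ s₁ ≤ 3 * M₂ →
        t₁ + 300 * undone M₂ s₁ ≤ t' + 300 * undone M₂ s' + 90 →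
        (Cmd.set 4 (.add (.reg 4) (.const 1))).wp W s₁ t₁ fun s' t' =>
          ∃ i S M D, FacesInv ν S₀ M₂ i S M D s' ∧
            t' + 300 * undone M₂ s' + 300 * (M₂ - i) ≤ t + 4 + 600 * M₂ := by
      intro S₁ M₁ D₁ s₁ t₁ b1 b2 b3 b4 b5 b6 b7 b8 b9 b10 b11 b12 ht₁
      refine ⟨by omega, ?_, ν.num i + 1, S₁, M₁, D₁, ⟨?_, b2, b3, b4, b5, b6, b7, b8, b9, ?_, ?_,
        by omega, b12⟩, ?_⟩
      · simp only [Expr.Ok, Expr.eval, b10]; omega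
      · exact b1.congr (by simp [reg_setReg]) (by simp [reg_setReg]) (fun b _ => rfl)
      · simp [reg_setReg, Expr.eval, b10]
      · simp [reg_setReg, b11]
      · change _ + 300 * undone M₂ s₁ + _ ≤ _
        simp only [Expr.cost]
        omega
    refine ⟨by simp [Expr.Ok], ?_, fun hpos => ?_, fun hzer => ?_⟩
    · simp only [Expr.Ok, Expr.eval, h4, hrot, hc1, hc2]; omega
    · simp only [Expr.eval, h4, hrot, hc1, hc2] at hpos
      refine last S M D s' _ H.rep H.ext H.kites H.faces ?_ H.fresh H.done H.done_le
        (fun v => (H.mark_le v).trans (by omega)) h4 H.reg5 H.size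
        (by simp only [Expr.cost]; omega)
      intro a ha hlt'
      by_cases hai : a = i
      · subst hai
        have h1 := (good_iff_optNum (ν := ν) hi).1 ha
        exact (H.done a).1 (by omega)
      · refine H.prev a ha ?_
        have : ν.num a ≠ ν.num i := fun h => hai (ν.inj h)
        omega
    · simp only [Expr.eval, h4, hrot, hc1, hc2] at hzer
      have hgood : S.Good i := (good_iff_optNum (ν := ν) hi).2 (by omega)
      have hiD : i ∉ D := fun h1 => (H.done i).2 h1 (by omega)
      have hnx := H.rep.get_next hi
      have hre := H.rep.get_rev hi
      rw [hre] at hnx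
      have l7 := ν.lt (F.rev i)
      have l8 := ν.lt (S.next i)
      refine ⟨?_, ?_, ?_, ?_, by omega, ?_, by omega, ?_, ?_⟩
      · simp only [Expr.Ok, h4]; omega
      · simp only [Expr.Ok]; omega
      · simp only [Expr.Ok, Expr.eval, reg_setArr, arr_setArr, Nat.reduceEqDiff, reduceIte, h4, hfst]
        omega
      · simp only [Expr.Ok, Expr.eval, reg_setArr, h4]; omega
      · simp only [Expr.Ok, reg_setArr, h4]; omega
      · simp only [Expr.Ok, Expr.eval, reg_setReg, arr_setReg, reg_setArr, arr_setArr,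
          Nat.reduceEqDiff, reduceIte, h4, hre, hnx]
        omega
      simp only [Expr.eval, reg_setReg, arr_setReg, reg_setArr, arr_setArr, Nat.reduceEqDiff,
        reduceIte, h4, hfst, hre, hnx]
      generalize hs₁ : (((s'.setArr 10 _ _).setArr 11 _ _).setReg 10 _).setReg 11 _ = s₁
      have e₁ : ∀ r, r ≠ 10 → r ≠ 11 → s₁.reg r = s'.reg r := by
        intro r h1 h2
        rw [← hs₁, reg_setReg, if_neg h2, reg_setReg, if_neg h1, reg_setArr, reg_setArr]
      have h10 : s₁.reg 10 = ν.num i := by rw [← hs₁]; simp [reg_setReg]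
      have h11 : s₁.reg 11 = ν.num (S.next i) := by rw [← hs₁]; simp [reg_setReg]
      have a₁ : ∀ b, b ≠ 10 → b ≠ 11 → s₁.arr b = s'.arr b := by
        intro b h1 h2
        funext j
        rw [← hs₁, arr_setReg, arr_setReg, arr_setArr, if_neg h2, arr_setArr, if_neg h1]
      have d₁ : ∀ j, s₁.arr 10 j = if j = ν.num i then 1 else s'.arr 10 j := by
        intro j
        rw [← hs₁, arr_setReg, arr_setReg, arr_setArr, if_neg (by omega), arr_setArr, if_pos rfl]
      have m₁ : ∀ j, s₁.arr 11 j = if j = S.fst i then ν.num i + 1 else s'.arr 11 j := by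
        intro j
        rw [← hs₁]
        simp [arr_setReg, arr_setArr]
      have hU : undone M₂ s₁ ≤ undone M₂ s' := undone_mono fun j hj => by
        rw [d₁] at hj
        split_ifs at hj
        exact hj
      have hsize := H.size
      have W₁ : WalkInv ν S₀ M₂ i S M i [] D s₁ := by
        refine ⟨H.rep.congr (e₁ 0 (by omega) (by omega)) (e₁ 1 (by omega) (by omega))
          (fun b hb => a₁ b (by omega) (by omega)), H.ext, .start H.kites H.faces hgood hiD, H.prev,
          fun a ha hM => .inl (H.fresh a ha hM), fun a => ?_, fun j => ?_, fun v => ?_, fun v => ?_,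
          (e₁ 4 (by omega) (by omega)).trans h4, (e₁ 5 (by omega) (by omega)).trans H.reg5, h10,
          by omega⟩
        · rw [d₁]
          by_cases hai : a = i
          · simp [hai]
          · rw [if_neg (fun h => hai (ν.inj h)), H.done a]
            simp [hai]
        · rw [d₁]
          split_ifs
          · exact le_rfl
          · exact H.done_le j
        · rw [m₁]
          have := H.mark_le v
          split_ifs <;> omega
        · rw [m₁]
          have := H.mark_le v
          by_cases hv : v = S.fst i
          · simp [hv]
          · rw [if_neg (fun h => hv (Fin.ext h))]
            simp only [List.map_cons, List.map_nil, List.mem_singleton, hv, iff_false]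
            omega
      refine Cmd.wp_loop (fun s₂ t₂ => ∃ S M d r D, WalkInv ν S₀ M₂ i S M d r D s₂ ∧
        s₂.reg 11 = ν.num (S.next d) ∧
        t₂ + 300 * undone M₂ s₂ ≤ t' + 300 * undone M₂ s' + 60) (t' + 300 * undone M₂ s' + 60)
        ?_ ?_ ?_ ?_ ?_
      · exact ⟨S, M, i, [], D, W₁, h11, by simp only [Expr.cost]; omega⟩
      · rintro s₂ t₂ ⟨S₂, M', d, r, D₂, H₂, h11₂, ht₂⟩
        omega
      · rintro s₂ t₂ ⟨S₂, M', d, r, D₂, H₂, h11₂, ht₂⟩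
        have := ν.lt (S₂.next d)
        simp only [Expr.Ok, Expr.eval, H₂.reg4, h11₂]
        omega
      · rintro s₂ t₂ ⟨S₂, M', d, r, D₂, H₂, h11₂, ht₂⟩ hne
        simp only [Expr.eval, H₂.reg4, h11₂] at hne
        refine wp_walkStep H₂ h11₂ (fun h1 => by rw [h1] at hne; omega) hW hN ?_
        intro S₃ M₃ d₃ r₃ D₃ s₃ t₃ H₃ h11₃ hU₃ ht₃
        refine ⟨S₃, M₃, d₃, r₃, D₃, H₃, h11₃, ?_⟩
        simp only [Expr.cost] at ht₃
        omega
      · rintro s₂ t₂ ⟨S₂, M', d, r, D₂, H₂, h11₂, ht₂⟩ heq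
        simp only [Expr.eval, H₂.reg4, h11₂] at heq
        have hdi : S₂.next d = i := ν.inj (by omega)
        refine last S₂ M' _ s₂ _ H₂.rep H₂.ext H₂.walk.kites (H₂.walk.finish hdi) ?_ H₂.fresh
          H₂.done H₂.done_le H₂.mark_le H₂.reg4 H₂.reg5 H₂.size (by simp only [Expr.cost]; omega)
        intro a ha hlt'
        by_cases hai : a = i
        · rw [hai]
          exact .inr (List.mem_of_getLast? H₂.walk.last)
        · refine .inl (H₂.prev a ha ?_)
          have : ν.num a ≠ ν.num i := fun h => hai (ν.inj h)
          omega
  · rintro s' t' ⟨i, S, M, D, H, ht⟩ hge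
    simp only [Expr.eval, H.reg4, H.reg5] at hge
    have l1 := H.le
    refine hQ S M s' _ H.rep H.ext H.kites ?_ (by simp only [Expr.cost]; omega)
    intro d d' hd hs hf
    refine H.faces.simple d ?_ d' hs hf
    by_cases hdM : ν.num d < M₂
    · exact H.prev d hd (by omega)
    · exact H.fresh d hd.mem (by omega)

/-! ## The outer face -/

/-- Choose a face without crossings on its boundary as the outer face. -/
def chooseOuter : Cmd :=
  .set 2 (.const 0) ;; .set 4 (.const 0) ;;
  forLoop 4 1
    (.ite (.const 0) (.add (.get 3 (.reg 4)) (.get 3 (.get 2 (.reg 4)))) .skip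
      (.set 2 (.add (.reg 4) (.const 1))))

theorem wp_chooseOuter {S : DartSystem F n} {M W t : ℕ} {s : Mem} {Q : Mem → ℕ → Prop}
    (h : SysRep ν S M s) (hK : S.HasKites) (hW : 2 * N + 2 * n + 2 ≤ W)
    (hQ : ∀ s' t' o, SysRep ν S M s' → s'.reg 2 = optNum ν.num o → (∀ a, o = some a → S.Good a) →
      (∀ a ∈ S.used, o.isSome) → t' ≤ t + (N + 2) * 40 → Q s' t') :
    chooseOuter.wp W s t Q := by
  have hMN := h.le
  refine ⟨by omega, by simp [Expr.Ok], by omega, by simp [Expr.Ok], ?_⟩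
  refine wp_forLoop (L := M) (K := 25) (fun i s' => SysRep ν S M s' ∧ ∃ o,
    s'.reg 2 = optNum ν.num o ∧ (∀ a, o = some a → S.Good a) ∧
    (∀ a, S.Good a → ν.num a < i → o.isSome)) (by omega) (by omega) (by omega)
    (by simp [reg_setReg, Expr.eval]; rfl) (by omega) ?_ (fun i s hI => hI.1.reg1) ?_ ?_
  · refine ⟨h.congr (by simp [reg_setReg]) (by simp [reg_setReg]) (fun b _ => rfl), none, ?_,
      by simp, fun a _ ha => by omega⟩
    simp [reg_setReg, Expr.eval, optNum, DartSystem.optNum]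
  · rintro i s' t' hi h4 ⟨hb, o, h2, ho, ho'⟩
    obtain ⟨a, ha, rfl⟩ := hb.exists_dart hi
    have hrot := hb.get_rot ha
    have hc1 := hb.get_cross a
    have hc2 := hb.get_cross (S.rot a)
    have l1 := ν.lt (S.rot a)
    have l2 := ν.optNum_le (F.cross a)
    have l3 := ν.optNum_le (F.cross (S.rot a))
    refine Cmd.wp_of_post fun R hR => ?_
    simp only [Cmd.wp, Expr.Ok, Expr.eval, Expr.cost, h4, hrot, hc1, hc2]
    refine ⟨by omega, by omega, fun hpos => hR _ _ ⟨h4, ⟨?_, o, ?_, ho, ?_⟩, by omega⟩,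
      fun hg => ⟨by omega, by omega, hR _ _ ⟨?_, ⟨?_, some a, ?_, ?_, by simp⟩, by omega⟩⟩⟩
    · exact hb.congr (by simp [reg_setReg]) (by simp [reg_setReg]) (fun b _ => rfl)
    · simp [reg_setReg, h2]
    · intro a' ha' hlt
      have : ν.num a' ≠ ν.num a := fun h => (good_iff_optNum ha).1 (ν.inj h ▸ ha') hpos
      exact ho' a' ha' (by omega)
    · simp [reg_setReg, h4]
    · exact hb.congr (by simp [reg_setReg]) (by simp [reg_setReg]) (fun b _ => rfl)
    · simp [reg_setReg, optNum, DartSystem.optNum]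
    · rintro _ ⟨⟩
      exact (good_iff_optNum ha).2 hg
  · rintro s' t' h4 ⟨hb, o, h2, ho, ho'⟩ ht
    refine hQ s' t' o hb h2 ho ?_ ?_
    · intro a ha
      obtain ⟨d, hd, -⟩ := DartSystem.exists_good hK ha
      exact ho' d hd (h.num_lt hd.mem)
    · simp only [Expr.cost] at ht
      have : (M + 1) * 35 ≤ (N + 1) * 35 := Nat.mul_le_mul_right _ (by omega)
      omega

end

/-! ## The algorithm -/

/-- The augmentation algorithm. -/
def augment : RAM.Cmd :=
  initTables ;; findSides ;; closeCorners ;; connect ;; subdivideFaces ;; chooseOuter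

namespace ICPlaneGraph

variable {n : ℕ} (G : ICPlaneGraph n) (J : ℕ) {m : ℕ} (ι : G.graph.Dart ≃ Fin m)

/-- The numbering of the darts of `G` and of the further edges. -/
def numbering : DartNumbering (G.frame J) m (m + 2 * J) where
  num := G.extNum J ι
  inj := by
    rintro (d | ⟨i, b⟩) (e | ⟨j, c⟩) h <;> simp only [extNum, Sum.elim_inl, Sum.elim_inr] at h
    · rw [ι.injective (Fin.ext h)]
    · have := (ι d).2; omega
    · have := (ι e).2; omega
    · have hb : b.toNat ≤ 1 := by cases b <;> simp
      have hc : c.toNat ≤ 1 := by cases c <;> simp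
      have h1 : i = j := Fin.ext (by omega)
      have h2 : b.toNat = c.toNat := by omega
      have h3 : b = c := by cases b <;> cases c <;> simp at h2 ⊢
      rw [h1, h3]
  lt := by
    rintro (d | ⟨i, b⟩) <;> simp only [extNum, Sum.elim_inl, Sum.elim_inr]
    · have := (ι d).2; omega
    · have := i.2
      have hb : b.toNat ≤ 1 := by cases b <;> simp
      omega
  surj := by
    intro k hk
    by_cases h : k < m
    · exact ⟨.inl (ι.symm ⟨k, h⟩), by simp [extNum]⟩
    · refine ⟨.inr (⟨(k - m) / 2, by omega⟩, decide ((k - m) % 2 = 1)), ?_⟩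
      simp only [extNum, Sum.elim_inr]
      have : (decide ((k - m) % 2 = 1)).toNat = (k - m) % 2 := by
        rcases Nat.mod_two_eq_zero_or_one (k - m) with h1 | h1 <;> simp [h1]
      omega
  fresh := by
    rintro (d | ⟨i, b⟩) h1 h2 <;>
      simp only [extNum, Sum.elim_inl, Sum.elim_inr, frame, Sum.map_inr] at h1 h2 ⊢
    · have := (ι d).2; omega
    · cases b
      · simp
      · simp at h2; omega

theorem baseRep (hn : 0 < n) : BaseRep (G.numbering J ι) (G.system J hn).fst (G.system J hn).rot m
    (G.memory ι) := by
  have hlt : ∀ a : G.ExtDart J, (G.numbering J ι).num a < m → ∃ d, a = .inl d := by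
    rintro (d | ⟨i, b⟩) h
    · exact ⟨d, rfl⟩
    · simp only [numbering, extNum, Sum.elim_inr] at h
      omega
  have harr : ∀ b (d : G.graph.Dart), (G.memory ι).arr b (ι d) = G.entry ι d b := by
    intro b d
    simp [memory]
  refine ⟨by omega, le_rfl, by omega, ?_, rfl, rfl, ?_, ?_, ?_, ?_⟩
  · intro a ha
    obtain ⟨d, rfl⟩ := hlt a ha
    exact (ι (G.emb.rot d)).2
  · intro a ha
    obtain ⟨d, rfl⟩ := hlt a ha
    exact harr 0 d
  · intro a ha
    obtain ⟨d, rfl⟩ := hlt a ha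
    exact harr 1 d
  · intro a ha
    obtain ⟨d, rfl⟩ := hlt a ha
    exact harr 2 d
  · rintro (d | ⟨i, b⟩)
    · refine (harr 3 d).trans ?_
      change optIndex ι (G.emb.cross d) = optNum _ ((G.emb.cross d).map Sum.inl)
      cases G.emb.cross d <;> rfl
    · simp only [numbering, extNum, Sum.elim_inr, memory]
      rw [dif_neg (by omega)]
      rfl

end ICPlaneGraph

/-- There are a program `P` and a constant `C` such that, started on any representation of any
IC-plane graph `G` with `n ≥ 1` vertices, `P` halts after at most `C * n` steps, using only numbers
up to `C * n`, with the required augmentation `G'` of `G` in the memory. -/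
theorem augmentation_to_empty_kites :
    ∃ (P : RAM.Prog) (C : ℕ), ∀ (n : ℕ), 0 < n →
      ∀ (G : ICPlaneGraph n) (m : ℕ) (ι : G.graph.Dart ≃ Fin m),
        ∃ G' : ICPlaneGraph n,
          G.graph ≤ G'.graph ∧
          Biconnected G'.graph ∧
          (∀ d e : G'.graph.Dart, G'.emb.cross d = some e → G'.InducesEmptyKite d e) ∧
          ∃ (t : ℕ) (s : RAM.Mem),
            RAM.Exec (C * n) P (G.memory ι) t s ∧ t ≤ C * n ∧ G'.StoredIn s := by
  classical
  refine ⟨augment.code, 1000000, fun n hn G m ι => ?_⟩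
  have hm := G.card_dart_le hn ι
  let J := 4 * m + 3 * n
  let S₀ := G.system J hn
  let ν := G.numbering J ι
  have hN : m + 2 * J = 9 * m + 6 * n := by omega
  have hused : ∀ a, a ∈ S₀.used ↔ ν.num a < m := by
    rintro (d | ⟨i, b⟩)
    · exact ⟨fun _ => (ι d).2, fun _ => ⟨d, rfl⟩⟩
    · constructor
      · rintro ⟨d, hd⟩
        cases hd
      · intro h
        simp only [ν, ICPlaneGraph.numbering, ICPlaneGraph.extNum, Sum.elim_inr] at h
        omega
  have hzero : ∀ b, 4 ≤ b → ∀ i, (G.memory ι).arr b i = 0 := by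
    intro b hb i
    obtain ⟨b, rfl⟩ := Nat.exists_eq_add_of_le' hb
    simp only [ICPlaneGraph.memory]
    split_ifs <;> rfl
  have key : augment.wp (1000000 * n) (G.memory ι) 0 fun s t => t ≤ 1000000 * n ∧
      ∃ G' : ICPlaneGraph n, G.graph ≤ G'.graph ∧ Biconnected G'.graph ∧
        (∀ d e : G'.graph.Dart, G'.emb.cross d = some e → G'.InducesEmptyKite d e) ∧
        G'.StoredIn s := by
    refine wp_initTables (S := S₀) (ν := ν) (G.baseRep J ι hn) hused (by omega) hzero ?_
    intro s₁ t₁ p₁ c₁ z₁ ht₁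
    refine wp_findSides p₁ (by omega) c₁ z₁ ?_
    intro s₂ t₂ p₂ f₂ z₂ ht₂
    refine wp_closeCorners p₂ (by omega) (by omega) f₂ z₂ ?_
    intro S₃ M₃ s₃ t₃ x₃ k₃ l₃ p₃ z₃ ht₃
    refine wp_connect p₃ k₃ hn (by omega) (by omega) z₃ ?_
    intro S₄ M₄ s₄ t₄ p₄ x₄ k₄ g₄ l₄ z₄ ht₄
    refine wp_subdivideFaces p₄ k₄ (by omega) (by omega) z₄ ?_
    intro S₅ M₅ s₅ t₅ p₅ x₅ k₅ f₅ ht₅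
    refine wp_chooseOuter p₅ k₅ (by omega) ?_
    intro s₆ t₆ o p₆ h2 ho ho' ht₆
    refine ⟨by omega, ?_⟩
    have hle : G.graph ≤ S₅.graph := by
      refine le_trans ?_ ((x₃.trans x₄).trans x₅).graph_le
      intro u v huv
      exact ⟨.inl ⟨(u, v), huv⟩, ⟨_, rfl⟩, rfl, rfl⟩
    obtain ⟨G', h3, h4, h5, h6⟩ := S₅.exists_planeGraph k₅ f₅ (g₄.mono x₅.graph_le) ν.inj p₆.used
      (fun i hi => ν.surj i (hi.trans_le p₆.le)) ho ho' p₆.reg0 p₆.reg1 h2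
      (fun a ha => p₆.get_fst ha) (fun a ha => p₆.get_rev ha) (fun a ha => p₆.get_rot ha)
      (fun a _ => p₆.cross a)
    exact ⟨G', h3 ▸ hle, h4, h5, h6⟩
  obtain ⟨t, s₁, s', hx, hs, ht, G', h1, h2, h3, h4⟩ :=
    RAM.Cmd.runs key (G.memory ι) ⟨fun _ _ => rfl, rfl⟩
  refine ⟨G', h1, h2, h3, t, s₁, hx, by omega, ?_⟩
  obtain ⟨m', ι', h5, h6⟩ := h4
  exact ⟨m', ι', fun r hr => (hs.1 r (by omega)).trans (h5 r hr), fun a ha i hi => by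
    rw [hs.2]; exact h6 a ha i hi⟩
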